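/- An involution f ∈ Out(F) is soft if and only if no element of Out(F) of the form a₁f₁a₂f₂ has order three, where f₁, f₂ are conjugates of f in Out(F) and each of a₁, a₂ is a product of two involutions taken from a single anti-commutative conjugacy class of Out(F). -/

import Mathlib

open Pointwise

/-- A subset `S` of a free group is a basis if the canonical homomorphism
`FreeGroup S →* FreeGroup X` extending the inclusion is bijective. -/
def FreeGroup.IsBasis {X : Type*} (S : Set (FreeGroup X)) : Prop :=
  Function.Bijective (FreeGroup.lift (fun s : S => (s : FreeGroup X)))

/-- The subgroup of inner automorphisms of a group `G`, as a subgroup of `MulAut G`. -/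
def Inn (G : Type*) [Group G] : Subgroup (MulAut G) :=
  (MulAut.conj : G →* MulAut G).range

instance Inn.normal (G : Type*) [Group G] : (Inn G).Normal := by
  constructor
  rintro - ⟨g, rfl⟩ σ
  refine ⟨σ g, ?_⟩
  ext x
  simp [MulAut.conj, MulAut.mul_apply, mul_assoc]

/-- The outer automorphism group `Out G = Aut G / Inn G`. -/
abbrev OutAut (G : Type*) [Group G] := MulAut G ⧸ Inn G

/-- The natural homomorphism `Aut G → Out G`. -/
def toOut {G : Type*} [Group G] : MulAut G →* OutAut G :=
  QuotientGroup.mk' (Inn G)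

/-- `g` is an involution of the group `G`. -/
def IsInvolution {G : Type*} [Group G] (g : G) : Prop :=
  g ≠ 1 ∧ g ^ 2 = 1

/-- A subset of a group is anti-commutative if its elements pairwise do not commute. -/
def AntiCommSet {G : Type*} [Group G] (s : Set G) : Prop :=
  ∀ a ∈ s, ∀ b ∈ s, a ≠ b → a * b ≠ b * a

/-- A decomposition `U ⊔ S ⊔ ⊔_{x ∈ S} Y x` of a basis of a free group. -/
structure IsBasisDecomposition {X : Type*} (U S : Set (FreeGroup X))
    (Y : FreeGroup X → Set (FreeGroup X)) : Prop where
  isBasis : FreeGroup.IsBasis (U ∪ S ∪ ⋃ x ∈ S, Y x)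
  disjUS : Disjoint U S
  disjUY : ∀ x ∈ S, Disjoint U (Y x)
  disjSY : ∀ x ∈ S, Disjoint S (Y x)
  disjYY : ∀ x ∈ S, ∀ x' ∈ S, x ≠ x' → Disjoint (Y x) (Y x')

/-- `U ⊔ S ⊔ ⊔_{x ∈ S} Y x` is a canonical basis for the (soft) involution `φ`:
`φ` fixes `U` pointwise, inverts the elements of `S` and conjugates the elements of
`Y x` by `x`. -/
def IsCanonicalBasis {X : Type*} (φ : MulAut (FreeGroup X)) (U S : Set (FreeGroup X))
    (Y : FreeGroup X → Set (FreeGroup X)) : Prop :=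
  IsBasisDecomposition U S Y ∧
    (∀ u ∈ U, φ u = u) ∧ (∀ x ∈ S, φ x = x⁻¹) ∧
    (∀ x ∈ S, ∀ y ∈ Y x, φ y = x * y * x⁻¹)

/-- A soft involution of `Aut F`: an involution admitting a canonical basis. -/
def IsSoftInvolution {X : Type*} (φ : MulAut (FreeGroup X)) : Prop :=
  IsInvolution φ ∧ ∃ U S Y, IsCanonicalBasis φ U S Y

/-- A soft involution of `Out F`: an involution induced by a soft involution of `Aut F`. -/
def IsSoftOutInvolution {X : Type*} (f : OutAut (FreeGroup X)) : Prop :=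
  IsInvolution f ∧ ∃ φ, IsSoftInvolution φ ∧ toOut φ = f

/-- A `1`-involution of `Aut F`: a soft involution whose canonical bases have exactly
one block. -/
def IsOneInvolution {X : Type*} (ψ : MulAut (FreeGroup X)) : Prop :=
  IsInvolution ψ ∧ ∃ (U Y : Set (FreeGroup X)) (x : FreeGroup X),
    IsCanonicalBasis ψ U {x} (fun _ => Y)

/-- A `1`-involution of `Out F`: an involution induced by a `1`-involution of `Aut F`. -/
def IsOneOutInvolution {X : Type*} (f : OutAut (FreeGroup X)) : Prop :=
  IsInvolution f ∧ ∃ ψ, IsOneInvolution ψ ∧ toOut ψ = f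

/-- An extremal involution of `Aut F`: an involution inverting one element of a suitable
basis and fixing all other elements of that basis. -/
def IsExtremalInvolution {X : Type*} (φ : MulAut (FreeGroup X)) : Prop :=
  IsInvolution φ ∧ ∃ (B : Set (FreeGroup X)) (x : FreeGroup X),
    FreeGroup.IsBasis B ∧ x ∈ B ∧ φ x = x⁻¹ ∧ ∀ b ∈ B, b ≠ x → φ b = b

/-- An extremal involution of `Out F`: an involution induced by an extremal involution
of `Aut F`. -/
def IsExtremalOutInvolution {X : Type*} (f : OutAut (FreeGroup X)) : Prop :=
  IsInvolution f ∧ ∃ φ, IsExtremalInvolution φ ∧ toOut φ = f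

/-- A symmetry of `Aut F`: an involution inverting all elements of some basis. -/
def IsSymmetryAut {X : Type*} (θ : MulAut (FreeGroup X)) : Prop :=
  IsInvolution θ ∧ ∃ B : Set (FreeGroup X), FreeGroup.IsBasis B ∧ ∀ b ∈ B, θ b = b⁻¹

/-- A symmetry of `Out F`: an involution whose full preimage in `Aut F` contains a
symmetry. -/
def IsSymmetryOut {X : Type*} (f : OutAut (FreeGroup X)) : Prop :=
  IsInvolution f ∧ ∃ θ, IsSymmetryAut θ ∧ toOut θ = f

/-- Condition (★): the product set `K·K` contains exactly one conjugacy class of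
involutions, and no element of `K` is a square. -/
def StarCondition {G : Type*} [Group G] (K : Set G) : Prop :=
  (∃ c ∈ K * K, IsInvolution c ∧ ∀ d ∈ K * K, IsInvolution d → IsConj c d) ∧
    ∀ k ∈ K, ¬ ∃ g : G, g ^ 2 = k

/-- `a` is a product of two involutions taken from a single anti-commutative conjugacy
class of the group. -/
def IsProductOfTwoInvolutionsFromAntiCommClass {G : Type*} [Group G] (a : G) : Prop :=
  ∃ c : G, IsInvolution c ∧ AntiCommSet {g : G | IsConj c g} ∧
    ∃ j₁ j₂ : G, IsConj c j₁ ∧ IsConj c j₂ ∧ a = j₁ * j₂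

universe u v w

namespace CutSystem

variable {V : Type*}

/-- The edge boundary of a set of vertices, as a set of directed edges leaving the set. -/
def boundary (Γ : SimpleGraph V) (A : Set V) : Set (V × V) :=
  {e | Γ.Adj e.1 e.2 ∧ e.1 ∈ A ∧ e.2 ∉ A}

/-- Two ultrafilters are separated by a set. -/
def Sep (u v : Ultrafilter V) (A : Set V) : Prop := ¬(A ∈ u ↔ A ∈ v)

/-- All four corners of two sets are nonempty. -/
def Cross (A B : Set V) : Prop :=
  (A ∩ B).Nonempty ∧ (A ∩ Bᶜ).Nonempty ∧ (Aᶜ ∩ B).Nonempty ∧ (Aᶜ ∩ Bᶜ).Nonempty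

/-- A set is inner connected if it cannot be split into two nonadjacent nonempty parts. -/
def InnerConn (Γ : SimpleGraph V) (A : Set V) : Prop :=
  ∀ D ⊆ A, D.Nonempty → (A \ D).Nonempty → ∃ a ∈ D, ∃ b ∈ A \ D, Γ.Adj a b

/-- A cut with finite boundary and both sides nonempty and connected. -/
structure Tight (Γ : SimpleGraph V) (A : Set V) : Prop where
  nonempty : A.Nonempty
  compl_nonempty : (Aᶜ).Nonempty
  finite : (boundary Γ A).Finite
  conn : InnerConn Γ A
  conn_compl : InnerConn Γ Aᶜ

/-- A cut of minimal boundary among those separating two ultrafilters. -/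
structure SepMin (Γ : SimpleGraph V) (u v : Ultrafilter V) (A : Set V) : Prop where
  sep : Sep u v A
  finite : (boundary Γ A).Finite
  le : ∀ B, Sep u v B → (boundary Γ B).Finite →
    (boundary Γ A).ncard ≤ (boundary Γ B).ncard

/-- Minimal separating cuts of boundary size at most `N`. -/
def minCuts (Γ : SimpleGraph V) (N : ℕ) : Set (Set V) :=
  {A | (∃ u v, SepMin Γ u v A) ∧ (boundary Γ A).ncard ≤ N}

/-- The minimal cuts crossing a given set. -/
def crossing (Γ : SimpleGraph V) (N : ℕ) (A : Set V) : Set (Set V) :=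
  {C | C ∈ minCuts Γ N ∧ Cross A C}

/-- A minimal separating cut crossed by as few minimal cuts as possible. -/
structure Opt (Γ : SimpleGraph V) (N : ℕ) (u v : Ultrafilter V) (A : Set V) : Prop where
  sepMin : SepMin Γ u v A
  size : (boundary Γ A).ncard ≤ N
  least : ∀ B, SepMin Γ u v B → (crossing Γ N A).ncard ≤ (crossing Γ N B).ncard

/-- The optimal cuts of boundary size at most `N`. -/
def optCuts (Γ : SimpleGraph V) (N : ℕ) : Set (Set V) :=
  {A | ∃ u v, Opt Γ N u v A}

variable {Γ : SimpleGraph V} {N : ℕ} {u v x y : Ultrafilter V} {A B C : Set V}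

theorem Sep.symm (h : Sep u v A) : Sep v u A := fun h' => h h'.symm

theorem sep_compl : Sep u v Aᶜ ↔ Sep u v A := by
  simp only [Sep, Ultrafilter.compl_mem_iff_notMem, not_iff_not]

theorem boundary_compl : boundary Γ Aᶜ = Prod.swap '' boundary Γ A := by
  ext ⟨a, b⟩
  simp only [boundary, Set.mem_ofPred_eq, Set.mem_compl_iff, not_not, Set.mem_image, Prod.exists,
    Prod.swap_prod_mk, Prod.mk.injEq]
  constructor
  · rintro ⟨h, ha, hb⟩
    exact ⟨b, a, ⟨h.symm, hb, ha⟩, rfl, rfl⟩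
  · rintro ⟨c, d, ⟨h, hc, hd⟩, rfl, rfl⟩
    exact ⟨h.symm, hd, hc⟩

theorem ncard_boundary_compl : (boundary Γ Aᶜ).ncard = (boundary Γ A).ncard := by
  rw [boundary_compl, Set.ncard_image_of_injective _ Prod.swap_injective]

theorem finite_boundary_compl : (boundary Γ Aᶜ).Finite ↔ (boundary Γ A).Finite := by
  rw [boundary_compl, Set.finite_image_iff Prod.swap_injective.injOn]

theorem SepMin.symm (h : SepMin Γ u v A) : SepMin Γ v u A :=
  ⟨h.sep.symm, h.finite, fun B hB => h.le B hB.symm⟩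

theorem SepMin.compl (h : SepMin Γ u v A) : SepMin Γ u v Aᶜ :=
  ⟨sep_compl.2 h.sep, finite_boundary_compl.2 h.finite, fun B hB hf => by
    rw [ncard_boundary_compl]; exact h.le B hB hf⟩

theorem cross_compl_left : Cross Aᶜ B ↔ Cross A B := by
  simp only [Cross, compl_compl]; tauto

theorem cross_compl_right : Cross A Bᶜ ↔ Cross A B := by
  simp only [Cross, compl_compl]; tauto

theorem crossing_compl : crossing Γ N Aᶜ = crossing Γ N A := by
  simp only [crossing, cross_compl_left]

theorem Opt.compl (h : Opt Γ N u v A) : Opt Γ N u v Aᶜ :=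
  ⟨h.sepMin.compl, by rw [ncard_boundary_compl]; exact h.size, by
    rw [crossing_compl]; exact h.least⟩

theorem exists_boundary_of_connected (hΓ : Γ.Connected) (hA : A.Nonempty) (hA' : Aᶜ.Nonempty) :
    (boundary Γ A).Nonempty := by
  obtain ⟨a, ha⟩ := hA
  obtain ⟨b, hb⟩ := hA'
  obtain ⟨p⟩ := hΓ.preconnected a b
  obtain ⟨d, -, hd, hd'⟩ := p.exists_boundary_dart A ha hb
  exact ⟨(d.fst, d.snd), d.adj, hd, hd'⟩

theorem SepMin.conn (hΓ : Γ.Connected) (h : SepMin Γ u v A) : InnerConn Γ A := by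
  intro D hD hne hne'
  by_contra! hno
  wlog hA : A ∈ u generalizing u v
  · exact this h.symm (by have := h.sep; simp only [Sep] at this; tauto)
  have hAv : A ∉ v := fun hv => h.sep ⟨fun _ => hv, fun _ => hA⟩
  have key : ∀ D' ⊆ A, boundary Γ D' ⊂ boundary Γ A → D' ∈ u → False := by
    intro D' hD' hb hu
    have hv : D' ∉ v := fun hv => hAv (Filter.mem_of_superset hv hD')
    exact absurd (h.le D' (fun e => hv (e.1 hu)) (h.finite.subset hb.1))
      (not_le.2 (Set.ncard_lt_ncard hb h.finite))
  have hAc : ∀ z, z ∉ A → (Aᶜ).Nonempty := fun z hz => ⟨z, hz⟩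
  have hcn : (Aᶜ).Nonempty := by
    by_contra hc
    rw [Set.not_nonempty_iff_eq_empty, Set.compl_empty_iff] at hc
    exact hAv (hc ▸ Filter.univ_mem)
  have b₁ : boundary Γ D ⊆ boundary Γ A := by
    rintro ⟨a, b⟩ ⟨hab, ha, hb⟩
    exact ⟨hab, hD ha, fun hbA => hno a ha b ⟨hbA, hb⟩ hab⟩
  have b₂ : boundary Γ (A \ D) ⊆ boundary Γ A := by
    rintro ⟨a, b⟩ ⟨hab, ha, hb⟩
    refine ⟨hab, ha.1, fun hbA => ?_⟩
    have hbD : b ∈ D := by by_contra hbD; exact hb ⟨hbA, hbD⟩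
    exact hno b hbD a ha hab.symm
  obtain ⟨e₁, he₁⟩ := exists_boundary_of_connected hΓ hne
    (hcn.mono (Set.compl_subset_compl.2 hD))
  obtain ⟨e₂, he₂⟩ := exists_boundary_of_connected hΓ hne'
    (hcn.mono (Set.compl_subset_compl.2 Set.sdiff_subset))
  have hu : D ∈ u ∨ A \ D ∈ u := by
    rw [← Ultrafilter.union_mem_iff, Set.union_sdiff_cancel hD]; exact hA
  rcases hu with hu | hu
  · exact key D hD ⟨b₁, fun hs => (hs (b₂ he₂)).2.1 |> fun h' => he₂.2.1.2 h'⟩ hu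
  · exact key _ Set.sdiff_subset ⟨b₂, fun hs => (hs (b₁ he₁)).2.1.2 he₁.2.1⟩ hu

theorem SepMin.tight (hΓ : Γ.Connected) (h : SepMin Γ u v A) : Tight Γ A := by
  refine ⟨?_, ?_, h.finite, h.conn hΓ, h.compl.conn hΓ⟩
  · by_contra hc
    rw [Set.not_nonempty_iff_eq_empty] at hc
    apply h.sep; simp [hc]
  · by_contra hc
    rw [Set.not_nonempty_iff_eq_empty, Set.compl_empty_iff] at hc
    apply h.sep; rw [hc]
    exact ⟨fun _ => Filter.univ_mem, fun _ => Filter.univ_mem⟩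

theorem exists_finite_path {r : V → V → Prop} {a b : V} (h : Relation.ReflTransGen r a b) :
    ∃ P : Set (V × V), P.Finite ∧ (∀ e ∈ P, r e.1 e.2) ∧
      ∀ A : Set V, a ∈ A → b ∉ A → ∃ e ∈ P, e.1 ∈ A ∧ e.2 ∉ A := by
  induction h with
  | refl => exact ⟨∅, Set.finite_empty, by simp, fun A h h' => absurd h h'⟩
  | @tail b c _ hbc ih =>
    obtain ⟨P, hP, hr, hA⟩ := ih
    refine ⟨insert (b, c) P, hP.insert _, ?_, ?_⟩
    · rintro e (rfl | he)
      · exact hbc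
      · exact hr e he
    · intro A ha hc
      by_cases hb : b ∈ A
      · exact ⟨(b, c), Set.mem_insert _ _, hb, hc⟩
      · obtain ⟨e, he, h⟩ := hA A ha hb
        exact ⟨e, Set.mem_insert_of_mem _ he, h⟩

theorem InnerConn.reachable {R : Set (V × V)} (hA : InnerConn Γ A) {a b : V}
    (hR : ∀ e ∈ R, ¬(e.1 ∈ A ∧ e.2 ∈ A)) (ha : a ∈ A) (hb : b ∈ A) :
    Relation.ReflTransGen (fun p q => Γ.Adj p q ∧ (p, q) ∉ R) a b := by
  by_contra hab
  obtain ⟨p, hp, q, hq, hpq⟩ := hA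
    {c | c ∈ A ∧ Relation.ReflTransGen (fun p q => Γ.Adj p q ∧ (p, q) ∉ R) a c}
    (fun c hc => hc.1) ⟨a, ha, .refl⟩ ⟨b, hb, fun h => hab h.2⟩
  exact hq.2 ⟨hq.1, hp.2.tail ⟨hpq, fun h => hR _ h ⟨hp.1, hq.1⟩⟩⟩

theorem finite_tight_aux (a b : V) (n : ℕ) : ∀ R : Set (V × V),
    {A | Tight Γ A ∧ a ∈ A ∧ b ∉ A ∧ R ⊆ boundary Γ A ∧ (boundary Γ A \ R).ncard ≤ n}.Finite := by
  induction n with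
  | zero | succ n ih =>
    intro R
    by_cases hw : Relation.ReflTransGen (fun p q => Γ.Adj p q ∧ (p, q) ∉ R) a b
    · obtain ⟨P, hP, hr, hA⟩ := exists_finite_path hw
      first
      | refine Set.finite_empty.subset ?_
        rintro A ⟨hT, ha, hb, hRA, hn⟩
        obtain ⟨e, he, he₁, he₂⟩ := hA A ha hb
        have : e ∈ boundary Γ A \ R := ⟨⟨(hr e he).1, he₁, he₂⟩, (hr e he).2⟩
        rw [Nat.le_zero, Set.ncard_eq_zero (hT.finite.subset Set.sdiff_subset)] at hn
        exact absurd this (by rw [hn]; exact Set.notMem_empty e)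
      | refine (hP.biUnion fun e _ => ih (insert e R)).subset ?_
        rintro A ⟨hT, ha, hb, hRA, hn⟩
        obtain ⟨e, he, he₁, he₂⟩ := hA A ha hb
        have heA : e ∈ boundary Γ A := ⟨(hr e he).1, he₁, he₂⟩
        refine Set.mem_biUnion he ⟨hT, ha, hb, Set.insert_subset heA hRA, ?_⟩
        have hlt : (boundary Γ A \ insert e R).ncard < (boundary Γ A \ R).ncard := by
          apply Set.ncard_lt_ncard _ (hT.finite.subset Set.sdiff_subset)
          refine ⟨Set.sdiff_subset_sdiff_right (Set.subset_insert _ _), fun hs => ?_⟩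
          exact (hs ⟨heA, (hr e he).2⟩).2 (Set.mem_insert _ _)
        omega
    · refine (Set.finite_singleton
        {c | Relation.ReflTransGen (fun p q => Γ.Adj p q ∧ (p, q) ∉ R) a c}).subset ?_
      rintro A ⟨hT, ha, hb, hRA, -⟩
      ext c
      constructor
      · intro hc
        exact hT.conn.reachable (fun e he h => (hRA he).2.2 h.2) ha hc
      · intro hc
        by_contra hcA
        exact hw (Relation.ReflTransGen.trans hc
          (hT.conn_compl.reachable (fun e he h => h.1 (hRA he).2.1) hcA hb))

theorem finite_tight (a b : V) (n : ℕ) :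
    {A | Tight Γ A ∧ a ∈ A ∧ b ∉ A ∧ (boundary Γ A).ncard ≤ n}.Finite := by
  refine (finite_tight_aux (Γ := Γ) a b n ∅).subset ?_
  rintro A ⟨h₁, h₂, h₃, h₄⟩
  exact ⟨h₁, h₂, h₃, Set.empty_subset _, by simpa using h₄⟩

theorem finite_crossing (hΓ : Γ.Connected) (hA : (boundary Γ A).Finite) :
    (crossing Γ N A).Finite := by
  set E : Set V := Prod.fst '' boundary Γ A ∪ Prod.snd '' boundary Γ A with hE
  have hEf : E.Finite := (hA.image _).union (hA.image _)
  refine ((hEf.prod hEf).biUnion fun e _ => finite_tight (Γ := Γ) e.1 e.2 N).subset ?_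
  rintro C ⟨⟨⟨u, v, hC⟩, hN⟩, hX⟩
  have hT := hC.tight hΓ
  have key : ∀ D : Set V, InnerConn Γ D → (A ∩ D).Nonempty → (Aᶜ ∩ D).Nonempty →
      ∃ e ∈ E, e ∈ D := by
    rintro D hD ⟨p, hp⟩ ⟨q, hq⟩
    obtain ⟨a, ha, b, hb, hab⟩ := hD (A ∩ D) Set.inter_subset_right ⟨p, hp⟩
      ⟨q, hq.2, fun h => hq.1 h.1⟩
    exact ⟨a, Or.inl ⟨(a, b), ⟨hab, ha.1, fun h => hb.2 ⟨h, hb.1⟩⟩, rfl⟩, ha.2⟩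
  obtain ⟨a, haE, haC⟩ := key C hT.conn hX.1 hX.2.2.1
  obtain ⟨b, hbE, hbC⟩ := key Cᶜ hT.conn_compl hX.2.1 hX.2.2.2
  exact Set.mem_biUnion (x := (a, b)) ⟨haE, hbE⟩ ⟨hT, haC, hbC, hN⟩

theorem ncard_add_ncard_le {α : Type*} {S T S' T' : Set α} (hS : S.Finite) (hT : T.Finite)
    (hu : S' ∪ T' ⊆ S ∪ T) (hi : S' ∩ T' ⊆ S ∩ T) :
    S'.ncard + T'.ncard ≤ S.ncard + T.ncard := by
  have hST := hS.union hT
  have hS' : S'.Finite := hST.subset (Set.subset_union_left.trans hu)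
  have hT' : T'.Finite := hST.subset (Set.subset_union_right.trans hu)
  rw [← Set.ncard_union_add_ncard_inter S' T' hS' hT',
    ← Set.ncard_union_add_ncard_inter S T hS hT]
  exact add_le_add (Set.ncard_le_ncard hu hST) (Set.ncard_le_ncard hi (hS.inter_of_left T))

theorem ncard_add_ncard_lt {α : Type*} {S T S' T' : Set α} (hS : S.Finite) (hT : T.Finite)
    (hu : S' ∪ T' ⊂ S ∪ T) (hi : S' ∩ T' ⊆ S ∩ T) :
    S'.ncard + T'.ncard < S.ncard + T.ncard := by
  have hST := hS.union hT
  have hS' : S'.Finite := hST.subset (Set.subset_union_left.trans hu.1)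
  have hT' : T'.Finite := hST.subset (Set.subset_union_right.trans hu.1)
  rw [← Set.ncard_union_add_ncard_inter S' T' hS' hT',
    ← Set.ncard_union_add_ncard_inter S T hS hT]
  exact add_lt_add_of_lt_of_le (Set.ncard_lt_ncard hu hST)
    (Set.ncard_le_ncard hi (hS.inter_of_left T))

theorem boundary_inter_subset : boundary Γ (A ∩ B) ⊆ boundary Γ A ∪ boundary Γ B := by
  rintro ⟨a, b⟩ ⟨hab, ha, hb⟩
  by_cases h : b ∈ A
  · exact Or.inr ⟨hab, ha.2, fun h' => hb ⟨h, h'⟩⟩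
  · exact Or.inl ⟨hab, ha.1, h⟩

theorem finite_boundary_inter (hA : (boundary Γ A).Finite) (hB : (boundary Γ B).Finite) :
    (boundary Γ (A ∩ B)).Finite :=
  (hA.union hB).subset boundary_inter_subset

theorem ncard_boundary_corners (hA : (boundary Γ A).Finite) (hB : (boundary Γ B).Finite) :
    (boundary Γ (A ∩ B)).ncard + (boundary Γ (Aᶜ ∩ Bᶜ)).ncard ≤
      (boundary Γ A).ncard + (boundary Γ B).ncard := by
  rw [← Set.compl_union, ncard_boundary_compl]
  apply ncard_add_ncard_le hA hB
  · refine Set.union_subset boundary_inter_subset ?_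
    rintro ⟨a, b⟩ ⟨hab, ha, hb⟩
    rcases ha with ha | ha
    · exact Or.inl ⟨hab, ha, fun h => hb (Or.inl h)⟩
    · exact Or.inr ⟨hab, ha, fun h => hb (Or.inr h)⟩
  · rintro ⟨a, b⟩ ⟨⟨hab, ha, hb⟩, ⟨-, ha', hb'⟩⟩
    exact ⟨⟨hab, ha.1, fun h => hb' (Or.inl h)⟩, ⟨hab, ha.2, fun h => hb' (Or.inr h)⟩⟩

theorem ncard_crossing_corners (hΓ : Γ.Connected) (hA : (boundary Γ A).Finite)
    (hB : (boundary Γ B).Finite) (hBN : B ∈ minCuts Γ N) (hX : Cross A B) :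
    (crossing Γ N (A ∩ B)).ncard + (crossing Γ N (Aᶜ ∩ Bᶜ)).ncard <
      (crossing Γ N A).ncard + (crossing Γ N B).ncard := by
  have key : ∀ A B : Set V, Cross A B → ∀ C, Cross (A ∩ B) C → Cross A C ∨ Cross B C := by
    rintro A B ⟨-, -, -, q, hq⟩ C ⟨⟨p₁, h₁⟩, ⟨p₂, h₂⟩, ⟨p₃, h₃⟩, ⟨p₄, h₄⟩⟩
    by_contra! hno
    have n₁ : ¬((Aᶜ ∩ C).Nonempty ∧ (Aᶜ ∩ Cᶜ).Nonempty) := fun h =>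
      hno.1 ⟨⟨p₁, h₁.1.1, h₁.2⟩, ⟨p₂, h₂.1.1, h₂.2⟩, h.1, h.2⟩
    have n₂ : ¬((Bᶜ ∩ C).Nonempty ∧ (Bᶜ ∩ Cᶜ).Nonempty) := fun h =>
      hno.2 ⟨⟨p₁, h₁.1.2, h₁.2⟩, ⟨p₂, h₂.1.2, h₂.2⟩, h.1, h.2⟩
    simp only [Set.Nonempty, Set.mem_inter_iff, Set.mem_compl_iff] at *
    by_cases hqC : q ∈ C
    · have e₁ : ∀ z, z ∉ A → z ∈ C := fun z hz => by
        by_contra hzC; exact n₁ ⟨⟨q, hq.1, hqC⟩, ⟨z, hz, hzC⟩⟩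
      have e₂ : ∀ z, z ∉ B → z ∈ C := fun z hz => by
        by_contra hzC; exact n₂ ⟨⟨q, hq.2, hqC⟩, ⟨z, hz, hzC⟩⟩
      exact h₄.1 ⟨by_contra fun h => h₄.2 (e₁ _ h), by_contra fun h => h₄.2 (e₂ _ h)⟩
    · have e₁ : ∀ z, z ∉ A → z ∉ C := fun z hz hzC => n₁ ⟨⟨z, hz, hzC⟩, ⟨q, hq.1, hqC⟩⟩
      have e₂ : ∀ z, z ∉ B → z ∉ C := fun z hz hzC => n₂ ⟨⟨z, hz, hzC⟩, ⟨q, hq.2, hqC⟩⟩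
      exact h₃.1 ⟨by_contra fun h => e₁ _ h h₃.2, by_contra fun h => e₂ _ h h₃.2⟩
  apply ncard_add_ncard_lt (finite_crossing hΓ hA) (finite_crossing hΓ hB)
  · refine ⟨?_, fun hs => ?_⟩
    · rintro C (⟨hC, hX'⟩ | ⟨hC, hX'⟩)
      · exact (key A B hX C hX').imp (fun h => ⟨hC, h⟩) fun h => ⟨hC, h⟩
      · exact (key Aᶜ Bᶜ (cross_compl_left.2 (cross_compl_right.2 hX)) C hX').imp
          (fun h => ⟨hC, cross_compl_left.1 h⟩) fun h => ⟨hC, cross_compl_left.1 h⟩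
    · rcases hs (Or.inl ⟨hBN, hX⟩) with ⟨-, h⟩ | ⟨-, h⟩
      · obtain ⟨z, hz⟩ := h.2.1; exact hz.2 hz.1.2
      · obtain ⟨z, hz⟩ := h.1; exact hz.1.2 hz.2
  · rintro C ⟨⟨hC, ⟨p₁, h₁⟩, ⟨p₂, h₂⟩, -, -⟩, ⟨-, ⟨q₁, k₁⟩, ⟨q₂, k₂⟩, -, -⟩⟩
    exact ⟨⟨hC, ⟨p₁, h₁.1.1, h₁.2⟩, ⟨p₂, h₂.1.1, h₂.2⟩, ⟨q₁, k₁.1.1, k₁.2⟩, ⟨q₂, k₂.1.1, k₂.2⟩⟩,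
      ⟨hC, ⟨p₁, h₁.1.2, h₁.2⟩, ⟨p₂, h₂.1.2, h₂.2⟩, ⟨q₁, k₁.1.2, k₁.2⟩, ⟨q₂, k₂.1.2, k₂.2⟩⟩⟩

theorem Opt.mem_minCuts (h : Opt Γ N u v A) : A ∈ minCuts Γ N := ⟨⟨u, v, h.sepMin⟩, h.size⟩

theorem Opt.not_sep_corners (hΓ : Γ.Connected) (hA : Opt Γ N u v A) (hB : Opt Γ N x y B)
    (hX : Cross A B) (h₁ : Sep u v (A ∩ B)) (h₂ : Sep x y (Aᶜ ∩ Bᶜ)) : False := by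
  have fA := hA.sepMin.finite
  have fB := hB.sepMin.finite
  have f₁ := finite_boundary_inter fA fB
  have f₂ := finite_boundary_inter (finite_boundary_compl.2 fA) (finite_boundary_compl.2 fB)
  have l₁ := hA.sepMin.le _ h₁ f₁
  have l₂ := hB.sepMin.le _ h₂ f₂
  have l₃ := ncard_boundary_corners fA fB
  have m₁ := hA.least _ ⟨h₁, f₁, fun D hD hf => by have := hA.sepMin.le D hD hf; omega⟩
  have m₂ := hB.least _ ⟨h₂, f₂, fun D hD hf => by have := hB.sepMin.le D hD hf; omega⟩
  have m₃ := ncard_crossing_corners hΓ fA fB hB.mem_minCuts hX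
  omega

theorem Opt.not_cross (hΓ : Γ.Connected) (hA : Opt Γ N u v A) (hB : Opt Γ N x y B) :
    ¬Cross A B := by
  intro hX
  have main : ∀ {x y}, Opt Γ N x y B → ¬(Sep x y A ∧ Sep u v B) ∨ (x = u ∧ y = v) → False := by
    intro x y hB hor
    have k₁ := hA.not_sep_corners hΓ hB hX
    have k₂ := hA.not_sep_corners hΓ hB.compl (cross_compl_right.2 hX)
    have k₃ := hA.compl.not_sep_corners hΓ hB (cross_compl_left.2 hX)
    have k₄ := hA.compl.not_sep_corners hΓ hB.compl (cross_compl_left.2 (cross_compl_right.2 hX))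
    have sA := hA.sepMin.sep
    have sB := hB.sepMin.sep
    simp only [Sep, compl_compl, ← Ultrafilter.mem_coe, Filter.inter_mem_iff] at k₁ k₂ k₃ k₄ sA sB hor
    simp only [Ultrafilter.mem_coe, Ultrafilter.compl_mem_iff_notMem] at k₁ k₂ k₃ k₄ sA sB hor
    rcases hor with hor | ⟨rfl, rfl⟩ <;> grind
  by_cases h : Sep x y A ∧ Sep u v B
  · refine main (x := u) (y := v) ?_ (Or.inr ⟨rfl, rfl⟩)
    have l₁ := hA.sepMin.le _ h.2 hB.sepMin.finite
    have l₂ := hB.sepMin.le _ h.1 hA.sepMin.finite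
    have hA' : SepMin Γ x y A := ⟨h.1, hA.sepMin.finite, fun D hD hf => by
      have := hB.sepMin.le D hD hf; omega⟩
    have m := hB.least _ hA'
    exact ⟨⟨h.2, hB.sepMin.finite, fun D hD hf => by
      have := hA.sepMin.le D hD hf; omega⟩, hB.size, fun D hD => m.trans (hA.least D hD)⟩
  · exact main hB (Or.inl h)

theorem compl_mem_optCuts (h : A ∈ optCuts Γ N) : Aᶜ ∈ optCuts Γ N := by
  obtain ⟨u, v, h⟩ := h
  exact ⟨u, v, h.compl⟩

theorem not_cross_of_mem_optCuts (hΓ : Γ.Connected) (hA : A ∈ optCuts Γ N)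
    (hB : B ∈ optCuts Γ N) : ¬Cross A B := by
  obtain ⟨u, v, hA⟩ := hA
  obtain ⟨x, y, hB⟩ := hB
  exact hA.not_cross hΓ hB

theorem tight_of_mem_optCuts (hΓ : Γ.Connected) (hA : A ∈ optCuts Γ N) : Tight Γ A := by
  obtain ⟨u, v, hA⟩ := hA
  exact hA.sepMin.tight hΓ

theorem ncard_le_of_mem_optCuts (hA : A ∈ optCuts Γ N) : (boundary Γ A).ncard ≤ N := by
  obtain ⟨u, v, hA⟩ := hA
  exact hA.size

theorem finite_optCuts_separating (hΓ : Γ.Connected) (a b : V) :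
    {A ∈ optCuts Γ N | a ∈ A ∧ b ∉ A}.Finite :=
  (finite_tight (Γ := Γ) a b N).subset fun _ hA =>
    ⟨tight_of_mem_optCuts hΓ hA.1, hA.2.1, hA.2.2, ncard_le_of_mem_optCuts hA.1⟩

theorem exists_optCuts_sep (hB : Sep u v B) (hf : (boundary Γ B).Finite)
    (hN : (boundary Γ B).ncard ≤ N) : ∃ A ∈ optCuts Γ N, Sep u v A := by
  classical
  have ex : ∃ n, ∃ A, Sep u v A ∧ (boundary Γ A).Finite ∧ (boundary Γ A).ncard = n :=
    ⟨_, B, hB, hf, rfl⟩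
  obtain ⟨A, hA, hAf, hAn⟩ := Nat.find_spec ex
  have hmin : SepMin Γ u v A := ⟨hA, hAf, fun D hD hDf => by
    rw [hAn]; exact Nat.find_min' ex ⟨D, hD, hDf, rfl⟩⟩
  have ex' : ∃ n, ∃ A, SepMin Γ u v A ∧ (crossing Γ N A).ncard = n := ⟨_, A, hmin, rfl⟩
  obtain ⟨C, hC, hCn⟩ := Nat.find_spec ex'
  exact ⟨C, ⟨u, v, hC, (hC.le B hB hf).trans hN, fun D hD => by
    rw [hCn]; exact Nat.find_min' ex' ⟨D, hD, rfl⟩⟩, hC.sep⟩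

section Action

variable {G : Type*} [Group G] [MulAction G V]
  (hG : ∀ (g : G) a b, Γ.Adj a b → Γ.Adj (g • a) (g • b))

include hG

theorem boundary_smul (g : G) (A : Set V) : boundary Γ (g • A) = g • boundary Γ A := by
  ext ⟨a, b⟩
  simp only [boundary, Set.mem_ofPred_eq, Set.mem_smul_set_iff_inv_smul_mem, Prod.smul_mk]
  refine and_congr_left fun _ => ⟨fun h => hG _ _ _ h, fun h => ?_⟩
  simpa using hG g _ _ h

theorem ncard_boundary_smul (g : G) (A : Set V) :
    (boundary Γ (g • A)).ncard = (boundary Γ A).ncard := by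
  rw [boundary_smul hG, Set.ncard_smul_set]

theorem finite_boundary_smul (g : G) (A : Set V) :
    (boundary Γ (g • A)).Finite ↔ (boundary Γ A).Finite := by
  rw [boundary_smul hG, Set.finite_smul_set]

omit hG in
theorem sep_smul (g : G) (A : Set V) :
    Sep (u.map (g • ·)) (v.map (g • ·)) A ↔ Sep u v (g⁻¹ • A) := by
  simp only [Sep, Ultrafilter.mem_map, Set.preimage_smul]

theorem SepMin.smul (h : SepMin Γ u v A) (g : G) :
    SepMin Γ (u.map (g • ·)) (v.map (g • ·)) (g • A) := by
  refine ⟨?_, (finite_boundary_smul hG g A).2 h.finite, fun B hB hf => ?_⟩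
  · rw [sep_smul, inv_smul_smul]; exact h.sep
  · rw [ncard_boundary_smul hG, ← ncard_boundary_smul hG g⁻¹ B]
    exact h.le _ ((sep_smul g B).1 hB) ((finite_boundary_smul hG _ _).2 hf)

theorem smul_mem_minCuts (h : A ∈ minCuts Γ N) (g : G) : g • A ∈ minCuts Γ N := by
  obtain ⟨⟨u, v, h⟩, hN⟩ := h
  exact ⟨⟨_, _, h.smul hG g⟩, by rwa [ncard_boundary_smul hG]⟩

omit hG in
theorem Cross.smul (h : Cross A B) (g : G) : Cross (g • A) (g • B) := by
  simp only [Cross, ← Set.smul_set_compl, ← Set.smul_set_inter, Set.smul_set_nonempty]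
  exact h

theorem crossing_smul (g : G) (A : Set V) : crossing Γ N (g • A) = g • crossing Γ N A := by
  ext C
  rw [Set.mem_smul_set_iff_inv_smul_mem]
  constructor
  · rintro ⟨h, hX⟩
    exact ⟨smul_mem_minCuts hG h _, by simpa using hX.smul g⁻¹⟩
  · rintro ⟨h, hX⟩
    exact ⟨by simpa using smul_mem_minCuts hG h g, by simpa using hX.smul g⟩

theorem smul_mem_optCuts (h : A ∈ optCuts Γ N) (g : G) : g • A ∈ optCuts Γ N := by
  obtain ⟨u, v, h⟩ := h
  refine ⟨_, _, h.sepMin.smul hG g, by rw [ncard_boundary_smul hG]; exact h.size, fun B hB => ?_⟩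
  rw [crossing_smul hG, Set.ncard_smul_set]
  have hB' := hB.smul hG g⁻¹
  simp only [Ultrafilter.map_map, Function.comp_def, inv_smul_smul] at hB'
  have := h.least (g⁻¹ • B) (by simpa [Ultrafilter.map_id'] using hB')
  rwa [crossing_smul hG, Set.ncard_smul_set] at this

theorem exists_finite_orbit_representatives (hΓ : Γ.Connected) {P : Set (V × V)} (hP : P.Finite)
    (hcov : ∀ a b, Γ.Adj a b → ∃ g : G, (g • a, g • b) ∈ P) :
    ∃ R : Set (Set V), R.Finite ∧ ∀ A ∈ optCuts Γ N, ∃ g : G, g • A ∈ R := by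
  refine ⟨_, hP.biUnion fun e _ => finite_optCuts_separating (N := N) hΓ e.1 e.2, fun A hA => ?_⟩
  have hT := tight_of_mem_optCuts hΓ hA
  obtain ⟨⟨a, b⟩, hab, ha, hb⟩ := exists_boundary_of_connected hΓ hT.nonempty hT.compl_nonempty
  obtain ⟨g, hg⟩ := hcov a b hab
  exact ⟨g, Set.mem_biUnion hg ⟨smul_mem_optCuts hG hA g,
    Set.smul_mem_smul_set ha, by simpa using hb⟩⟩

end Action

end CutSystem

/-- Two points are not separated by a family of sets. -/
def Unsep {P : Type*} (T : Set (Set P)) (p q : P) : Prop := ∀ E ∈ T, p ∈ E ↔ q ∈ E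

/-- A nested, complement closed, invariant family of half-spaces encoding a tree on which the
subgroup `F` acts with trivial edge stabilisers, such that every nontrivial vertex stabiliser in
`F` belongs to a vertex in the orbit of `p₀`. -/
structure TreeSystem {G P : Type*} [Group G] [MulAction G P] (F : Subgroup G) (p₀ : P)
    (T : Set (Set P)) : Prop where
  compl : ∀ E ∈ T, Eᶜ ∈ T
  finite : ∀ p q, {E ∈ T | p ∉ E ∧ q ∈ E}.Finite
  edge : ∀ E ∈ T, ∃ p q, p ∉ E ∧ q ∈ E ∧ ∀ E' ∈ T, ¬(p ∈ E' ↔ q ∈ E') → E' = E ∨ E' = Eᶜ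
  nested : ∀ A ∈ T, ∀ B ∈ T, A ⊆ B ∨ A ⊆ Bᶜ ∨ Aᶜ ⊆ B ∨ Aᶜ ⊆ Bᶜ
  smul : ∀ (g : G), ∀ E ∈ T, g • E ∈ T
  stab : ∀ g ∈ F, ∀ E ∈ T, g • E = E → g = 1
  vertex : ∀ g ∈ F, g ≠ 1 → ∀ p, Unsep T (g • p) p → ∃ h : G, Unsep T p (h • p₀)

section FinitePermutation

variable {G α : Type*} [Group G] [MulAction G α]

theorem exists_pow_smul_eq_of_infinite {g : G} {x : α} {S : Set α} (hS : S.Finite) {I : Set ℕ}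
    (hI : I.Infinite) (h : ∀ n ∈ I, g ^ n • x ∈ S) : ∃ n : ℕ, n ≠ 0 ∧ g ^ n • x = x := by
  obtain ⟨m, hm, n, hn, hmn, he⟩ := hI.exists_ne_map_eq_of_mapsTo h hS
  wlog hlt : m < n generalizing m n
  · exact this n hn m hm hmn.symm he.symm (by omega)
  refine ⟨n - m, by omega, ?_⟩
  have : g ^ n = g ^ m * g ^ (n - m) := by rw [← pow_add]; congr 1; omega
  simp only [this, mul_smul, smul_left_cancel_iff] at he
  exact he.symm

theorem exists_pow_smul_eq_of_mapsTo {g : G} {x : α} {S : Set α} (hS : S.Finite)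
    (hx : x ∈ S) (h : ∀ y ∈ S, g • y ∈ S) : ∃ n : ℕ, n ≠ 0 ∧ g ^ n • x = x := by
  refine exists_pow_smul_eq_of_infinite hS (I := Set.univ) Set.infinite_univ ?_
  intro n _
  clear * - hx h
  induction n with
  | zero => simpa using hx
  | succ n ih => rw [pow_succ', mul_smul]; exact h _ ih

end FinitePermutation

namespace CutSystem

variable {V G : Type*} [Group G] [MulAction G V]

/-- The half-space attached to a member of a nested family of cuts. -/
def halfSpace {𝓔 : SubMulAction G (Set V)} (E : Set V) : Set (V ⊕ 𝓔) :=
  {p | Sum.elim (fun v => v ∈ E) (fun E₀ => (E₀ : Set V) ⊆ E ∨ Eᶜ ⊂ (E₀ : Set V)) p}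

variable {𝓔 : SubMulAction G (Set V)} {E E' : Set V}

@[simp] theorem inl_mem_halfSpace {v : V} :
    (Sum.inl v : V ⊕ 𝓔) ∈ halfSpace (𝓔 := 𝓔) E ↔ v ∈ E := Iff.rfl

@[simp] theorem inr_mem_halfSpace {E₀ : 𝓔} :
    (Sum.inr E₀ : V ⊕ 𝓔) ∈ halfSpace (𝓔 := 𝓔) E ↔ (E₀ : Set V) ⊆ E ∨ Eᶜ ⊂ (E₀ : Set V) := Iff.rfl

theorem halfSpace_mono (h : E ⊆ E') : halfSpace (𝓔 := 𝓔) E ⊆ halfSpace E' := by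
  rintro (v | E₀)
  · exact fun hv => h hv
  · simp only [inr_mem_halfSpace]
    exact Or.imp (fun h' => h'.trans h) fun h' =>
      lt_of_le_of_lt (Set.compl_subset_compl.2 h) h'

theorem halfSpace_injective : Function.Injective (halfSpace (𝓔 := 𝓔)) := by
  intro E E' h
  ext v
  rw [← inl_mem_halfSpace (𝓔 := 𝓔), h, inl_mem_halfSpace]

theorem smul_halfSpace (g : G) : g • halfSpace (𝓔 := 𝓔) E = halfSpace (g • E) := by
  ext (v | E₀)
  · rw [Set.mem_smul_set_iff_inv_smul_mem, Sum.smul_inl, inl_mem_halfSpace, inl_mem_halfSpace,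
      Set.mem_smul_set_iff_inv_smul_mem]
  · rw [Set.mem_smul_set_iff_inv_smul_mem, Sum.smul_inr, inr_mem_halfSpace, inr_mem_halfSpace]
    have key : ∀ A B : Set V, g⁻¹ • A ⊆ B ↔ A ⊆ g • B := fun A B => by
      rw [Set.smul_set_subset_iff_subset_inv_smul_set, inv_inv]
    have key' : ∀ A B : Set V, A ⊆ g⁻¹ • B ↔ g • A ⊆ B := fun A B => by
      rw [Set.smul_set_subset_iff_subset_inv_smul_set]
    simp only [SubMulAction.val_smul, ssubset_iff_subset_not_subset, key, key',
      Set.smul_set_compl]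

/-- The abstract properties of the family of optimal cuts which yield a tree. -/
structure NestedCuts (𝓔 : SubMulAction G (Set V)) : Prop where
  compl : ∀ E ∈ 𝓔, Eᶜ ∈ 𝓔
  not_cross : ∀ A ∈ 𝓔, ∀ B ∈ 𝓔, ¬Cross A B
  nonempty : ∀ E ∈ 𝓔, E.Nonempty
  finite : ∀ a b, {E | E ∈ 𝓔 ∧ a ∈ E ∧ b ∉ E}.Finite

variable (h𝓔 : NestedCuts 𝓔)

include h𝓔

theorem NestedCuts.compl_nonempty (hE : E ∈ 𝓔) : (Eᶜ).Nonempty := h𝓔.nonempty _ (h𝓔.compl _ hE)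

theorem NestedCuts.subset_or (hE : E ∈ 𝓔) (hE' : E' ∈ 𝓔) :
    E ⊆ E' ∨ E ⊆ E'ᶜ ∨ Eᶜ ⊆ E' ∨ Eᶜ ⊆ E'ᶜ := by
  have h := h𝓔.not_cross E hE E' hE'
  simp only [Cross] at h
  by_contra! hno
  simp only [Set.not_subset] at hno
  obtain ⟨⟨a, ha⟩, ⟨b, hb⟩, ⟨c, hc⟩, ⟨d, hd⟩⟩ := hno
  simp only [Set.mem_compl_iff, not_not] at hb hd
  exact h ⟨⟨b, hb⟩, ⟨a, ha⟩, ⟨d, hd⟩, ⟨c, hc⟩⟩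

theorem NestedCuts.halfSpace_compl (hE : E ∈ 𝓔) :
    halfSpace (𝓔 := 𝓔) Eᶜ = (halfSpace E)ᶜ := by
  ext (v | ⟨E₀, hE₀⟩)
  · rfl
  · rw [Set.mem_compl_iff, inr_mem_halfSpace, inr_mem_halfSpace]
    simp only [compl_compl]
    obtain ⟨e, he⟩ := h𝓔.nonempty _ hE
    obtain ⟨e', he'⟩ := h𝓔.compl_nonempty hE
    obtain ⟨a, ha⟩ := h𝓔.nonempty _ hE₀
    obtain ⟨a', ha'⟩ := h𝓔.compl_nonempty hE₀
    have hor := h𝓔.subset_or hE₀ hE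
    simp only [ssubset_iff_subset_not_subset]
    constructor
    · rintro (h | ⟨h₁, h₂⟩) (k | ⟨k₁, k₂⟩)
      · exact h ha (k ha)
      · exact k₂ h
      · exact h₂ k
      · exact ha' ((em (a' ∈ E)).elim (fun h => h₁ h) fun h => k₁ h)
    · intro hno
      push Not at hno
      rcases hor with h | h | h | h
      · exact absurd h hno.1
      · exact Or.inl h
      · by_cases hEE : E₀ ⊆ Eᶜ
        · exact Or.inl hEE
        · exact absurd (hno.2 (Set.compl_subset_comm.1 h)) hEE
      · exact Or.inr ⟨Set.compl_subset_compl.1 h, hno.1⟩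

/-- The finite set of members separating a member from one of its boundary vertices. -/
theorem NestedCuts.exists_vertex (p : V ⊕ 𝓔) :
    ∃ v : V, {E | E ∈ 𝓔 ∧ ¬(p ∈ halfSpace (𝓔 := 𝓔) E ↔ v ∈ E)}.Finite := by
  rcases p with v | ⟨E₀, hE₀⟩
  · exact ⟨v, by simp⟩
  · obtain ⟨a, ha⟩ := h𝓔.nonempty _ hE₀
    obtain ⟨b, hb⟩ := h𝓔.compl_nonempty hE₀
    refine ⟨a, ((h𝓔.finite a b).union (h𝓔.finite b a)).subset ?_⟩
    have key : ∀ E ∈ 𝓔, (Sum.inr ⟨E₀, hE₀⟩ : V ⊕ 𝓔) ∈ halfSpace (𝓔 := 𝓔) E → a ∉ E → b ∈ E := by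
      rintro E hE (h | h) haE
      · exact absurd (h ha) haE
      · by_contra hbE; exact hb (h.1 hbE)
    rintro E ⟨hE, hsep⟩
    by_cases h : (Sum.inr ⟨E₀, hE₀⟩ : V ⊕ 𝓔) ∈ halfSpace (𝓔 := 𝓔) E
    · have haE : a ∉ E := fun h' => hsep ⟨fun _ => h', fun _ => h⟩
      exact Or.inr ⟨hE, key E hE h haE, haE⟩
    · have haE : a ∈ E := by by_contra h'; exact hsep ⟨fun k => absurd k h, fun k => absurd k h'⟩
      refine Or.inl ⟨hE, haE, ?_⟩
      refine key Eᶜ (h𝓔.compl _ hE) ?_ (fun h' => h' haE)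
      rw [h𝓔.halfSpace_compl hE]; exact h

theorem NestedCuts.finite_separating (p q : V ⊕ 𝓔) :
    {E | E ∈ 𝓔 ∧ ¬(p ∈ halfSpace (𝓔 := 𝓔) E ↔ q ∈ halfSpace (𝓔 := 𝓔) E)}.Finite := by
  obtain ⟨a, ha⟩ := h𝓔.exists_vertex p
  obtain ⟨b, hb⟩ := h𝓔.exists_vertex q
  refine (ha.union (hb.union ((h𝓔.finite a b).union (h𝓔.finite b a)))).subset ?_
  rintro E ⟨hE, hs⟩
  simp only [Set.mem_union, Set.mem_ofPred_eq]
  tauto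

theorem NestedCuts.treeSystem {F : Subgroup G} (v₀ : V)
    (hF : ∀ g ∈ F, ∀ n : ℕ, n ≠ 0 → g ^ n = 1 → g = 1)
    (hstab : ∀ g ∈ F, ∀ E ∈ 𝓔, g • E = E → g = 1)
    (htrans : ∀ v : V, ∃ g : G, v = g • v₀)
    (hyp : ∀ g ∈ F, (∀ v : V, g • v ≠ v) → ∃ E ∈ 𝓔,
      {n : ℕ | g ^ n • v₀ ∈ E}.Infinite ∧ {n : ℕ | g⁻¹ ^ n • v₀ ∉ E}.Infinite) :
    TreeSystem F (Sum.inl v₀ : V ⊕ 𝓔) (halfSpace (𝓔 := 𝓔) '' (𝓔 : Set (Set V))) := by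
  have hfin : ∀ p q : V ⊕ 𝓔, {E ∈ halfSpace (𝓔 := 𝓔) '' (𝓔 : Set (Set V)) |
      ¬(p ∈ E ↔ q ∈ E)}.Finite := fun p q => by
    refine ((h𝓔.finite_separating p q).image halfSpace).subset ?_
    rintro - ⟨⟨E, hE, rfl⟩, h⟩
    exact ⟨E, ⟨hE, h⟩, rfl⟩
  have hst : ∀ g ∈ F, ∀ E ∈ 𝓔, g • halfSpace (𝓔 := 𝓔) E = halfSpace E → g = 1 := by
    intro g hg E hE h
    rw [smul_halfSpace] at h
    exact hstab g hg E hE (halfSpace_injective h)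
  have hst' : ∀ g ∈ F, ∀ E ∈ 𝓔, ∀ n : ℕ, n ≠ 0 → g ^ n • halfSpace (𝓔 := 𝓔) E = halfSpace E →
      g = 1 := fun g hg E hE n hn h => hF g hg n hn (hst _ (F.pow_mem hg n) E hE h)
  have hsm : ∀ (g : G), ∀ E ∈ halfSpace (𝓔 := 𝓔) '' (𝓔 : Set (Set V)),
      g • E ∈ halfSpace (𝓔 := 𝓔) '' (𝓔 : Set (Set V)) := by
    rintro g - ⟨E, hE, rfl⟩
    exact ⟨g • E, 𝓔.smul_mem g hE, (smul_halfSpace g).symm⟩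
  refine ⟨?_, fun p q => (hfin p q).subset ?_, ?_, ?_, hsm, ?_, ?_⟩
  · rintro - ⟨E, hE, rfl⟩
    exact ⟨Eᶜ, h𝓔.compl _ hE, h𝓔.halfSpace_compl hE⟩
  · rintro E ⟨hE, hp, hq⟩
    exact ⟨hE, fun h => hp (h.2 hq)⟩
  · rintro - ⟨E, hE, rfl⟩
    obtain ⟨e, he⟩ := h𝓔.nonempty _ hE
    obtain ⟨e', he'⟩ := h𝓔.compl_nonempty hE
    have hEE : ¬ E ⊆ Eᶜ := fun h => h he he
    have hEE' : ¬ Eᶜ ⊆ E := fun h => he' (h he')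
    refine ⟨Sum.inr ⟨Eᶜ, h𝓔.compl _ hE⟩, Sum.inr ⟨E, hE⟩, ?_, Or.inl subset_rfl, ?_⟩
    · rintro (h | h)
      · exact hEE' h
      · exact h.2 subset_rfl
    · have key : ∀ E' ∈ 𝓔, (Sum.inr ⟨E, hE⟩ : V ⊕ 𝓔) ∈ halfSpace (𝓔 := 𝓔) E' →
          (Sum.inr ⟨Eᶜ, h𝓔.compl _ hE⟩ : V ⊕ 𝓔) ∉ halfSpace (𝓔 := 𝓔) E' → E' = E := by
        intro E' hE' h₁ h₂
        rw [← Set.mem_compl_iff, ← h𝓔.halfSpace_compl hE'] at h₂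
        simp only [inr_mem_halfSpace, compl_compl] at h₁ h₂
        rcases h₁ with h₁ | h₁ <;> rcases h₂ with h₂ | h₂
        · exact (Set.compl_subset_compl.1 h₂).antisymm h₁
        · exact absurd (h₁.trans h₂.1) hEE
        · exact absurd (h₂.trans h₁.1) hEE'
        · exact absurd (Set.compl_subset_compl.2 h₂.1) (by rw [compl_compl]; exact h₁.2)
      rintro - ⟨E', hE', rfl⟩ hsep
      by_cases h : (Sum.inr ⟨E, hE⟩ : V ⊕ 𝓔) ∈ halfSpace (𝓔 := 𝓔) E'
      · left
        rw [key E' hE' h fun h' => hsep ⟨fun _ => h, fun _ => h'⟩]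
      · right
        have hc := h𝓔.halfSpace_compl hE'
        have := key E'ᶜ (h𝓔.compl _ hE') (by rw [hc]; exact h) (by
          rw [hc]; intro h'
          exact hsep ⟨fun k => absurd k h', fun k => absurd k h⟩)
        rw [← this, hc, compl_compl]
  · rintro - ⟨A, hA, rfl⟩ - ⟨B, hB, rfl⟩
    rw [← h𝓔.halfSpace_compl hA, ← h𝓔.halfSpace_compl hB]
    exact (h𝓔.subset_or hA hB).imp halfSpace_mono (Or.imp halfSpace_mono
      (Or.imp halfSpace_mono halfSpace_mono))
  · rintro g hg - ⟨E, hE, rfl⟩ h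
    exact hst g hg E hE h
  · intro g hg hg1 p hp
    have hpow : ∀ n : ℕ, Unsep (halfSpace (𝓔 := 𝓔) '' (𝓔 : Set (Set V))) (g ^ n • p) p := by
      intro n
      induction n with
      | zero => intro E _; simp
      | succ n ih =>
        intro E hE
        rw [pow_succ', mul_smul]
        have := ih (g⁻¹ • E) (hsm _ _ hE)
        rw [Set.mem_inv_smul_set_iff, Set.mem_inv_smul_set_iff] at this
        exact this.trans (hp E hE)
    by_cases hfix : ∀ v : V, g • v ≠ v
    · exfalso
      obtain ⟨E, hE, h₁, h₂⟩ := hyp g hg hfix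
      have hEs : halfSpace (𝓔 := 𝓔) E ∈ halfSpace (𝓔 := 𝓔) '' (𝓔 : Set (Set V)) := ⟨E, hE, rfl⟩
      by_cases hpE : p ∈ halfSpace (𝓔 := 𝓔) E
      · obtain ⟨n, hn, h⟩ := exists_pow_smul_eq_of_infinite (x := halfSpace (𝓔 := 𝓔) E) (g := g)
          (hfin p (Sum.inl v₀)) h₂ (by
            intro n hn
            refine ⟨hsm _ _ hEs, fun h => hn ?_⟩
            rw [← hpow n _ (hsm _ _ hEs), Set.smul_mem_smul_set_iff] at h
            have h' := h.1 hpE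
            rwa [smul_halfSpace, inl_mem_halfSpace, Set.mem_smul_set_iff_inv_smul_mem, ← inv_pow]
              at h')
        exact hg1 (hst' g hg E hE n hn h)
      · obtain ⟨n, hn, h⟩ := exists_pow_smul_eq_of_infinite (x := halfSpace (𝓔 := 𝓔) E) (g := g⁻¹)
          (hfin p (Sum.inl v₀)) h₁ (by
            intro n hn
            refine ⟨hsm _ _ hEs, fun h => hpE ?_⟩
            rw [inv_pow, Set.mem_inv_smul_set_iff, Set.mem_inv_smul_set_iff] at h
            exact (hpow n _ hEs).1 (h.2 hn))
        rw [inv_pow, inv_smul_eq_iff] at h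
        exact hg1 (hst' g hg E hE n hn h.symm)
    · push Not at hfix
      obtain ⟨v, hv⟩ := hfix
      obtain ⟨h, rfl⟩ := htrans v
      refine ⟨h, fun E hE => ?_⟩
      by_contra hsep
      obtain ⟨n, hn, h'⟩ := exists_pow_smul_eq_of_mapsTo (x := E) (g := g)
        (hfin p (h • Sum.inl v₀)) ⟨hE, hsep⟩ (by
          rintro E' ⟨hE', hs⟩
          refine ⟨hsm _ _ hE', fun hs' => hs ?_⟩
          rw [← hp _ (hsm _ _ hE'), Set.smul_mem_smul_set_iff] at hs'
          rw [hs', Set.mem_smul_set_iff_inv_smul_mem, Sum.smul_inl, Sum.smul_inl,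
            inv_smul_eq_iff.2 hv.symm])
      obtain ⟨E, hE, rfl⟩ := hE
      exact hg1 (hst' g hg E hE n hn h')

end CutSystem

namespace CutSystem

/-- A group acting on a connected graph with finitely many orbits of edges, whose vertices and
ends are separated by finite cuts of bounded size, gives rise to a tree system. -/
theorem exists_treeSystem {V G : Type w} [Group G] [MulAction G V] {F : Subgroup G}
    {Γ : SimpleGraph V} (hΓ : Γ.Connected)
    (hG : ∀ (g : G) a b, Γ.Adj a b → Γ.Adj (g • a) (g • b))
    {P : Set (V × V)} (hP : P.Finite)
    (hcov : ∀ a b, Γ.Adj a b → ∃ g : G, (g • a, g • b) ∈ P) (v₀ : V) (N : ℕ)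
    (hF : ∀ g ∈ F, ∀ n : ℕ, n ≠ 0 → g ^ n = 1 → g = 1)
    (htrans : ∀ v : V, ∃ g : G, v = g • v₀)
    (hedge : ∀ g ∈ F, ∀ a b, Γ.Adj a b → g • a = a → g • b = b → g = 1)
    (hvert : ∀ v v' : V, v ≠ v' → ∃ B, (boundary Γ B).Finite ∧ (boundary Γ B).ncard ≤ N ∧
      v ∈ B ∧ v' ∉ B)
    (hyp : ∀ g ∈ F, (∀ v : V, g • v ≠ v) → ∃ B, (boundary Γ B).Finite ∧
      (boundary Γ B).ncard ≤ N ∧ ∃ n₀ : ℕ, ∀ n ≥ n₀, g ^ n • v₀ ∈ B ∧ g⁻¹ ^ n • v₀ ∉ B) :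
    ∃ (Q : Type w) (_ : MulAction G Q) (p₀ : Q) (T : Set (Set Q)), TreeSystem F p₀ T ∧
      (∀ g : G, Unsep T (g • p₀) p₀ ↔ g • v₀ = v₀) ∧
      ∃ R : Set (Set Q), R.Finite ∧ ∀ E ∈ T, ∃ g : G, g • E ∈ R := by
  let 𝓔 : SubMulAction G (Set V) := ⟨optCuts Γ N, fun g {A} hA => smul_mem_optCuts hG hA g⟩
  have h𝓔 : NestedCuts 𝓔 := ⟨fun E hE => compl_mem_optCuts hE,
    fun A hA B hB => not_cross_of_mem_optCuts hΓ hA hB,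
    fun E hE => (tight_of_mem_optCuts hΓ hE).nonempty,
    fun a b => finite_optCuts_separating hΓ a b⟩
  have hT := h𝓔.treeSystem v₀ hF ?_ htrans ?_
  · refine ⟨_, _, _, _, hT, ?_, ?_⟩
    · intro g
      constructor
      · intro hU
        by_contra hne
        obtain ⟨B, hB, hN, h₁, h₂⟩ := hvert _ _ hne
        obtain ⟨A, hA, hs⟩ := exists_optCuts_sep (Γ := Γ) (u := pure (g • v₀)) (v := pure v₀)
          (fun h => h₂ (h.1 h₁)) hB hN
        exact hs (hU (halfSpace A) ⟨A, hA, rfl⟩)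
      · rintro h E -
        rw [Sum.smul_inl, h]
    · obtain ⟨R, hR, h⟩ := exists_finite_orbit_representatives (N := N) hG hΓ hP hcov
      refine ⟨halfSpace '' R, hR.image _, ?_⟩
      rintro - ⟨E, hE, rfl⟩
      obtain ⟨g, hg⟩ := h E hE
      exact ⟨g, g • E, hg, (smul_halfSpace g).symm⟩
  · intro g hg E hE h
    have hEt := tight_of_mem_optCuts hΓ hE
    obtain ⟨e, he⟩ := exists_boundary_of_connected hΓ hEt.nonempty hEt.compl_nonempty
    have hb : ∀ e ∈ boundary Γ E, g • e ∈ boundary Γ E := fun e he => by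
      rw [← h, boundary_smul hG]; exact Set.smul_mem_smul_set he
    obtain ⟨n, hn, hfix⟩ := exists_pow_smul_eq_of_mapsTo hEt.finite he hb
    obtain ⟨a, b⟩ := e
    simp only [Prod.smul_mk, Prod.mk.injEq] at hfix
    exact hF g hg n hn (hedge _ (F.pow_mem hg n) a b he.1 hfix.1 hfix.2)
  · intro g hg hfix
    obtain ⟨B, hB, hN, n₀, hn⟩ := hyp g hg hfix
    have hmem : ∀ (k : G) (S : Set V), (∀ n ≥ n₀, k ^ n • v₀ ∈ S) →
        S ∈ (Filter.hyperfilter ℕ).map (fun n => k ^ n • v₀) := by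
      intro k S hS
      rw [Ultrafilter.mem_map]
      apply Filter.mem_hyperfilter_of_finite_compl
      refine (Set.finite_lt_nat n₀).subset fun n hn => ?_
      by_contra hlt
      exact hn (hS n (not_lt.1 hlt))
    have hinf : ∀ (k : G) (S : Set V), S ∈ (Filter.hyperfilter ℕ).map (fun n => k ^ n • v₀) →
        {n : ℕ | k ^ n • v₀ ∈ S}.Infinite := fun k S hS hfin =>
      Filter.notMem_hyperfilter_of_finite hfin hS
    have hs : Sep ((Filter.hyperfilter ℕ).map (fun n => g ^ n • v₀))
        ((Filter.hyperfilter ℕ).map (fun n => g⁻¹ ^ n • v₀)) B := by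
      intro h
      have h₁ := h.1 (hmem g B fun n h => (hn n h).1)
      have h₂ := hmem g⁻¹ Bᶜ fun n h => (hn n h).2
      exact Ultrafilter.compl_mem_iff_notMem.1 h₂ h₁
    obtain ⟨A, hA, hs⟩ := exists_optCuts_sep hs hB hN
    by_cases hA' : A ∈ (Filter.hyperfilter ℕ).map (fun n => g ^ n • v₀)
    · refine ⟨A, hA, hinf g A hA', hinf g⁻¹ Aᶜ (Ultrafilter.compl_mem_iff_notMem.2 fun h =>
        hs ⟨fun _ => h, fun _ => hA'⟩)⟩
    · refine ⟨Aᶜ, compl_mem_optCuts hA, hinf g Aᶜ (Ultrafilter.compl_mem_iff_notMem.2 hA'), ?_⟩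
      have : A ∈ (Filter.hyperfilter ℕ).map (fun n => g⁻¹ ^ n • v₀) := by
        by_contra h; exact hs ⟨fun k => absurd k hA', fun k => absurd k h⟩
      simpa using hinf g⁻¹ A this

end CutSystem

section Unsep

variable {P : Type*} {T : Set (Set P)} {p q r : P}

theorem Unsep.refl (p : P) : Unsep T p p := fun _ _ => Iff.rfl

theorem Unsep.symm (h : Unsep T p q) : Unsep T q p := fun E hE => (h E hE).symm

theorem Unsep.trans (h : Unsep T p q) (h' : Unsep T q r) : Unsep T p r :=
  fun E hE => (h E hE).trans (h' E hE)

theorem Unsep.mono {T' : Set (Set P)} (h : Unsep T p q) (hT : T' ⊆ T) : Unsep T' p q :=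
  fun E hE => h E (hT hE)

/-- The half-spaces containing the second point but not the first one. -/
def sepSet (T : Set (Set P)) (p q : P) : Set (Set P) := {E ∈ T | p ∉ E ∧ q ∈ E}

/-- The half-space `E` is a directed edge from `p` to `q`. -/
structure IsEdge (T : Set (Set P)) (E : Set P) (p q : P) : Prop where
  mem : E ∈ T
  left : p ∉ E
  right : q ∈ E
  eq_or : ∀ E' ∈ T, ¬(p ∈ E' ↔ q ∈ E') → E' = E ∨ E' = Eᶜ

theorem IsEdge.of_unsep_left {E : Set P} (h : IsEdge T E p q) (hp : Unsep T p r) :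
    IsEdge T E r q :=
  ⟨h.mem, by rw [← hp E h.mem]; exact h.left, h.right, fun E' hE' => by
    rw [← hp E' hE']; exact h.eq_or E' hE'⟩

theorem IsEdge.of_unsep_right {E : Set P} (h : IsEdge T E p q) (hq : Unsep T q r) :
    IsEdge T E p r :=
  ⟨h.mem, h.left, by rw [← hq E h.mem]; exact h.right, fun E' hE' => by
    rw [← hq E' hE']; exact h.eq_or E' hE'⟩

theorem IsEdge.mem_iff {E E' : Set P} (h : IsEdge T E p q) (hE' : E' ∈ T) (h₁ : E' ≠ E)
    (h₂ : E' ≠ Eᶜ) : p ∈ E' ↔ q ∈ E' := by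
  by_contra hn
  exact (h.eq_or E' hE' hn).elim h₁ h₂

end Unsep

namespace TreeSystem

variable {G P : Type*} [Group G] [MulAction G P] {F : Subgroup G} {p₀ : P} {T : Set (Set P)}
  (hT : TreeSystem F p₀ T) {E E' : Set P} {p q p' q' a : P}

include hT

theorem smul_mem_iff (g : G) : g • E ∈ T ↔ E ∈ T :=
  ⟨fun h => by simpa using hT.smul g⁻¹ _ h, hT.smul g E⟩

theorem unsep_smul (h : Unsep T p q) (g : G) : Unsep T (g • p) (g • q) := by
  intro E hE
  have := h (g⁻¹ • E) (hT.smul _ _ hE)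
  rwa [Set.mem_inv_smul_set_iff, Set.mem_inv_smul_set_iff] at this

theorem unsep_smul_iff (g : G) : Unsep T (g • p) (g • q) ↔ Unsep T p q :=
  ⟨fun h => by simpa using hT.unsep_smul h g⁻¹, fun h => hT.unsep_smul h g⟩

theorem unsep_inv_smul_iff (g : G) : Unsep T (g⁻¹ • p) q ↔ Unsep T p (g • q) := by
  rw [← hT.unsep_smul_iff g, smul_inv_smul]

theorem ncard_sepSet_smul (g : G) (p q : P) :
    (sepSet T (g • p) (g • q)).ncard = (sepSet T p q).ncard := by
  rw [← Set.ncard_smul_set g (sepSet T p q)]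
  congr 1
  ext E
  rw [Set.mem_smul_set_iff_inv_smul_mem]
  simp only [sepSet, Set.mem_ofPred_eq, hT.smul_mem_iff, Set.mem_inv_smul_set_iff]

theorem isEdge_smul (h : IsEdge T E p q) (g : G) : IsEdge T (g • E) (g • p) (g • q) := by
  refine ⟨hT.smul g E h.mem, by simpa using h.left, Set.smul_mem_smul_set h.right, ?_⟩
  intro E' hE' hs
  rcases h.eq_or (g⁻¹ • E') (hT.smul _ _ hE') (by
    rwa [Set.mem_inv_smul_set_iff, Set.mem_inv_smul_set_iff]) with h | h
  · left; rw [← h, smul_inv_smul]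
  · right; rw [← Set.smul_set_compl, ← h, smul_inv_smul]

theorem isEdge_compl (h : IsEdge T E p q) : IsEdge T Eᶜ q p :=
  ⟨hT.compl E h.mem, fun h' => h' h.right, h.left, fun E' hE' hs => by
    rw [compl_compl]; exact (h.eq_or E' hE' fun h' => hs h'.symm).symm⟩

theorem not_four (hE : E ∈ T) (hE' : E' ∈ T) {a b c d : P} (ha : a ∈ E ∧ a ∈ E')
    (hb : b ∈ E ∧ b ∉ E') (hc : c ∉ E ∧ c ∈ E') (hd : d ∉ E ∧ d ∉ E') : False := by
  rcases hT.nested E hE E' hE' with h | h | h | h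
  · exact hb.2 (h hb.1)
  · exact h ha.1 ha.2
  · exact hd.2 (h hd.1)
  · exact h hc.1 hc.2

theorem unsep_left_of_isEdge (h : IsEdge T E p q) (h' : IsEdge T E p' q') : Unsep T p p' := by
  intro E' hE'
  by_contra hs
  have h₁ : E' ≠ E := by rintro rfl; exact hs ⟨fun k => absurd k h.left, fun k => absurd k h'.left⟩
  have h₂ : E' ≠ Eᶜ := by
    rintro rfl; exact hs ⟨fun _ => h'.left, fun _ => h.left⟩
  have k := h.mem_iff hE' h₁ h₂
  have k' := h'.mem_iff hE' h₁ h₂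
  by_cases hp : p ∈ E'
  · have hp' : p' ∉ E' := fun h => hs ⟨fun _ => h, fun _ => hp⟩
    exact hT.not_four h.mem hE' ⟨h.right, k.1 hp⟩ ⟨h'.right, fun x => hp' (k'.2 x)⟩
      ⟨h.left, hp⟩ ⟨h'.left, hp'⟩
  · have hp' : p' ∈ E' := by by_contra h; exact hs ⟨fun k => absurd k hp, fun k => absurd k h⟩
    exact hT.not_four h.mem hE' ⟨h'.right, k'.1 hp'⟩ ⟨h.right, fun x => hp (k.2 x)⟩
      ⟨h'.left, hp'⟩ ⟨h.left, hp⟩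

theorem unsep_right_of_isEdge (h : IsEdge T E p q) (h' : IsEdge T E p' q') : Unsep T q q' :=
  hT.unsep_left_of_isEdge (hT.isEdge_compl h) (hT.isEdge_compl h')

theorem disjoint_of_isEdge (h : IsEdge T E p q) (h' : IsEdge T E' p q') (hne : E ≠ E') :
    Disjoint E E' := by
  rw [Set.disjoint_left]
  intro a ha ha'
  refine hT.not_four h.mem h'.mem ⟨ha, ha'⟩ ⟨h.right, ?_⟩ ⟨?_, h'.right⟩ ⟨h.left, h'.left⟩
  · rw [← h.mem_iff h'.mem hne.symm (fun e => h'.left (by rw [e]; exact h.left))]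
    exact h'.left
  · rw [← h'.mem_iff h.mem hne (fun e => h.left (by rw [e]; exact h'.left))]
    exact h.left

omit [Group G] [MulAction G P] hT in
theorem sepSet_subset (h : IsEdge T E p q) (ha : a ∈ E) : sepSet T q a ⊂ sepSet T p a := by
  refine ⟨?_, fun hs => (hs ⟨h.mem, h.left, ha⟩).2.1 h.right⟩
  rintro E' ⟨hE', hq, ha'⟩
  refine ⟨hE', fun hp => ?_, ha'⟩
  rcases h.eq_or E' hE' (fun e => hq (e.1 hp)) with rfl | rfl
  · exact hq h.right
  · exact ha' ha

theorem ncard_sepSet_lt (h : IsEdge T E p q) (ha : a ∈ E) :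
    (sepSet T q a).ncard < (sepSet T p a).ncard :=
  Set.ncard_lt_ncard (sepSet_subset h ha) (hT.finite p a)

theorem exists_sepSet (h : ¬Unsep T p a) : (sepSet T p a).Nonempty := by
  simp only [Unsep, not_forall] at h
  obtain ⟨E, hE, h⟩ := h
  by_cases hp : p ∈ E
  · exact ⟨Eᶜ, hT.compl E hE, fun h' => h' hp, fun ha => h ⟨fun _ => ha, fun _ => hp⟩⟩
  · exact ⟨E, hE, hp, by by_contra ha; exact h ⟨fun k => absurd k hp, fun k => absurd k ha⟩⟩

/-- The first edge on the path between two separated points. -/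
theorem exists_isEdge (h : ¬Unsep T p a) : ∃ E q, IsEdge T E p q ∧ a ∈ E := by
  obtain ⟨E, ⟨hE, hp, ha⟩, hmax⟩ := (hT.finite p a).exists_maximal (hT.exists_sepSet h)
  obtain ⟨p', q', hp', hq', huniq⟩ := hT.edge E hE
  have key : ∀ E' ∈ T, p ∉ E' → q' ∈ E' → E' = E := by
    intro E' hE' hpE hqE
    by_contra hne
    have hp'E : p' ∈ E' := by
      by_contra hn
      rcases huniq E' hE' (fun e => hn (e.2 hqE)) with h | h
      · exact hne h
      · rw [h] at hpE; exact hpE hp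
    have hsub : E ⊆ E' := by
      intro b hb
      by_contra hbE
      exact hT.not_four hE hE' ⟨hq', hqE⟩ ⟨hb, hbE⟩ ⟨hp', hp'E⟩ ⟨hp, hpE⟩
    exact hne ((hmax ⟨hE', hpE, hsub ha⟩ hsub).antisymm hsub)
  refine ⟨E, q', ⟨hE, hp, hq', fun E' hE' hs => ?_⟩, ha⟩
  by_cases hpE : p ∈ E'
  · right
    rw [← key E'ᶜ (hT.compl E' hE') (fun h => h hpE) (fun hq => hs ⟨fun _ => hq, fun _ => hpE⟩),
      compl_compl]
  · left
    exact key E' hE' hpE (by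
      by_contra hq; exact hs ⟨fun k => absurd k hpE, fun k => absurd k hq⟩)

theorem mem_iff_of_between (h : IsEdge T E p q) (hs : ¬(a ∈ E ↔ p' ∈ E)) (hE' : E' ∈ T)
    (h₁ : E' ≠ E) (h₂ : E' ≠ Eᶜ) (hap : a ∈ E' ↔ p' ∈ E') : (a ∈ E' ↔ p ∈ E') := by
  have k := h.mem_iff hE' h₁ h₂
  have n₁ := h.left
  have n₂ := h.right
  have N := fun {a b c d : P} => hT.not_four (a := a) (b := b) (c := c) (d := d) h.mem hE'
  by_contra hn
  by_cases ha : a ∈ E <;> by_cases ha' : a ∈ E'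
  · exact @N a q p' p (by tauto) (by tauto) (by tauto) (by tauto)
  · exact @N q a p p' (by tauto) (by tauto) (by tauto) (by tauto)
  · exact @N p' q a p (by tauto) (by tauto) (by tauto) (by tauto)
  · exact @N q p' p a (by tauto) (by tauto) (by tauto) (by tauto)

/-- Moving one step towards the image under an involution that does not invert the edge
decreases the displacement. -/
theorem sepSet_involution_subset {ρ : G} (hρ : ρ * ρ = 1) (h : IsEdge T E p q)
    (hp : ρ • p ∈ E) (hE : ρ • E ≠ Eᶜ) : sepSet T q (ρ • q) ⊂ sepSet T p (ρ • p) := by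
  have hρe := hT.isEdge_smul h ρ
  have hqE : ρ • q ∈ E := by
    by_contra hn
    rcases hρe.eq_or E h.mem (fun e => hn (e.1 hp)) with h' | h'
    · apply hρe.left; rw [← h']; exact hp
    · exact hE (by rw [← compl_compl (ρ • E), ← h'])
  refine ⟨?_, fun hs => (hs ⟨h.mem, h.left, hp⟩).2.1 h.right⟩
  rintro E' ⟨hE', h₁, h₂⟩
  refine ⟨hE', fun hpE => ?_, ?_⟩
  · rcases h.eq_or E' hE' (fun e => h₁ (e.1 hpE)) with rfl | rfl
    · exact h₁ h.right
    · exact h₂ hqE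
  · by_contra hn
    have : E' = ρ • E := by
      rcases hρe.eq_or E' hE' (fun e => hn (e.2 h₂)) with h' | h'
      · exact h'
      · exfalso; rw [h'] at h₂; exact h₂ hρe.right
    rw [this] at h₁
    apply h₁
    rw [Set.mem_smul_set_iff_inv_smul_mem, inv_eq_of_mul_eq_one_left hρ]
    exact hqE

theorem ncard_sepSet_involution_lt {ρ : G} (hρ : ρ * ρ = 1) (h : IsEdge T E p q)
    (hp : ρ • p ∈ E) (hE : ρ • E ≠ Eᶜ) :
    (sepSet T q (ρ • q)).ncard < (sepSet T p (ρ • p)).ncard :=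
  Set.ncard_lt_ncard (hT.sepSet_involution_subset hρ h hp hE) (hT.finite _ _)

/-- The stabiliser of the base vertex. -/
def vstab : Subgroup G where
  carrier := {g | Unsep T (g • p₀) p₀}
  one_mem' := by simp only [Set.mem_ofPred_eq, one_smul]; exact Unsep.refl _
  mul_mem' := by
    intro a b ha hb
    simp only [Set.mem_ofPred_eq, mul_smul] at *
    exact (hT.unsep_smul hb a).trans ha
  inv_mem' := by
    intro a ha
    exact (hT.unsep_inv_smul_iff a).2 (Unsep.symm ha)

theorem mem_vstab {g : G} : g ∈ hT.vstab ↔ Unsep T (g • p₀) p₀ := Iff.rfl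

omit hT in
/-- The family obtained by removing the orbit of an edge, that is, by contracting the
corresponding edges of the tree. -/
def contract (G : Type*) {P : Type*} [Group G] [MulAction G P] (T : Set (Set P)) (E : Set P) :
    Set (Set P) :=
  {A ∈ T | ∀ g : G, A ≠ g • E ∧ A ≠ g • Eᶜ}

omit hT in
theorem contract_subset : contract G T E ⊆ T := fun _ h => h.1

omit hT in
theorem exists_of_notMem_contract (hE' : E' ∈ T) (h : E' ∉ contract G T E) :
    ∃ g : G, E' = g • E ∨ E' = g • Eᶜ := by
  by_contra! hn
  exact h ⟨hE', hn⟩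

theorem treeSystem_contract (h : IsEdge T E p₀ q) :
    TreeSystem F p₀ (contract G T E) := by
  refine ⟨?_, fun p q => (hT.finite p q).subset fun A hA => ⟨hA.1.1, hA.2⟩, ?_,
    fun A hA B hB => hT.nested A hA.1 B hB.1, ?_, fun g hg A hA => hT.stab g hg A hA.1, ?_⟩
  · rintro A ⟨hA, hA'⟩
    refine ⟨hT.compl A hA, fun g => ⟨fun e => (hA' g).2 ?_, fun e => (hA' g).1 ?_⟩⟩
    · rw [Set.smul_set_compl, ← e, compl_compl]
    · rw [← compl_inj_iff, e, Set.smul_set_compl]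
  · rintro A hA
    obtain ⟨p, q, h₁, h₂, h₃⟩ := hT.edge A hA.1
    exact ⟨p, q, h₁, h₂, fun E' hE' => h₃ E' hE'.1⟩
  · rintro g A ⟨hA, hA'⟩
    refine ⟨hT.smul g A hA, fun k => ⟨fun e => (hA' (g⁻¹ * k)).1 ?_, fun e => (hA' (g⁻¹ * k)).2 ?_⟩⟩
    · rw [mul_smul, ← e, inv_smul_smul]
    · rw [mul_smul, ← e, inv_smul_smul]
  · intro g hg hg1 p hp
    by_cases hpT : Unsep T (g • p) p
    · obtain ⟨k, hk⟩ := hT.vertex g hg hg1 p hpT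
      exact ⟨k, hk.mono contract_subset⟩
    · simp only [Unsep, not_forall] at hpT
      obtain ⟨E₁, hE₁, hs⟩ := hpT
      obtain ⟨k, hk⟩ := exists_of_notMem_contract hE₁ (fun h' => hs (hp E₁ h'))
      have hs' : ¬(p ∈ k • E ↔ g • p ∈ k • E) := by
        rcases hk with rfl | rfl
        · exact fun h => hs h.symm
        · rw [Set.smul_set_compl] at hs
          simp only [Set.mem_compl_iff] at hs
          tauto
      refine ⟨k, fun E' hE' => ?_⟩
      exact hT.mem_iff_of_between (hT.isEdge_smul h k) hs' hE'.1 (hE'.2 k).1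
        (by rw [← Set.smul_set_compl]; exact (hE'.2 k).2) (hp E' hE').symm

end TreeSystem

section PingPong

variable {ι α G : Type*} [Group G] [MulAction G α]

/-- A version of the ping-pong lemma with a base point. -/
theorem FreeGroup.injective_lift_of_base_point (a : ι → G) (X : ι → Bool → Set α)
    (hdisj : ∀ i c j d, ∀ y ∈ X i c, y ∈ X j d → i = j ∧ c = d)
    (hpos : ∀ i, ∀ y ∉ X i false, a i • y ∈ X i true)
    (hneg : ∀ i, ∀ y ∉ X i true, (a i)⁻¹ • y ∈ X i false) (x : α) (hx : ∀ i c, x ∉ X i c) :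
    Function.Injective (FreeGroup.lift a) := by
  classical
  have key : ∀ (L : List (ι × Bool)) (i : ι) (c : Bool), FreeGroup.IsReduced ((i, c) :: L) →
      FreeGroup.lift a (FreeGroup.mk ((i, c) :: L)) • x ∈ X i c := by
    intro L
    induction L with
    | nil =>
      intro i c _
      cases c
      · simpa using hneg i x (hx _ _)
      · simpa using hpos i x (hx _ _)
    | cons b L ih =>
      obtain ⟨j, d⟩ := b
      intro i c hr
      rw [FreeGroup.isReduced_cons_cons] at hr
      have h := ih j d hr.2
      have hn : FreeGroup.lift a (FreeGroup.mk ((j, d) :: L)) • x ∉ X i (!c) := by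
        intro h'
        obtain ⟨h₁, h₂⟩ := hdisj _ _ _ _ _ h h'
        have := hr.1 h₁.symm
        simp only at this
        rw [this] at h₂
        exact absurd h₂ (by simp)
      have hm : FreeGroup.mk ((i, c) :: (j, d) :: L) =
          FreeGroup.mk [(i, c)] * FreeGroup.mk ((j, d) :: L) := by
        rw [FreeGroup.mul_mk]; rfl
      rw [hm, _root_.map_mul, mul_smul]
      cases c
      · simpa using hneg i _ hn
      · simpa using hpos i _ hn
  rw [injective_iff_map_eq_one]
  intro w hw
  rw [← FreeGroup.toWord_eq_nil_iff]
  have hr := FreeGroup.isReduced_toWord (x := w)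
  rcases h : w.toWord with _ | ⟨⟨i, c⟩, L⟩
  · rfl
  · rw [h] at hr
    have := key L i c hr
    rw [← h, FreeGroup.mk_toWord, hw, one_smul] at this
    exact absurd this (hx _ _)

end PingPong

section FreeOn

variable {G : Type*} [Group G]

/-- The set `S` is a basis of the subgroup it generates. -/
def FreeOn (S : Set G) : Prop := Function.Injective (FreeGroup.lift (fun s : S => (s : G)))

theorem FreeOn.range {ι : Type*} {f : ι → G} (hf : Function.Injective (FreeGroup.lift f)) :
    FreeOn (Set.range f) := by
  have hinj : Function.Injective f := by
    intro i j hij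
    exact FreeGroup.of_injective (hf (by simpa using hij))
  have : FreeGroup.lift (fun s : Set.range f => (s : G)) =
      (FreeGroup.lift f).comp
        (FreeGroup.freeGroupCongr (Equiv.ofInjective f hinj).symm).toMonoidHom := by
    ext ⟨_, i, rfl⟩
    simp [Equiv.ofInjective_symm_apply]
  rw [FreeOn, this]
  exact hf.comp (MulEquiv.injective _)

theorem FreeOn.injective_comp {ι : Type*} {S : Set G} (hS : FreeOn S) {f : ι → G}
    (hf : Function.Injective f) (hfS : ∀ i, f i ∈ S) : Function.Injective (FreeGroup.lift f) := by
  have : FreeGroup.lift f = (FreeGroup.lift (fun s : S => (s : G))).comp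
      (FreeGroup.map fun i => ⟨f i, hfS i⟩) := by
    ext i
    simp
  rw [this]
  exact hS.comp (FreeGroup.map_injective fun i j h => hf (congrArg Subtype.val h))

theorem range_lift_coe (S : Set G) :
    (FreeGroup.lift (fun s : S => (s : G))).range = Subgroup.closure S := by
  rw [FreeGroup.range_lift_eq_closure, Subtype.range_coe]

theorem FreeOn.image {H : Type*} [Group H] {S : Set G} (hS : FreeOn S) {φ : G →* H}
    (hφ : Function.Injective φ) : FreeOn (φ '' S) := by
  have : φ '' S = Set.range (fun s : S => φ s) := by ext; simp
  rw [this]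
  apply FreeOn.range
  have : FreeGroup.lift (fun s : S => φ s) = φ.comp (FreeGroup.lift (fun s : S => (s : G))) := by
    ext; simp
  rw [this]
  exact hφ.comp hS

/-- Adjoining to a free family new letters which play ping-pong with the subgroup generated by
that family. -/
theorem FreeOn.union_range {ν : Type*} {S : Set G} (hS : FreeOn S) (n : ν → G)
    (Y : ν → Bool → Set G) (hdisj : ∀ i c j d, ∀ y ∈ Y i c, y ∈ Y j d → i = j ∧ c = d)
    (hpos : ∀ i, ∀ y ∉ Y i false, n i * y ∈ Y i true)
    (hneg : ∀ i, ∀ y ∉ Y i true, (n i)⁻¹ * y ∈ Y i false)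
    (hcl : ∀ k ∈ Subgroup.closure S, ∀ i c, k ∉ Y i c)
    (hfree : ∀ k ∈ Subgroup.closure S, ∀ i c j d, ∀ f ∈ Y i c, k * f ∈ Y j d → k = 1) :
    FreeOn (S ∪ Set.range n) := by
  classical
  have hproj : ∃ π : G → FreeGroup S, (∀ s : S, ∀ f, π (s * f) = FreeGroup.of s * π f) ∧
      ∀ i c, ∀ f ∈ Y i c, π f = 1 := by
    set K := Subgroup.closure S with hK
    have hrep : ∀ f : G, ∃ r : G, f * r⁻¹ ∈ K ∧ ((∃ i c, r ∈ Y i c) ∨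
        ∀ k ∈ K, ∀ i c, k * f ∉ Y i c) := by
      intro f
      by_cases h : ∃ k ∈ K, ∃ i c, k * f ∈ Y i c
      · obtain ⟨k, hk, i, c, h⟩ := h
        exact ⟨k * f, by simpa using hk, Or.inl ⟨i, c, h⟩⟩
      · push Not at h
        exact ⟨f, by simp [K.one_mem], Or.inr h⟩
    -- canonical representatives, constant on cosets
    let rep : G → G := fun f =>
      Classical.choose (hrep (Quotient.out (Quotient.mk (QuotientGroup.rightRel K) f)))
    have hout : ∀ f, Quotient.out (Quotient.mk (QuotientGroup.rightRel K) f) * f⁻¹ ∈ K := by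
      intro f
      have := Quotient.mk_out (s := QuotientGroup.rightRel K) f
      have h2 := QuotientGroup.rightRel_apply.1 this
      simpa using K.inv_mem h2
    have hrep₁ : ∀ f, f * (rep f)⁻¹ ∈ K := by
      intro f
      have h := (Classical.choose_spec (hrep
        (Quotient.out (Quotient.mk (QuotientGroup.rightRel K) f)))).1
      have := K.mul_mem (K.inv_mem (hout f)) h
      simpa [mul_assoc, rep] using this
    have hrepY : ∀ i c, ∀ f ∈ Y i c, rep f = f := by
      intro i c f hf
      rcases (Classical.choose_spec (hrep
        (Quotient.out (Quotient.mk (QuotientGroup.rightRel K) f)))).2 with ⟨j, d, h⟩ | h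
      · have := hfree _ (hrep₁ f) j d i c _ h (by simpa [rep] using hf)
        rw [mul_inv_eq_one] at this
        exact this.symm
      · exact absurd hf (by simpa using h _ (K.inv_mem (hout f)) i c)
    have hrepmul : ∀ k ∈ K, ∀ f, rep (k * f) = rep f := by
      intro k hk f
      have : Quotient.mk (QuotientGroup.rightRel K) (k * f) =
          Quotient.mk (QuotientGroup.rightRel K) f := by
        apply Quotient.sound
        apply QuotientGroup.rightRel_apply.2
        simpa using hk
      simp only [rep, this]
    have hlift : ∀ f, ∃ w : FreeGroup S, FreeGroup.lift (fun s : S => (s : G)) w =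
        f * (rep f)⁻¹ := by
      intro f
      have := hrep₁ f
      rw [hK, ← range_lift_coe] at this
      exact this
    choose π hπ using hlift
    refine ⟨π, fun s f => hS ?_, fun i c f hf => hS ?_⟩
    · rw [hπ, map_mul, hπ, hrepmul _ (Subgroup.subset_closure s.2)]
      simp [mul_assoc]
    · rw [hπ, hrepY i c f hf]
      simp
  obtain ⟨π, hπs, hπY⟩ := hproj
  have hr : S ∪ Set.range n = Set.range (Sum.elim (fun s : S => (s : G)) n) := by
    rw [Set.Sum.elim_range, Subtype.range_coe]
  rw [hr]
  apply FreeOn.range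
  have hπinv : ∀ (s : S) f, π ((s : G)⁻¹ * f) = (FreeGroup.of s)⁻¹ * π f := by
    intro s f
    rw [eq_inv_mul_iff_mul_eq, ← hπs, mul_inv_cancel_left]
  have hπlift : ∀ (w : FreeGroup S) f,
      π (FreeGroup.lift (fun s : S => (s : G)) w * f) = w * π f := by
    intro w
    induction w using FreeGroup.induction_on with
    | C1 => simp
    | of s => simp [hπs]
    | inv_of s _ => intro f; simpa using hπinv s f
    | mul a b ha hb => intro f; rw [map_mul, mul_assoc, ha, hb, mul_assoc]
  refine FreeGroup.injective_lift_of_base_point (α := G) _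
    (Sum.elim (fun s c => {f | π f ∈ FreeGroup.startsWith (s, c)}) Y) ?_ ?_ ?_
    (FreeGroup.lift (fun s : S => (s : G)) (π 1)⁻¹) ?_
  · rintro (s | i) c (t | j) d y hy hy'
    · by_contra hne
      have : ((s, c) : S × Bool) ≠ (t, d) := by
        intro h; exact hne (by simpa using h)
      exact Set.disjoint_left.1 (FreeGroup.startsWith.disjoint_iff_ne.2 this) hy hy'
    · have := hπY _ _ _ hy'
      exact absurd this (FreeGroup.startsWith.ne_one _ hy)
    · have := hπY _ _ _ hy
      exact absurd this (FreeGroup.startsWith.ne_one _ hy')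
    · obtain ⟨rfl, rfl⟩ := hdisj _ _ _ _ _ hy hy'
      exact ⟨rfl, rfl⟩
  · rintro (s | i) y hy
    · have := FreeGroup.startsWith_mk_mul (w := (s, true)) (g := π y) hy
      simp only [Sum.elim_inl, smul_eq_mul, Set.mem_ofPred_eq, hπs]
      exact this
    · exact hpos i y hy
  · rintro (s | i) y hy
    · have := FreeGroup.startsWith_mk_mul (w := (s, false)) (g := π y) hy
      simp only [Sum.elim_inl, smul_eq_mul, Set.mem_ofPred_eq, hπinv]
      exact this
    · exact hneg i y hy
  · have h1 : π (FreeGroup.lift (fun s : S => (s : G)) (π 1)⁻¹) = 1 := by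
      have := hπlift (π 1)⁻¹ 1
      rwa [mul_one, inv_mul_cancel] at this
    rintro (s | i) c h
    · exact FreeGroup.startsWith.ne_one _ h h1
    · refine hcl _ ?_ _ _ h
      rw [← range_lift_coe]
      exact ⟨_, rfl⟩

end FreeOn

section Adapted

variable {G : Type*} [Group G]

/-- The possible ways in which conjugation by `τ` moves a member `s` of a family `S`: it inverts
`s`, it multiplies `s` on both sides by inverted members of the family, or it sends `s` to another
member of the family. -/
def AdaptedElt (τ : G) (S : Set G) (s : G) : Prop :=
  τ * s * τ = s⁻¹ ∨
    (∃ a ∈ insert 1 S, ∃ b ∈ insert 1 S, τ * a * τ = a⁻¹ ∧ τ * b * τ = b⁻¹ ∧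
      τ * s * τ = b * s * a⁻¹) ∨ τ * s * τ ∈ S

/-- The set `S` is a basis of `H ⊓ F` that is adapted to the involution `τ ∈ H`. -/
structure IsAdapted (F : Subgroup G) (τ : G) (S : Set G) (H : Subgroup G) : Prop where
  mem : τ ∈ H
  free : FreeOn S
  closure_eq : Subgroup.closure S = H ⊓ F
  elt : ∀ s ∈ S, AdaptedElt τ S s
  conj : ∀ ρ ∈ H, ρ ∉ F → ρ * ρ = 1 →
    ∃ a ∈ H ⊓ F, ∃ x ∈ insert 1 S, τ * x * τ = x⁻¹ ∧ ρ = a * (τ * x) * a⁻¹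

theorem AdaptedElt.mono {τ s : G} {S S' : Set G} (h : AdaptedElt τ S s) (hS : S ⊆ S') :
    AdaptedElt τ S' s := by
  rcases h with h | ⟨a, ha, b, hb, h⟩ | h
  · exact Or.inl h
  · exact Or.inr (Or.inl ⟨a, Set.insert_subset_insert hS ha, b, Set.insert_subset_insert hS hb, h⟩)
  · exact Or.inr (Or.inr (hS h))

theorem insert_one_subset_closure (S : Set G) :
    insert 1 S ⊆ (Subgroup.closure S : Set G) :=
  Set.insert_subset (Subgroup.one_mem _) Subgroup.subset_closure

theorem AdaptedElt.mem_closure {τ s : G} {S : Set G} (hs : s ∈ S) (h : AdaptedElt τ S s) :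
    τ * s * τ ∈ Subgroup.closure S := by
  have hs' := Subgroup.subset_closure hs
  rcases h with h | ⟨a, ha, b, hb, -, -, h⟩ | h
  · rw [h]; exact Subgroup.inv_mem _ hs'
  · rw [h]
    exact Subgroup.mul_mem _ (Subgroup.mul_mem _ (insert_one_subset_closure S hb) hs')
      (Subgroup.inv_mem _ (insert_one_subset_closure S ha))
  · exact Subgroup.subset_closure h

theorem conj_mem_closure {τ : G} (hτ : τ * τ = 1) {S : Set G} (h : ∀ s ∈ S, AdaptedElt τ S s) :
    ∀ g ∈ Subgroup.closure S, τ * g * τ ∈ Subgroup.closure S := by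
  intro g hg
  induction hg using Subgroup.closure_induction with
  | mem s hs => exact (h s hs).mem_closure hs
  | one => simp [hτ]
  | mul a b _ _ ha hb =>
    have : τ * (a * b) * τ = (τ * a * τ) * (τ * b * τ) := by
      calc τ * (a * b) * τ = τ * a * 1 * b * τ := by group
        _ = _ := by rw [← hτ]; group
    rw [this]; exact Subgroup.mul_mem _ ha hb
  | inv a _ ha =>
    have : τ * a⁻¹ * τ = (τ * a * τ)⁻¹ := by
      have hτ' : τ⁻¹ = τ := inv_eq_of_mul_eq_one_left hτ
      simp [mul_inv_rev, hτ', mul_assoc]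
    rw [this]; exact Subgroup.inv_mem _ ha

theorem mem_or_mul_mem_of_mem_closure {τ : G} (hτ : τ * τ = 1) {M : Subgroup G}
    (hM : ∀ g ∈ M, τ * g * τ ∈ M) {g : G} (hg : g ∈ Subgroup.closure (insert τ (M : Set G))) :
    g ∈ M ∨ g * τ ∈ M := by
  have hτ' : τ⁻¹ = τ := inv_eq_of_mul_eq_one_left hτ
  have key : ∀ x y : G, x * y = x * (τ * τ) * y := by intro x y; rw [hτ, mul_one]
  induction hg using Subgroup.closure_induction with
  | mem s hs =>
    rcases hs with rfl | hs
    · right; rw [hτ]; exact M.one_mem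
    · exact Or.inl hs
  | one => exact Or.inl M.one_mem
  | mul a b _ _ ha hb =>
    rcases ha with ha | ha <;> rcases hb with hb | hb
    · exact Or.inl (M.mul_mem ha hb)
    · right; rw [mul_assoc]; exact M.mul_mem ha hb
    · right
      have : a * b * τ = a * τ * (τ * b * τ) := by rw [key a b]; group
      rw [this]; exact M.mul_mem ha (hM _ hb)
    · left
      have : a * b = a * τ * (τ * (b * τ) * τ) := by
        have : a * τ * (τ * (b * τ) * τ) = a * (τ * τ) * b * (τ * τ) := by group
        rw [this, hτ]; simp
      rw [this]; exact M.mul_mem ha (hM _ hb)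
  | inv a _ ha =>
    rcases ha with ha | ha
    · exact Or.inl (M.inv_mem ha)
    · right
      have : a⁻¹ * τ = τ * (a * τ)⁻¹ * τ := by rw [mul_inv_rev, hτ', ← mul_assoc, hτ, one_mul]
      rw [this]; exact hM _ (M.inv_mem ha)

/-- Criterion for extending an adapted basis. -/
theorem IsAdapted.extend {F : Subgroup G} {τ : G} {S N : Set G} {H H' : Subgroup G}
    (hF : ∀ g h, g ∉ F → h ∉ F → g * h ∈ F) (hτF : τ ∉ F) (hτ : τ * τ = 1)
    (h : IsAdapted F τ S H) (hH : H ≤ H') (hN : N ⊆ (H' ⊓ F : Subgroup G))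
    (hfree : FreeOn (S ∪ N)) (helt : ∀ n ∈ N, AdaptedElt τ (S ∪ N) n)
    (hgen : H' ≤ Subgroup.closure ((H : Set G) ∪ N))
    (hconj : ∀ ρ ∈ H', ρ ∉ F → ρ * ρ = 1 → ∃ k ∈ H', k⁻¹ * ρ * k ∈ H ∨ τ * (k⁻¹ * ρ * k) ∈ N) :
    IsAdapted F τ (S ∪ N) H' := by
  have helt' : ∀ s ∈ S ∪ N, AdaptedElt τ (S ∪ N) s := by
    rintro s (hs | hs)
    · exact (h.elt s hs).mono Set.subset_union_left
    · exact helt s hs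
  have hSF : S ⊆ (H ⊓ F : Subgroup G) := by rw [← h.closure_eq]; exact Subgroup.subset_closure
  have hle : Subgroup.closure (S ∪ N) ≤ H' ⊓ F := by
    rw [Subgroup.closure_le]
    exact Set.union_subset (hSF.trans (inf_le_inf_right F hH)) hN
  refine ⟨hH h.mem, hfree, le_antisymm hle ?_, helt', ?_⟩
  · set M := Subgroup.closure (S ∪ N)
    rintro g ⟨hg, hgF⟩
    have h1 : Subgroup.closure ((H : Set G) ∪ N) ≤ Subgroup.closure (insert τ (M : Set G)) := by
      rw [Subgroup.closure_le]
      have hMτ : M ≤ Subgroup.closure (insert τ (M : Set G)) :=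
        fun x hx => Subgroup.subset_closure (Or.inr hx)
      have hS : H ⊓ F ≤ M := by
        rw [← h.closure_eq]; exact Subgroup.closure_mono Set.subset_union_left
      rintro x (hx | hx)
      · by_cases hxF : x ∈ F
        · exact hMτ (hS ⟨hx, hxF⟩)
        · have h2 : x * τ ∈ M := hS ⟨H.mul_mem hx h.mem, hF _ _ hxF hτF⟩
          have h3 : x = x * τ * τ := by rw [mul_assoc, hτ, mul_one]
          rw [h3]
          exact Subgroup.mul_mem _ (hMτ h2) (Subgroup.subset_closure (Or.inl rfl))
      · exact hMτ (Subgroup.subset_closure (Or.inr hx))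
    rcases mem_or_mul_mem_of_mem_closure hτ (conj_mem_closure hτ helt') (h1 (hgen hg)) with h2 | h2
    · exact h2
    · exact absurd ((F.mul_mem_cancel_left hgF).1 (hle h2).2) hτF
  · intro ρ hρ hρF hρ2
    obtain ⟨k, hk, hk'⟩ := hconj ρ hρ hρF hρ2
    have hρF' : k⁻¹ * ρ * k ∉ F := by
      intro hc
      by_cases hkF : k ∈ F
      · exact hρF ((F.mul_mem_cancel_left (F.inv_mem hkF)).1 ((F.mul_mem_cancel_right hkF).1 hc))
      · have h1 : ρ * k ∈ F := hF _ _ hρF hkF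
        rw [mul_assoc] at hc
        exact hkF (by simpa using F.inv_mem ((F.mul_mem_cancel_right h1).1 hc))
    have hρ2' : (k⁻¹ * ρ * k) * (k⁻¹ * ρ * k) = 1 := by
      have : (k⁻¹ * ρ * k) * (k⁻¹ * ρ * k) = k⁻¹ * (ρ * ρ) * k := by group
      rw [this, hρ2]; group
    obtain ⟨l, hl, x, hx, hx1, hx2⟩ : ∃ l ∈ H', ∃ x ∈ insert 1 (S ∪ N), τ * x * τ = x⁻¹ ∧
        ρ = l * (τ * x) * l⁻¹ := by
      rcases hk' with hk' | hk'
      · obtain ⟨a, ha, x, hx, hx1, hx2⟩ := h.conj _ hk' hρF' hρ2'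
        refine ⟨k * a, H'.mul_mem hk (hH ha.1), x,
          Set.insert_subset_insert Set.subset_union_left hx, hx1, ?_⟩
        calc ρ = k * (k⁻¹ * ρ * k) * k⁻¹ := by group
          _ = _ := by rw [hx2]; group
      · refine ⟨k, hk, _, Or.inr (Or.inr hk'), ?_, ?_⟩
        · rw [mul_inv_rev, inv_eq_of_mul_eq_one_left hρ2', inv_eq_of_mul_eq_one_left hτ,
            ← mul_assoc τ τ, hτ, one_mul]
        · rw [← mul_assoc τ τ, hτ, one_mul]; group
    by_cases hlF : l ∈ F
    · exact ⟨l, ⟨hl, hlF⟩, x, hx, hx1, hx2⟩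
    · have hxH : x ∈ H' ⊓ F := hle (insert_one_subset_closure _ hx)
      have hτxF : τ * x ∉ F := fun hc => hτF ((F.mul_mem_cancel_right hxH.2).1 hc)
      refine ⟨l * (τ * x), ⟨H'.mul_mem hl (H'.mul_mem (hH h.mem) hxH.1), hF _ _ hlF hτxF⟩, x, hx,
        hx1, ?_⟩
      rw [hx2]; group

end Adapted

namespace TreeSystem

variable {G P : Type*} [Group G] [MulAction G P] {F : Subgroup G} {p₀ : P} {T : Set (Set P)}
  (hT : TreeSystem F p₀ T) {E E' : Set P} {p q : P}

include hT

theorem freeOn_union_range {ν : Type*} {S : Set G} (hS : FreeOn S)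
    (hcl : Subgroup.closure S = hT.vstab ⊓ F) (n : ν → G) (e : ν → Bool → Set P)
    (he : ∀ i c, ∃ q, IsEdge T (e i c) p₀ q) (hn : ∀ i, n i • (e i false)ᶜ ⊆ e i true)
    (huniq : ∀ k ∈ hT.vstab ⊓ F, ∀ i c j d, k • e i c = e j d → i = j ∧ c = d) :
    FreeOn (S ∪ Set.range n) := by
  refine hS.union_range n (fun i c => {g | g • p₀ ∈ e i c}) ?_ ?_ ?_ ?_ ?_
  · intro i c j d y hy hy'
    obtain ⟨q, hq⟩ := he i c
    obtain ⟨q', hq'⟩ := he j d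
    by_contra hne
    refine Set.disjoint_left.1 (hT.disjoint_of_isEdge hq hq' fun h => hne ?_) hy hy'
    exact huniq 1 (Subgroup.one_mem _) i c j d (by rw [one_smul, h])
  · intro i y hy
    simp only [Set.mem_ofPred_eq, mul_smul] at hy ⊢
    exact hn i (Set.smul_mem_smul_set hy)
  · intro i y hy
    simp only [Set.mem_ofPred_eq, mul_smul] at hy ⊢
    by_contra hc
    apply hy
    have := hn i (Set.smul_mem_smul_set (a := n i) hc)
    rwa [smul_inv_smul] at this
  · intro k hk i c hc
    rw [hcl] at hk
    obtain ⟨q, hq⟩ := he i c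
    exact hq.left ((hk.1 _ hq.mem).1 hc)
  · intro k hk i c j d f hf hf'
    rw [hcl] at hk
    obtain ⟨q, hq⟩ := he i c
    obtain ⟨q', hq'⟩ := he j d
    have hkq := (hT.isEdge_smul hq k).of_unsep_left hk.1
    have heq : k • e i c = e j d := by
      by_contra hne
      refine Set.disjoint_left.1 (hT.disjoint_of_isEdge hkq hq' hne)
        (Set.smul_mem_smul_set (a := k) hf) ?_
      rw [← mul_smul]; exact hf'
    obtain ⟨rfl, rfl⟩ := huniq k hk i c j d heq
    exact hT.stab k hk.2 _ hq.mem heq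

omit hT in
theorem ne_compl_self (h : IsEdge T E p q) : E ≠ Eᶜ := fun e => by
  have := h.right; rw [e] at this; exact this h.right

/-- No element of a subgroup without involutions inverts an edge. -/
theorem smul_ne_compl (htf : ∀ g ∈ F, g * g = 1 → g = 1) (h : IsEdge T E p q) {g : G}
    (hg : g ∈ F) : g • E ≠ Eᶜ := by
  intro e
  have h1 : (g * g) • E = E := by rw [mul_smul, e, Set.smul_set_compl, e, compl_compl]
  have h2 := htf g hg (hT.stab _ (F.mul_mem hg hg) E h.mem h1)
  rw [h2, one_smul] at e
  exact ne_compl_self h e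

theorem unsep_contract (h : IsEdge T E p q) (g : G) : Unsep (contract G T E) (g • p) (g • q) := by
  intro E' hE'
  by_contra hs
  rcases (hT.isEdge_smul h g).eq_or E' hE'.1 hs with h' | h'
  · exact (hE'.2 g).1 h'
  · exact (hE'.2 g).2 (by rw [h', Set.smul_set_compl])

end TreeSystem

namespace TreeSystem

variable {G P : Type*} [Group G] [MulAction G P] {F : Subgroup G} {p₀ : P} {T : Set (Set P)}
  (hT : TreeSystem F p₀ T) {E E' : Set P} {q a : P} (h : IsEdge T E p₀ q)

include hT h

theorem vstab_le_contract : hT.vstab ≤ (hT.treeSystem_contract h).vstab :=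
  fun _ hg => Unsep.mono hg contract_subset

theorem exists_smul_eq_of_isEdge {E₁ : Set P} {p q₁ : P} (he : IsEdge T E₁ p q₁) (ha : a ∈ E₁)
    (hpa : Unsep (contract G T E) p a) : ∃ k : G, E₁ = k • E ∨ E₁ = k • Eᶜ :=
  exists_of_notMem_contract he.mem fun hc => he.left ((hpa E₁ hc).2 ha)

section Orbit

variable {s : G} (hs : Unsep T q (s • p₀))

include hs

theorem mem_vstab_contract : s ∈ (hT.treeSystem_contract h).vstab := by
  have h1 := hT.unsep_contract h 1
  rw [one_smul, one_smul] at h1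
  exact (h1.trans (hs.mono contract_subset)).symm

theorem exists_step (hpa : Unsep (contract G T E) p₀ a) (hn : ¬Unsep T p₀ a) :
    ∃ E₁ g, IsEdge T E₁ p₀ (g • p₀) ∧ a ∈ E₁ ∧ g ∈ Subgroup.closure ((hT.vstab : Set G) ∪ {s}) ∧
      ∃ k ∈ (hT.treeSystem_contract h).vstab, E₁ = k • E ∨ E₁ = k • Eᶜ := by
  obtain ⟨E₁, q₁, he, ha⟩ := hT.exists_isEdge hn
  obtain ⟨k, hk⟩ := hT.exists_smul_eq_of_isEdge h he ha hpa
  have hsc : s ∈ Subgroup.closure ((hT.vstab : Set G) ∪ {s}) :=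
    Subgroup.subset_closure (Or.inr rfl)
  have hHc : ∀ x ∈ hT.vstab, x ∈ Subgroup.closure ((hT.vstab : Set G) ∪ {s}) :=
    fun x hx => Subgroup.subset_closure (Or.inl hx)
  have hks : Unsep T (k • q) ((k * s) • p₀) := by rw [mul_smul]; exact hT.unsep_smul hs k
  refine ⟨E₁, ?_⟩
  rcases hk with hk | hk
  · have he' := hT.isEdge_smul h k
    rw [← hk] at he'
    have hkH : k ∈ hT.vstab := hT.unsep_left_of_isEdge he' he
    exact ⟨k * s, he.of_unsep_right ((hT.unsep_right_of_isEdge he he').trans hks), ha,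
      Subgroup.mul_mem _ (hHc _ hkH) hsc, k, hT.vstab_le_contract h hkH, Or.inl hk⟩
  · have he' := hT.isEdge_smul (hT.isEdge_compl h) k
    rw [← hk] at he'
    have hkH : k * s ∈ hT.vstab := hks.symm.trans (hT.unsep_left_of_isEdge he' he)
    have hk' : k = k * s * s⁻¹ := by group
    refine ⟨k, he.of_unsep_right (hT.unsep_right_of_isEdge he he'), ha, ?_, k, ?_, Or.inr hk⟩
    · rw [hk']; exact Subgroup.mul_mem _ (hHc _ hkH) (Subgroup.inv_mem _ hsc)
    · rw [hk']
      exact Subgroup.mul_mem _ (hT.vstab_le_contract h hkH)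
        (Subgroup.inv_mem _ (hT.mem_vstab_contract h hs))

theorem closure_le_vstab_contract :
    Subgroup.closure ((hT.vstab : Set G) ∪ {s}) ≤ (hT.treeSystem_contract h).vstab := by
  rw [Subgroup.closure_le]
  exact Set.union_subset (hT.vstab_le_contract h)
    (Set.singleton_subset_iff.2 (hT.mem_vstab_contract h hs))

theorem vstab_contract_le :
    (hT.treeSystem_contract h).vstab ≤ Subgroup.closure ((hT.vstab : Set G) ∪ {s}) := by
  intro g hg
  induction hn : (sepSet T p₀ (g • p₀)).ncard using Nat.strong_induction_on generalizing g with
  | _ n ih =>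
  by_cases hu : Unsep T p₀ (g • p₀)
  · exact Subgroup.subset_closure (Or.inl hu.symm)
  obtain ⟨E₁, k, he, ha, hk, -⟩ := hT.exists_step h hs (Unsep.symm hg) hu
  have hk' := hT.closure_le_vstab_contract h hs hk
  have hlt := hT.ncard_sepSet_lt he ha
  have h1 := ih (sepSet T p₀ ((k⁻¹ * g) • p₀)).ncard (by
    rw [← hT.ncard_sepSet_smul k, ← mul_smul, mul_inv_cancel_left, ← hn]; exact hlt)
    (Subgroup.mul_mem _ (Subgroup.inv_mem _ hk') hg) rfl
  have : g = k * (k⁻¹ * g) := by group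
  rw [this]
  exact Subgroup.mul_mem _ hk h1

theorem exists_conj_of_orbit {ρ : G} (hρ : ρ ∈ (hT.treeSystem_contract h).vstab)
    (hρ2 : ρ * ρ = 1) : ∃ k ∈ (hT.treeSystem_contract h).vstab,
      k⁻¹ * ρ * k ∈ hT.vstab ∨ (k⁻¹ * ρ * k) • E = Eᶜ := by
  induction hn : (sepSet T p₀ (ρ • p₀)).ncard using Nat.strong_induction_on generalizing ρ with
  | _ n ih =>
  by_cases hu : Unsep T p₀ (ρ • p₀)
  · exact ⟨1, Subgroup.one_mem _, Or.inl (by simpa [mem_vstab] using hu.symm)⟩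
  obtain ⟨E₁, g, he, ha, hg, k, hk, hE₁⟩ := hT.exists_step h hs (Unsep.symm hρ) hu
  by_cases hinv : ρ • E₁ = E₁ᶜ
  · refine ⟨k, hk, Or.inr ?_⟩
    rw [mul_smul, mul_smul, inv_smul_eq_iff]
    rcases hE₁ with rfl | rfl
    · rw [hinv, Set.smul_set_compl]
    · rw [← compl_inj_iff, ← Set.smul_set_compl, ← Set.smul_set_compl, hinv, Set.smul_set_compl]
  · have hg' := hT.closure_le_vstab_contract h hs hg
    have hlt := hT.ncard_sepSet_involution_lt hρ2 he ha hinv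
    obtain ⟨l, hl, hl'⟩ := ih (sepSet T p₀ ((g⁻¹ * ρ * g) • p₀)).ncard (by
      rw [← hT.ncard_sepSet_smul g, ← mul_smul, ← hn, mul_assoc, mul_inv_cancel_left, mul_smul]
      exact hlt) (Subgroup.mul_mem _ (Subgroup.mul_mem _ (Subgroup.inv_mem _ hg') hρ) hg')
      (by
        have : g⁻¹ * ρ * g * (g⁻¹ * ρ * g) = g⁻¹ * (ρ * ρ) * g := by group
        rw [this, hρ2]; group) rfl
    refine ⟨g * l, Subgroup.mul_mem _ hg' hl, ?_⟩
    have : (g * l)⁻¹ * ρ * (g * l) = l⁻¹ * (g⁻¹ * ρ * g) * l := by group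
    rw [this]
    exact hl'

end Orbit

section NonOrbit

variable (hno : ∀ g : G, ¬Unsep T q (g • p₀))

include hno

theorem eq_one_of_unsep {g : G} (hg : g ∈ F) (hgq : Unsep T (g • q) q) : g = 1 := by
  by_contra hg1
  obtain ⟨k, hk⟩ := hT.vertex g hg hg1 q hgq
  exact hno k hk

theorem not_unsep_smul (k g : G) : ¬Unsep T (k • q) (g • p₀) := by
  intro hk
  apply hno (k⁻¹ * g)
  rw [mul_smul, ← hT.unsep_smul_iff k, smul_inv_smul]
  exact hk

theorem exists_first_step (hpa : Unsep (contract G T E) p₀ a) (hn : ¬Unsep T p₀ a) :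
    ∃ k ∈ hT.vstab, IsEdge T (k • E) p₀ (k • q) ∧ a ∈ k • E := by
  obtain ⟨E₁, q₁, he, ha⟩ := hT.exists_isEdge hn
  obtain ⟨k, hk⟩ := hT.exists_smul_eq_of_isEdge h he ha hpa
  rcases hk with rfl | rfl
  · have he' := hT.isEdge_smul h k
    have hkH := hT.unsep_left_of_isEdge he' he
    exact ⟨k, hkH, he'.of_unsep_left hkH, ha⟩
  · have he' := hT.isEdge_smul (hT.isEdge_compl h) k
    have hkH := hT.unsep_left_of_isEdge he' he
    exact absurd (by rw [one_smul]; exact hkH) (hT.not_unsep_smul h hno k 1)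

theorem exists_second_step {k : G} (hk : k ∈ (hT.treeSystem_contract h).vstab)
    (hpa : Unsep (contract G T E) (k • q) a) (hn : ¬Unsep T (k • q) a) :
    ∃ k₂ ∈ (hT.treeSystem_contract h).vstab, Unsep T (k₂ • q) (k • q) ∧
      IsEdge T (k₂ • Eᶜ) (k • q) (k₂ • p₀) ∧ a ∈ k₂ • Eᶜ := by
  obtain ⟨E₁, q₁, he, ha⟩ := hT.exists_isEdge hn
  obtain ⟨k₂, hk₂⟩ := hT.exists_smul_eq_of_isEdge h he ha hpa
  rcases hk₂ with rfl | rfl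
  · have he' := hT.isEdge_smul h k₂
    exact absurd (hT.unsep_left_of_isEdge he he') (hT.not_unsep_smul h hno k k₂)
  · have he' := hT.isEdge_smul (hT.isEdge_compl h) k₂
    have hkH := hT.unsep_left_of_isEdge he' he
    refine ⟨k₂, ?_, hkH, he'.of_unsep_left hkH, ha⟩
    exact (hT.unsep_contract h k₂).trans ((hkH.mono contract_subset).trans
      ((hT.unsep_contract h k).symm.trans hk))

theorem exists_two_steps {g : G} (hg : g ∈ (hT.treeSystem_contract h).vstab)
    (hgH : g ∉ hT.vstab) : ∃ k ∈ hT.vstab, ∃ k₂ ∈ (hT.treeSystem_contract h).vstab,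
      Unsep T (k₂ • q) (k • q) ∧ k₂ • E ≠ k • E ∧
      (sepSet T (k₂ • p₀) (g • p₀)).ncard < (sepSet T p₀ (g • p₀)).ncard := by
  obtain ⟨k, hk, he, ha⟩ := hT.exists_first_step h hno (Unsep.symm hg) fun hc => hgH hc.symm
  have hk' := hT.vstab_le_contract h hk
  obtain ⟨k₂, hk₂, hu, he₂, ha₂⟩ := hT.exists_second_step h hno hk'
    ((hT.unsep_contract h k).symm.trans (Unsep.trans hk' (Unsep.symm hg)))
    (hT.not_unsep_smul h hno _ _)
  refine ⟨k, hk, k₂, hk₂, hu, fun hc => ?_,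
    (hT.ncard_sepSet_lt he₂ ha₂).trans (hT.ncard_sepSet_lt he ha)⟩
  rw [Set.smul_set_compl, hc] at ha₂
  exact ha₂ ha

theorem vstab_contract_eq (hσ : ∀ σ ∉ F, Unsep T (σ • q) q → σ • E = E) :
    (hT.treeSystem_contract h).vstab = hT.vstab := by
  refine le_antisymm (fun g hg => ?_) (hT.vstab_le_contract h)
  by_contra hgH
  obtain ⟨k, -, k₂, -, hu, hne, -⟩ := hT.exists_two_steps h hno hg hgH
  have hu' : Unsep T ((k⁻¹ * k₂) • q) q := by
    rw [mul_smul, hT.unsep_inv_smul_iff]; exact hu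
  have : (k⁻¹ * k₂) • E = E := by
    by_cases hF : k⁻¹ * k₂ ∈ F
    · rw [hT.eq_one_of_unsep h hno hF hu', one_smul]
    · exact hσ _ hF hu'
  rw [mul_smul, inv_smul_eq_iff] at this
  exact hne this

section Involution

variable (hF : ∀ g h, g ∉ F → h ∉ F → g * h ∈ F) {σ : G} (hσF : σ ∉ F) (hσ2 : σ * σ = 1)
  (hσq : Unsep T (σ • q) q)

include hF hσF hσ2 hσq

theorem eq_of_unsep {g : G} (hg : g ∉ F) (hgq : Unsep T (g • q) q) : g = σ := by
  have := hT.eq_one_of_unsep h hno (hF _ _ hg hσF) (by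
    rw [mul_smul]; exact (hT.unsep_smul hσq g).trans hgq)
  rw [← inv_eq_of_mul_eq_one_left hσ2]
  exact eq_inv_of_mul_eq_one_left this

omit hno hF hσF hσ2 in
theorem mem_vstab_contract_of_unsep : σ ∈ (hT.treeSystem_contract h).vstab := by
  have h1 := hT.unsep_contract h 1
  rw [one_smul, one_smul] at h1
  exact (hT.unsep_contract h σ).trans ((hσq.mono contract_subset).trans h1.symm)

theorem vstab_contract_le_of_unsep :
    (hT.treeSystem_contract h).vstab ≤ Subgroup.closure ((hT.vstab : Set G) ∪ {σ}) := by
  intro g hg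
  induction hn : (sepSet T p₀ (g • p₀)).ncard using Nat.strong_induction_on generalizing g with
  | _ n ih =>
  by_cases hu : g ∈ hT.vstab
  · exact Subgroup.subset_closure (Or.inl hu)
  obtain ⟨k, hk, k₂, hk₂, hkk, hne, hlt⟩ := hT.exists_two_steps h hno hg hu
  have hu' : Unsep T ((k⁻¹ * k₂) • q) q := by
    rw [mul_smul, hT.unsep_inv_smul_iff]; exact hkk
  have hk₂F : k⁻¹ * k₂ ∉ F := by
    intro hF'
    have := hT.eq_one_of_unsep h hno hF' hu'
    rw [inv_mul_eq_one] at this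
    exact hne (by rw [this])
  have hk₂' : k₂ = k * σ := by
    rw [← hT.eq_of_unsep h hno hF hσF hσ2 hσq hk₂F hu']; group
  have h1 := ih (sepSet T p₀ ((k₂⁻¹ * g) • p₀)).ncard (by
    rw [← hT.ncard_sepSet_smul k₂, ← mul_smul, mul_inv_cancel_left, ← hn]; exact hlt)
    (Subgroup.mul_mem _ (Subgroup.inv_mem _ hk₂) hg) rfl
  have : g = k * σ * (k₂⁻¹ * g) := by rw [← hk₂']; group
  rw [this]
  exact Subgroup.mul_mem _ (Subgroup.mul_mem _ (Subgroup.subset_closure (Or.inl hk))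
    (Subgroup.subset_closure (Or.inr rfl))) h1

theorem exists_conj_of_unsep {ρ : G} (hρ : ρ ∈ (hT.treeSystem_contract h).vstab) (hρF : ρ ∉ F)
    (hnorm : ∀ g k, g ∉ F → k⁻¹ * g * k ∉ F)
    (hρ2 : ρ * ρ = 1) : ∃ k ∈ (hT.treeSystem_contract h).vstab,
      k⁻¹ * ρ * k ∈ hT.vstab ∨ k⁻¹ * ρ * k = σ := by
  induction hn : (sepSet T p₀ (ρ • p₀)).ncard using Nat.strong_induction_on generalizing ρ with
  | _ n ih =>
  by_cases hu : Unsep T p₀ (ρ • p₀)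
  · exact ⟨1, Subgroup.one_mem _, Or.inl (by simpa [mem_vstab] using hu.symm)⟩
  obtain ⟨k, hk, he, ha⟩ := hT.exists_first_step h hno (Unsep.symm hρ) hu
  have hk' := hT.vstab_le_contract h hk
  have hlt := hT.ncard_sepSet_involution_lt hρ2 he ha (by
    intro hc
    have h1 := hT.isEdge_smul he ρ
    rw [hc] at h1
    have h2 := hT.unsep_left_of_isEdge (hT.isEdge_compl he) h1
    exact hT.not_unsep_smul h hno _ _ h2)
  by_cases hfix : Unsep T (k • q) (ρ • k • q)
  · refine ⟨k, hk', Or.inr (hT.eq_of_unsep h hno hF hσF hσ2 hσq (hnorm _ _ hρF) ?_)⟩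
    rw [mul_smul, mul_smul, hT.unsep_inv_smul_iff]
    exact hfix.symm
  have hT' := hT.treeSystem_contract h
  have hkq := hT.unsep_contract h k
  obtain ⟨k₂, hk₂, -, he₂, ha₂⟩ := hT.exists_second_step h hno hk'
    (hkq.symm.trans (Unsep.trans hk' ((Unsep.symm hρ).trans
      (hT'.unsep_smul ((Unsep.symm hk').trans hkq) ρ)))) hfix
  have hlt₂ := hT.ncard_sepSet_involution_lt hρ2 he₂ ha₂ (by
    intro hc
    have h1 := hT.isEdge_smul he₂ ρ
    rw [hc] at h1
    have h2 := hT.unsep_left_of_isEdge (hT.isEdge_compl he₂) h1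
    rw [← mul_smul] at h2
    exact hT.not_unsep_smul h hno _ _ h2.symm)
  obtain ⟨l, hl, hl'⟩ := ih (sepSet T p₀ ((k₂⁻¹ * ρ * k₂) • p₀)).ncard (by
      rw [← hT.ncard_sepSet_smul k₂, ← mul_smul, ← hn, mul_assoc, mul_inv_cancel_left, mul_smul]
      exact hlt₂.trans hlt) (Subgroup.mul_mem _ (Subgroup.mul_mem _ (Subgroup.inv_mem _ hk₂) hρ) hk₂)
      (hnorm _ _ hρF) (by
        have : k₂⁻¹ * ρ * k₂ * (k₂⁻¹ * ρ * k₂) = k₂⁻¹ * (ρ * ρ) * k₂ := by group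
        rw [this, hρ2]; group) rfl
  refine ⟨k₂ * l, Subgroup.mul_mem _ hk₂ hl, ?_⟩
  have : (k₂ * l)⁻¹ * ρ * (k₂ * l) = l⁻¹ * (k₂⁻¹ * ρ * k₂) * l := by group
  rw [this]
  exact hl'

end Involution

end NonOrbit

end TreeSystem

namespace TreeSystem

variable {G P : Type*} [Group G] [MulAction G P] {F : Subgroup G} {p₀ : P} {T : Set (Set P)}
  (hT : TreeSystem F p₀ T) {E E' : Set P} {q a : P} (h : IsEdge T E p₀ q)
  (hF : ∀ g h, g ∉ F → h ∉ F → g * h ∈ F) (htf : ∀ g ∈ F, g * g = 1 → g = 1)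
  {τ : G} (hτF : τ ∉ F) (hτ : τ * τ = 1) {S : Set G} (hS : IsAdapted F τ S hT.vstab)

omit [MulAction G P] in
theorem _root_.conj_notMem_of_index_two {F : Subgroup G} (hF : ∀ g h, g ∉ F → h ∉ F → g * h ∈ F)
    {g : G} (k : G) (hg : g ∉ F) : k⁻¹ * g * k ∉ F := by
  intro hc
  by_cases hkF : k ∈ F
  · exact hg ((F.mul_mem_cancel_left (F.inv_mem hkF)).1 ((F.mul_mem_cancel_right hkF).1 hc))
  · have h1 : g * k ∈ F := hF _ _ hg hkF
    rw [mul_assoc] at hc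
    exact hkF (by simpa using F.inv_mem ((F.mul_mem_cancel_right h1).1 hc))

include hT h hF hτF hτ hS

theorem isAdapted_contract_of_involution {σ : G} (hσF : σ ∉ F) (hσ2 : σ * σ = 1)
    (hσE : σ • Eᶜ ⊆ E) (hkE : ∀ k ∉ F, k • E ≠ E) (hσH : σ ∈ (hT.treeSystem_contract h).vstab)
    (hgen : (hT.treeSystem_contract h).vstab ≤ Subgroup.closure ((hT.vstab : Set G) ∪ {σ}))
    (hconj : ∀ ρ ∈ (hT.treeSystem_contract h).vstab, ρ ∉ F → ρ * ρ = 1 →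
      ∃ k ∈ (hT.treeSystem_contract h).vstab, k⁻¹ * ρ * k ∈ hT.vstab ∨ k⁻¹ * ρ * k = σ) :
    ∃ S', S ⊆ S' ∧ IsAdapted F τ S' (hT.treeSystem_contract h).vstab := by
  have hτ' : τ⁻¹ = τ := inv_eq_of_mul_eq_one_left hτ
  have hσ' : σ⁻¹ = σ := inv_eq_of_mul_eq_one_left hσ2
  have hle := hT.vstab_le_contract h
  refine ⟨S ∪ Set.range (fun _ : Unit => τ * σ), Set.subset_union_left,
    hS.extend hF hτF hτ hle ?_ ?_ ?_ ?_ ?_⟩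
  · rintro _ ⟨-, rfl⟩
    exact ⟨Subgroup.mul_mem _ (hle hS.mem) hσH, hF _ _ hτF hσF⟩
  · refine hT.freeOn_union_range hS.free hS.closure_eq _
      (fun _ c => if c then τ • E else E) ?_ ?_ ?_
    · rintro - (_ | _)
      · exact ⟨q, h⟩
      · exact ⟨τ • q, (hT.isEdge_smul h τ).of_unsep_left hS.mem⟩
    · rintro -
      simp only [Bool.false_eq_true, if_false, if_true, mul_smul]
      exact Set.smul_set_mono hσE
    · rintro k ⟨-, hk⟩ - c - d heq
      refine ⟨rfl, ?_⟩
      cases c <;> cases d <;> simp only [Bool.false_eq_true, if_false, if_true] at heq ⊢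
      · refine hkE (τ⁻¹ * k) (fun hc => hτF ?_) (by rw [mul_smul, heq, inv_smul_smul])
        exact F.inv_mem_iff.1 ((F.mul_mem_cancel_right hk).1 hc)
      · exfalso
        exact hkE (k * τ) (fun hc => hτF ((F.mul_mem_cancel_left hk).1 hc))
          (by rw [mul_smul, heq])
  · rintro _ ⟨-, rfl⟩
    left
    rw [mul_inv_rev, hσ', hτ', ← mul_assoc τ τ, hτ, one_mul]
  · refine hgen.trans ?_
    rw [Subgroup.closure_le]
    rintro x (hx | rfl)
    · exact Subgroup.subset_closure (Or.inl hx)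
    · have : x = τ * (τ * x) := by rw [← mul_assoc, hτ, one_mul]
      refine Set.mem_of_eq_of_mem this ?_
      exact Subgroup.mul_mem _ (Subgroup.subset_closure (Or.inl hS.mem))
        (Subgroup.subset_closure (Or.inr ⟨(), rfl⟩))
  · intro ρ hρ hρF hρ2
    obtain ⟨k, hk, hk'⟩ := hconj ρ hρ hρF hρ2
    exact ⟨k, hk, hk'.imp id fun e => ⟨(), by rw [e]⟩⟩

include htf

theorem isAdapted_contract_of_fixed {σ s : G} (hσF : σ ∉ F) (hσE : σ • E = E) (hsF : s ∈ F)
    (hs : Unsep T q (s • p₀)) :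
    ∃ S', S ⊆ S' ∧ IsAdapted F τ S' (hT.treeSystem_contract h).vstab := by
  have hle := hT.vstab_le_contract h
  have hσ2 : σ * σ = 1 := hT.stab _ (hF _ _ hσF hσF) E h.mem (by rw [mul_smul, hσE, hσE])
  have hσh := hT.isEdge_smul h σ
  rw [hσE] at hσh
  have hσH : σ ∈ hT.vstab := hT.unsep_left_of_isEdge hσh h
  have hσq : Unsep T (σ • q) q := hT.unsep_right_of_isEdge hσh h
  have hσH' : s⁻¹ * σ * s ∈ hT.vstab := by
    change Unsep T _ _
    rw [mul_smul, mul_smul, hT.unsep_inv_smul_iff]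
    exact (hT.unsep_smul hs.symm σ).trans (hσq.trans hs)
  obtain ⟨a, ha, x, hx, hxτ, hσx⟩ := hS.conj σ hσH hσF hσ2
  obtain ⟨b, hb, y, hy, hyτ, hσy⟩ := hS.conj _ hσH' (conj_notMem_of_index_two hF s hσF) (by
    have : s⁻¹ * σ * s * (s⁻¹ * σ * s) = s⁻¹ * (σ * σ) * s := by group
    rw [this, hσ2]; group)
  have hsc := hT.mem_vstab_contract h hs
  have hnF : a⁻¹ * s * b ∈ F := F.mul_mem (F.mul_mem (F.inv_mem ha.2) hsF) hb.2
  have hne : ∀ g ∈ F, g • E ≠ Eᶜ := fun g hg => hT.smul_ne_compl htf h hg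
  refine ⟨S ∪ Set.range (fun _ : Unit => a⁻¹ * s * b), Set.subset_union_left,
    hS.extend hF hτF hτ hle ?_ ?_ ?_ ?_ ?_⟩
  · rintro _ ⟨-, rfl⟩
    exact ⟨Subgroup.mul_mem _ (Subgroup.mul_mem _ (Subgroup.inv_mem _ (hle ha.1)) hsc)
      (hle hb.1), hnF⟩
  · refine hT.freeOn_union_range hS.free hS.closure_eq _
      (fun _ c => if c then a⁻¹ • E else (a⁻¹ * s * b)⁻¹ • a⁻¹ • Eᶜ) ?_ ?_ ?_
    · rintro - (_ | _)
      · refine ⟨_, (hT.isEdge_smul (hT.isEdge_smul (hT.isEdge_compl h) a⁻¹)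
          (a⁻¹ * s * b)⁻¹).of_unsep_left ?_⟩
        rw [hT.unsep_inv_smul_iff, mul_smul, mul_smul, hT.unsep_smul_iff]
        exact hs.trans (hT.unsep_smul (Unsep.symm hb.1) s)
      · exact ⟨_, (hT.isEdge_smul h a⁻¹).of_unsep_left (hT.vstab.inv_mem ha.1)⟩
    · rintro -
      simp only [Bool.false_eq_true, if_false, if_true]
      rw [← Set.smul_set_compl, ← Set.smul_set_compl, compl_compl, smul_inv_smul]
    · rintro k ⟨-, hk⟩ - c - d heq
      refine ⟨rfl, ?_⟩
      cases c <;> cases d <;> simp only [Bool.false_eq_true, if_false, if_true] at heq ⊢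
      · refine hne (a * k * (a⁻¹ * s * b)⁻¹ * a⁻¹) (F.mul_mem (F.mul_mem (F.mul_mem ha.2 hk)
          (F.inv_mem hnF)) (F.inv_mem ha.2)) ?_
        rw [← compl_inj_iff, ← Set.smul_set_compl, compl_compl, mul_smul, mul_smul, mul_smul, heq,
          smul_inv_smul]
      · exfalso
        refine hne (a * (a⁻¹ * s * b) * k * a⁻¹) (F.mul_mem (F.mul_mem (F.mul_mem ha.2 hnF) hk)
          (F.inv_mem ha.2)) ?_
        rw [mul_smul, mul_smul, mul_smul, heq, smul_inv_smul, smul_inv_smul]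
  · rintro _ ⟨-, rfl⟩
    refine Or.inr (Or.inl ⟨y, Set.insert_subset_insert Set.subset_union_left hy, x,
      Set.insert_subset_insert Set.subset_union_left hx, hyτ, hxτ, ?_⟩)
    rw [eq_mul_inv_iff_mul_eq]
    have h1 : τ * y = b⁻¹ * (s⁻¹ * σ * s) * b := by rw [hσy]; group
    have h2 : τ * x = a⁻¹ * σ * a := by rw [hσx]; group
    have h3 : x = τ * (a⁻¹ * σ * a) := by rw [← h2, ← mul_assoc, hτ, one_mul]
    rw [mul_assoc _ τ, h1, h3]
    group
  · refine (hT.vstab_contract_le h hs).trans ?_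
    rw [Subgroup.closure_le]
    rintro x (hx | rfl)
    · exact Subgroup.subset_closure (Or.inl hx)
    · have : x = a * (a⁻¹ * x * b) * b⁻¹ := by group
      refine Set.mem_of_eq_of_mem this ?_
      exact Subgroup.mul_mem _ (Subgroup.mul_mem _ (Subgroup.subset_closure (Or.inl ha.1))
        (Subgroup.subset_closure (Or.inr ⟨(), rfl⟩)))
        (Subgroup.subset_closure (Or.inl (hT.vstab.inv_mem hb.1)))
  · intro ρ hρ hρF hρ2
    obtain ⟨k, hk, hk'⟩ := hT.exists_conj_of_orbit h hs hρ hρ2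
    refine ⟨k, hk, Or.inl (hk'.resolve_right fun hc => ?_)⟩
    exact hne _ (hF _ _ hσF (conj_notMem_of_index_two hF k hρF))
      (by rw [mul_smul, hc, Set.smul_set_compl, hσE])

theorem isAdapted_contract_of_free {s : G} (hE : ∀ σ ∉ F, σ • E ≠ E ∧ σ • E ≠ Eᶜ) (hsF : s ∈ F)
    (hs : Unsep T q (s • p₀)) :
    ∃ S', S ⊆ S' ∧ IsAdapted F τ S' (hT.treeSystem_contract h).vstab := by
  have hτ' : τ⁻¹ = τ := inv_eq_of_mul_eq_one_left hτ
  have hle := hT.vstab_le_contract h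
  have hsc := hT.mem_vstab_contract h hs
  have hne : ∀ g : G, g • E ≠ Eᶜ := fun g hg => by
    by_cases hgF : g ∈ F
    · exact hT.smul_ne_compl htf h hgF hg
    · exact (hE g hgF).2 hg
  have hfix : ∀ g : G, g • E = E → g ∈ F := fun g hg => by
    by_contra hgF
    exact (hE g hgF).1 hg
  have hsτ : τ * s * τ ∈ F := by
    have := hF _ _ (fun hc => hτF ((F.mul_mem_cancel_right hsF).1 hc)) hτF
    exact this
  let u : Bool → G := fun i => if i then τ else 1
  refine ⟨S ∪ Set.range (fun i => u i * s * u i), Set.subset_union_left,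
    hS.extend hF hτF hτ hle ?_ ?_ ?_ ?_ ?_⟩
  · rintro _ ⟨_ | _, rfl⟩
    · simpa [u] using ⟨hsc, hsF⟩
    · exact ⟨Subgroup.mul_mem _ (Subgroup.mul_mem _ (hle hS.mem) hsc) (hle hS.mem), hsτ⟩
  · have huu : ∀ i, u i * u i = 1 := by rintro (_ | _) <;> simp [u, hτ]
    have huH : ∀ i, u i ∈ hT.vstab := by
      rintro (_ | _)
      · exact hT.vstab.one_mem
      · exact hS.mem
    have hu : ∀ i j, ∀ k ∈ F, (u j)⁻¹ * k * u i ∈ F → i = j := by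
      rintro (_ | _) (_ | _) k hk hc <;> simp only [u, if_true, Bool.false_eq_true, if_false] at hc ⊢
      · rw [mul_one] at hc
        exact hτF (F.inv_mem_iff.1 ((F.mul_mem_cancel_right hk).1 hc))
      · rw [inv_one, one_mul] at hc
        exact absurd ((F.mul_mem_cancel_left hk).1 hc) hτF
    refine hT.freeOn_union_range hS.free hS.closure_eq _
      (fun i c => u i • if c then E else s⁻¹ • Eᶜ) ?_ ?_ ?_
    · rintro i (_ | _)
      · refine ⟨_, (hT.isEdge_smul (hT.isEdge_smul (hT.isEdge_compl h) s⁻¹) (u i)).of_unsep_left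
          ((hT.unsep_smul ?_ _).trans (huH i))⟩
        rw [hT.unsep_inv_smul_iff]
        exact hs
      · exact ⟨_, (hT.isEdge_smul h (u i)).of_unsep_left (huH i)⟩
    · intro i
      simp only [Bool.false_eq_true, if_false, if_true]
      rw [← Set.smul_set_compl, ← Set.smul_set_compl, compl_compl, mul_smul, mul_smul,
        ← mul_smul (u i) (u i), huu, one_smul, smul_inv_smul]
    · rintro k ⟨-, hk⟩ i c j d heq
      cases c <;> cases d <;> simp only [Bool.false_eq_true, if_false, if_true] at heq
      · refine ⟨hu i j k hk ?_, rfl⟩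
        have h1 : (s * ((u j)⁻¹ * k * u i) * s⁻¹) • E = E := by
          rw [← compl_inj_iff, ← Set.smul_set_compl, mul_smul, mul_smul, mul_smul, mul_smul, heq,
            inv_smul_smul, smul_inv_smul]
        have := hfix _ h1
        rw [F.mul_mem_cancel_right (F.inv_mem hsF), F.mul_mem_cancel_left hsF] at this
        exact this
      · exfalso
        refine hne ((u j)⁻¹ * k * u i * s⁻¹) ?_
        rw [← compl_inj_iff, ← Set.smul_set_compl, compl_compl, mul_smul, mul_smul, mul_smul, heq,
          inv_smul_smul]
      · exfalso
        refine hne (s * ((u j)⁻¹ * k * u i)) ?_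
        rw [mul_smul, mul_smul, mul_smul, heq, inv_smul_smul, smul_inv_smul]
      · refine ⟨hu i j k hk (hfix _ ?_), rfl⟩
        rw [mul_smul, mul_smul, heq, inv_smul_smul]
  · rintro _ ⟨i, rfl⟩
    refine Or.inr (Or.inr (Or.inr ⟨!i, ?_⟩))
    cases i
    · simp [u]
    · simp only [u, Bool.not_true, Bool.false_eq_true, if_false, if_true]
      have : τ * (τ * s * τ) * τ = (τ * τ) * s * (τ * τ) := by group
      rw [this, hτ]
  · refine (hT.vstab_contract_le h hs).trans ?_
    rw [Subgroup.closure_le]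
    rintro x (hx | rfl)
    · exact Subgroup.subset_closure (Or.inl hx)
    · exact Subgroup.subset_closure (Or.inr ⟨false, by simp [u]⟩)
  · intro ρ hρ hρF hρ2
    obtain ⟨k, hk, hk'⟩ := hT.exists_conj_of_orbit h hs hρ hρ2
    exact ⟨k, hk, Or.inl (hk'.resolve_right (hne _))⟩

theorem exists_isAdapted_contract :
    ∃ S', S ⊆ S' ∧ IsAdapted F τ S' (hT.treeSystem_contract h).vstab := by
  by_cases ho : ∃ g : G, Unsep T q (g • p₀)
  · by_cases h1 : ∃ σ ∉ F, σ • E = Eᶜ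
    · obtain ⟨σ, hσF, hσE⟩ := h1
      have hσ2 : σ * σ = 1 := hT.stab _ (hF _ _ hσF hσF) E h.mem (by
        rw [mul_smul, hσE, Set.smul_set_compl, hσE, compl_compl])
      have hσh := hT.isEdge_smul h σ
      rw [hσE] at hσh
      have hs : Unsep T q (σ • p₀) := hT.unsep_left_of_isEdge (hT.isEdge_compl h) hσh
      refine hT.isAdapted_contract_of_involution h hF hτF hτ hS hσF hσ2 ?_ ?_
        (hT.mem_vstab_contract h hs) (hT.vstab_contract_le h hs) ?_
      · rw [Set.smul_set_compl, hσE, compl_compl]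
      · intro k hk hkE
        exact hT.smul_ne_compl htf h (hF _ _ hσF hk) (by rw [mul_smul, hkE, hσE])
      · intro ρ hρ hρF hρ2
        obtain ⟨k, hk, hk'⟩ := hT.exists_conj_of_orbit h hs hρ hρ2
        refine ⟨k, hk, hk'.imp id fun hc => ?_⟩
        have := hT.stab _ (hF _ _ hσF (conj_notMem_of_index_two hF k hρF)) E h.mem (by
          rw [mul_smul, hc, Set.smul_set_compl, hσE, compl_compl])
        rw [← inv_eq_of_mul_eq_one_left hσ2]
        exact eq_inv_of_mul_eq_one_right this
    · obtain ⟨s, hsF, hs⟩ : ∃ s ∈ F, Unsep T q (s • p₀) := by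
        obtain ⟨g, hg⟩ := ho
        by_cases hgF : g ∈ F
        · exact ⟨g, hgF, hg⟩
        · refine ⟨g * τ, hF _ _ hgF hτF, hg.trans ?_⟩
          rw [mul_smul]
          exact hT.unsep_smul (Unsep.symm hS.mem) g
      by_cases h2 : ∃ σ ∉ F, σ • E = E
      · obtain ⟨σ, hσF, hσE⟩ := h2
        exact hT.isAdapted_contract_of_fixed h hF htf hτF hτ hS hσF hσE hsF hs
      · push Not at h1 h2
        exact hT.isAdapted_contract_of_free h hF htf hτF hτ hS
          (fun σ hσ => ⟨h2 σ hσ, h1 σ hσ⟩) hsF hs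
  · push Not at ho
    by_cases h1 : ∀ σ ∉ F, Unsep T (σ • q) q → σ • E = E
    · exact ⟨S, subset_rfl, by rw [hT.vstab_contract_eq h ho h1]; exact hS⟩
    · push Not at h1
      obtain ⟨σ, hσF, hσq, hσE⟩ := h1
      have hσ2 : σ * σ = 1 := hT.eq_one_of_unsep h ho (hF _ _ hσF hσF) (by
        rw [mul_smul]; exact (hT.unsep_smul hσq σ).trans hσq)
      refine hT.isAdapted_contract_of_involution h hF hτF hτ hS hσF hσ2 ?_ ?_
        (hT.mem_vstab_contract_of_unsep h hσq)
        (hT.vstab_contract_le_of_unsep h ho hF hσF hσ2 hσq) ?_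
      · have hc := hT.isEdge_compl h
        have := hT.disjoint_of_isEdge hc ((hT.isEdge_smul hc σ).of_unsep_left hσq) (fun e => by
          rw [Set.smul_set_compl, compl_inj_iff] at e; exact hσE e.symm)
        rw [← Set.subset_compl_iff_disjoint_left, compl_compl] at this
        exact this
      · intro k hk hkE
        have hkh := hT.isEdge_smul h k
        rw [hkE] at hkh
        have := hT.eq_of_unsep h ho hF hσF hσ2 hσq hk (hT.unsep_right_of_isEdge hkh h)
        rw [this] at hkE
        exact hσE hkE
      · intro ρ hρ hρF hρ2
        exact hT.exists_conj_of_unsep h ho hF hσF hσ2 hσq hρ hρF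
          (fun g k hg => conj_notMem_of_index_two hF k hg) hρ2

omit h in
/-- An adapted basis of a vertex group of a cocompact tree extends to the whole group. -/
theorem exists_isAdapted_top {R : Set (Set P)} (hR : R.Finite)
    (hRT : ∀ A ∈ T, ∃ g : G, g • A ∈ R) : ∃ S', S ⊆ S' ∧ IsAdapted F τ S' ⊤ := by
  induction hn : R.ncard using Nat.strong_induction_on generalizing R T S with
  | _ n ih =>
  by_cases htop : ∀ g, g ∈ hT.vstab
  · exact ⟨S, subset_rfl, by rw [← (Subgroup.eq_top_iff' _).2 htop]; exact hS⟩
  push Not at htop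
  obtain ⟨g, hg⟩ := htop
  obtain ⟨E, q, h, -⟩ := hT.exists_isEdge (p := p₀) (a := g • p₀) fun hc => hg hc.symm
  obtain ⟨S₁, hS₁, had⟩ := hT.exists_isAdapted_contract h hF htf hτF hτ hS
  obtain ⟨k, hk⟩ := hRT E h.mem
  obtain ⟨S₂, hS₂, had₂⟩ := ih (R \ {k • E}).ncard
    (by rw [← hn]; exact Set.ncard_sdiff_singleton_lt_of_mem hk hR) (hT.treeSystem_contract h) had
    (hR.subset Set.sdiff_subset) (fun A hA => by
      obtain ⟨l, hl⟩ := hRT A hA.1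
      refine ⟨l, hl, fun hc => (hA.2 (l⁻¹ * k)).1 ?_⟩
      rw [Set.mem_singleton_iff] at hc
      rw [mul_smul, ← hc, inv_smul_smul]) rfl
  exact ⟨S₂, hS₁.trans hS₂, had₂⟩

end TreeSystem

namespace FreeGroup

section Words

variable {C : Type*} [DecidableEq C]

theorem mem_startsWith_of_isReduced {c : C × Bool} {t : List (C × Bool)}
    (h : IsReduced (c :: t)) : mk (c :: t) ∈ startsWith c := by
  simp [startsWith, h.reduce_eq]

omit [DecidableEq C] in
theorem mk_singleton_inv (d : C × Bool) : (mk [d])⁻¹ = mk [(d.1, !d.2)] := by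
  simp [inv_mk, invRev]

theorem mk_mul_notMem_startsWith {c : C × Bool} {g : FreeGroup C}
    (h : g ∈ startsWith (c.1, !c.2)) : mk [c] * g ∉ startsWith c := by
  obtain ⟨t, ht⟩ : ∃ t, g.toWord = (c.1, !c.2) :: t := by
    simp only [startsWith, Set.mem_ofPred_eq] at h
    cases hg : g.toWord with
    | nil => simp [hg] at h
    | cons a t => exact ⟨t, by simpa [hg] using h⟩
  have hr : IsReduced ((c.1, !c.2) :: t) := ht ▸ isReduced_toWord
  have hg : mk [c] * g = mk t := by
    rw [← mk_toWord (x := g), ht, show (c.1, !c.2) :: t = [(c.1, !c.2)] ++ t from rfl, ← mul_mk,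
      ← mul_assoc, ← mk_singleton_inv, mul_inv_cancel, one_mul]
  rw [hg]
  intro hc
  cases t with
  | nil => simp [startsWith] at hc
  | cons b t =>
    have h2 := (isReduced_cons_cons.mp hr).1
    have h3 : reduce (b :: t) = b :: t := (isReduced_cons_cons.mp hr).2.reduce_eq
    simp only [startsWith, Set.mem_ofPred_eq, toWord_mk, h3] at hc
    grind

theorem mk_mul_mem_startsWith_iff {c : C × Bool} {g : FreeGroup C} :
    mk [c] * g ∈ startsWith c ↔ g ∉ startsWith (c.1, !c.2) :=
  ⟨fun h h' => mk_mul_notMem_startsWith h' h, startsWith_mk_mul g⟩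

theorem eq_of_mem_startsWith {c d : C × Bool} {g : FreeGroup C} (hc : g ∈ startsWith c)
    (hd : g ∈ startsWith d) : c = d := by
  by_contra h
  exact (startsWith.disjoint_iff_ne.mpr h).notMem_of_mem_left hc hd

theorem one_notMem_startsWith {c : C × Bool} : (1 : FreeGroup C) ∉ startsWith c :=
  fun h => startsWith.ne_one _ h rfl

/-- Induction on the reduced word of an element, adding one letter on the left at a time. -/
theorem induction_on_toWord {p : FreeGroup C → Prop} (one : p 1)
    (cons : ∀ d u, u ∉ startsWith (d.1, !d.2) → (mk [d] * u).toWord = d :: u.toWord → p u →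
      p (mk [d] * u)) (w : FreeGroup C) : p w := by
  suffices h : ∀ l : List (C × Bool), IsReduced l → p (mk l) by
    rw [← mk_toWord (x := w)]
    exact h _ isReduced_toWord
  intro l
  induction l with
  | nil => exact fun _ => one
  | cons d t ih =>
    intro h
    have ht : IsReduced t := List.IsChain.tail h
    have hm : mk (d :: t) = mk [d] * mk t := by rw [mul_mk]; rfl
    rw [hm]
    refine cons d _ ?_ ?_ (ih ht)
    · rw [← mk_mul_mem_startsWith_iff, ← hm]
      exact mem_startsWith_of_isReduced h
    · rw [← hm, toWord_mk, toWord_mk, h.reduce_eq, ht.reduce_eq]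

theorem exists_mem_startsWith {g : FreeGroup C} (hg : g ≠ 1) : ∃ c, g ∈ startsWith c := by
  induction g using induction_on_toWord with
  | one => exact absurd rfl hg
  | cons d u hd _ _ => exact ⟨d, startsWith_mk_mul u hd⟩

theorem mem_closure_of_image_iff {C₁ : Set C} {g : FreeGroup C} :
    g ∈ Subgroup.closure (of '' C₁) ↔ ∀ p ∈ g.toWord, p.1 ∈ C₁ := by
  constructor
  · intro hg
    induction hg using Subgroup.closure_induction with
    | mem x hx =>
      obtain ⟨c, hc, rfl⟩ := hx
      simpa using hc
    | one => simp
    | mul x y _ _ hx hy =>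
      intro p hp
      rcases List.mem_append.mp ((toWord_mul_sublist x y).subset hp) with h | h
      exacts [hx p h, hy p h]
    | inv x _ hx =>
      intro p hp
      rw [toWord_inv, invRev, List.mem_reverse, List.mem_map] at hp
      obtain ⟨q, hq, rfl⟩ := hp
      exact hx q hq
  · induction g using induction_on_toWord with
    | one => exact fun _ => one_mem _
    | cons d u _ hw ih =>
      intro h
      rw [hw] at h
      refine mul_mem ?_ (ih fun p hp => h p (List.mem_cons_of_mem _ hp))
      have hd : of d.1 ∈ Subgroup.closure (of '' C₁) :=
        Subgroup.subset_closure ⟨d.1, h d (by simp), rfl⟩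
      obtain ⟨x, b⟩ := d
      cases b
      · simpa [of, inv_mk, invRev] using inv_mem hd
      · exact hd

theorem mem_of_mem_startsWith {C₁ : Set C} {c : C × Bool} {g : FreeGroup C}
    (hg : g ∈ Subgroup.closure (of '' C₁)) (hc : g ∈ startsWith c) : c.1 ∈ C₁ :=
  mem_closure_of_image_iff.mp hg c (List.mem_of_getElem? hc)

theorem mk_singleton_mem_closure {C₁ : Set C} {d : C × Bool} (hd : d.1 ∈ C₁) :
    mk [d] ∈ Subgroup.closure (of '' C₁) := by
  rw [mem_closure_of_image_iff]
  simpa using hd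

/-- Right multiplication by an element of a standard free factor does not change the first letter
of an element outside that factor. -/
theorem mul_mem_startsWith_iff {C₁ : Set C} {c : C × Bool} {w l : FreeGroup C}
    (hl : l ∈ Subgroup.closure (of '' C₁)) (hw : w ∉ Subgroup.closure (of '' C₁) ∨ c.1 ∉ C₁) :
    w * l ∈ startsWith c ↔ w ∈ startsWith c := by
  by_cases hwL : w ∈ Subgroup.closure (of '' C₁)
  · have hc := hw.resolve_left (not_not.mpr hwL)
    exact ⟨fun h => absurd (mem_of_mem_startsWith (mul_mem hwL hl) h) hc,
      fun h => absurd (mem_of_mem_startsWith hwL h) hc⟩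
  clear hw
  induction w using induction_on_toWord generalizing c with
  | one => exact absurd (one_mem _) hwL
  | cons d u hd _ ih =>
    suffices h : mk [d] * u * l ∈ startsWith d by
      have h' : mk [d] * u ∈ startsWith d := startsWith_mk_mul u hd
      exact ⟨fun hc => eq_of_mem_startsWith h hc ▸ h', fun hc => eq_of_mem_startsWith h' hc ▸ h⟩
    rw [mul_assoc]
    refine startsWith_mk_mul _ fun hul => ?_
    by_cases hu : u ∈ Subgroup.closure (of '' C₁)
    · have hd1 : d.1 ∈ C₁ :=
        mem_of_mem_startsWith (c := (d.1, !d.2)) (mul_mem hu hl) hul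
      exact hwL (mul_mem (mk_singleton_mem_closure hd1) hu)
    · exact hd ((ih hu).mp hul)

theorem mul_mem_startsWith_of_mem_closure {C₁ : Set C} {d e : C × Bool} {l u : FreeGroup C}
    (hl : l ∈ Subgroup.closure (of '' C₁)) (hd : d.1 ∉ C₁) (hu : u ∈ startsWith d)
    (he : l ∈ startsWith e) : l * u ∈ startsWith e := by
  induction l using induction_on_toWord generalizing e with
  | one => exact absurd he one_notMem_startsWith
  | cons a v ha hw ih =>
    obtain rfl := eq_of_mem_startsWith (startsWith_mk_mul v ha) he
    have haC : a.1 ∈ C₁ := mem_of_mem_startsWith hl he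
    have hv : v ∈ Subgroup.closure (of '' C₁) := by
      rw [mem_closure_of_image_iff] at hl ⊢
      rw [hw] at hl
      exact fun p hp => hl p (List.mem_cons_of_mem _ hp)
    rw [mul_assoc]
    refine startsWith_mk_mul _ fun h => ?_
    rcases eq_or_ne v 1 with rfl | hv1
    · rw [one_mul] at h
      exact hd (eq_of_mem_startsWith hu h ▸ haC)
    · obtain ⟨e, he⟩ := exists_mem_startsWith hv1
      exact ha (eq_of_mem_startsWith (ih hv he) h ▸ he)

/-- Standard free factors are malnormal. -/
theorem eq_one_of_conj_mem_closure {C₁ : Set C} {l u : FreeGroup C}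
    (hl : l ∈ Subgroup.closure (of '' C₁)) (hlu : u⁻¹ * l * u ∈ Subgroup.closure (of '' C₁))
    (hu : u ∉ Subgroup.closure (of '' C₁)) : l = 1 := by
  induction u using induction_on_toWord generalizing l with
  | one => exact absurd (one_mem _) hu
  | cons d u hd hw ih =>
    by_cases hdC : d.1 ∈ C₁
    · have hdL : mk [d] ∈ Subgroup.closure (of '' C₁) := mk_singleton_mem_closure hdC
      have := ih (l := (mk [d])⁻¹ * l * mk [d]) (mul_mem (mul_mem (inv_mem hdL) hl) hdL)
        (by simpa [mul_assoc] using hlu) fun h => hu (mul_mem hdL h)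
      simpa [mul_eq_one_iff_eq_inv] using this
    · by_contra hl1
      obtain ⟨e, he⟩ := exists_mem_startsWith hl1
      have h1 : mk [d] * u ∈ startsWith d := startsWith_mk_mul u hd
      have h2 := mul_mem_startsWith_of_mem_closure hl hdC h1 he
      have h3 := (mul_mem_startsWith_iff hlu (Or.inl hu) (c := d)).mpr h1
      have h4 : mk [d] * u * ((mk [d] * u)⁻¹ * l * (mk [d] * u)) = l * (mk [d] * u) := by group
      rw [h4] at h3
      exact hdC (eq_of_mem_startsWith h2 h3 ▸ mem_of_mem_startsWith hl he)

theorem exists_inv_mul_mem_startsWith {C₁ : Set C} {u : FreeGroup C}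
    (hu : u ∉ Subgroup.closure (of '' C₁)) :
    ∃ a ∈ Subgroup.closure (of '' C₁), ∃ c : C × Bool, c.1 ∉ C₁ ∧ a⁻¹ * u ∈ startsWith c := by
  induction u using induction_on_toWord with
  | one => exact absurd (one_mem _) hu
  | cons d u hd hw ih =>
    by_cases hdC : d.1 ∈ C₁
    · have hdL : mk [d] ∈ Subgroup.closure (of '' C₁) := mk_singleton_mem_closure hdC
      obtain ⟨a, ha, c, hc, h⟩ := ih fun h => hu (mul_mem hdL h)
      exact ⟨mk [d] * a, mul_mem hdL ha, c, hc, by rwa [mul_inv_rev, mul_assoc, inv_mul_cancel_left]⟩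
    · exact ⟨1, one_mem _, d, hdC, by simpa using startsWith_mk_mul u hd⟩

theorem mul_letter_mem_startsWith_iff (c d : C × Bool) (w : FreeGroup C) :
    (w ∈ startsWith c ↔ w * mk [d] ∈ startsWith c) ∨ (w = 1 ∧ d = c) ∨
      (w = mk [c] ∧ d = (c.1, !c.2)) := by
  induction w using induction_on_toWord generalizing c with
  | one =>
    by_cases h : d = c
    · exact Or.inr (Or.inl ⟨rfl, h⟩)
    · refine Or.inl ⟨fun h' => absurd h' one_notMem_startsWith, fun h' => absurd ?_ h⟩
      simpa [startsWith] using h'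
  | cons e u he hw ih =>
    have h1 : mk [e] * u ∈ startsWith e := startsWith_mk_mul u he
    by_cases hu : u * mk [d] ∈ startsWith (e.1, !e.2)
    · rcases ih (e.1, !e.2) with h | ⟨rfl, rfl⟩ | ⟨rfl, h⟩
      · exact absurd (h.mpr hu) he
      · by_cases hec : e = c
        · exact Or.inr (Or.inr ⟨by simp [hec], by simp [hec]⟩)
        · refine Or.inl ⟨fun h => absurd (eq_of_mem_startsWith h1 h) hec, fun h => ?_⟩
          rw [mul_one, ← mk_singleton_inv, mul_inv_cancel] at h
          exact absurd h one_notMem_startsWith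
      · exact absurd (mem_startsWith_of_isReduced (by simp [IsReduced])) he
    · have h2 : mk [e] * u * mk [d] ∈ startsWith e := mul_assoc (mk [e]) u _ ▸ startsWith_mk_mul _ hu
      exact Or.inl ⟨fun h => eq_of_mem_startsWith h1 h ▸ h2, fun h => eq_of_mem_startsWith h2 h ▸ h1⟩

theorem encard_startsWith_boundary_le (c : C × Bool) (u : FreeGroup C) :
    {w : FreeGroup C | ¬ (w ∈ startsWith c ↔ w * u ∈ startsWith c)}.encard ≤ u.norm := by
  induction u using induction_on_toWord with
  | one => simp
  | cons d u hd hw ih =>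
    have hsub : {w : FreeGroup C | ¬ (w ∈ startsWith c ↔ w * (mk [d] * u) ∈ startsWith c)} ⊆
        (if d = c then {1} else {mk [c]}) ∪ (fun w => w * (mk [d])⁻¹) ''
          {w : FreeGroup C | ¬ (w ∈ startsWith c ↔ w * u ∈ startsWith c)} := by
      intro w h
      by_cases h2 : w * mk [d] ∈ startsWith c ↔ w * mk [d] * u ∈ startsWith c
      · left
        rcases mul_letter_mem_startsWith_iff c d w with h1 | ⟨h1, h3⟩ | ⟨h1, h3⟩
        · exact absurd (h1.trans (by rwa [mul_assoc] at h2)) h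
        · simp [h1, h3]
        · rw [if_neg, h1]
          · rfl
          · rw [h3]; simp [Prod.ext_iff]
      · exact Or.inr ⟨w * mk [d], h2, mul_inv_cancel_right _ _⟩
    calc _ ≤ _ := Set.encard_le_encard hsub
      _ ≤ _ := Set.encard_union_le _ _
      _ ≤ 1 + (u.norm : ℕ∞) := by
        refine add_le_add ?_ ((Set.encard_image_le _ _).trans ih)
        split_ifs <;> simp
      _ = (mk [d] * u).norm := by simp [norm, hw, add_comm]

theorem inv_mk_mul_pow_mem_startsWith {a b : List (C × Bool)} {c : C × Bool}
    (h : IsCyclicallyReduced (a ++ c :: b)) (n : ℕ) (hn : n ≠ 0) :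
    (mk a)⁻¹ * mk (a ++ c :: b) ^ n ∈ startsWith c := by
  obtain ⟨n, rfl⟩ := Nat.exists_eq_succ_of_ne_zero hn
  have h1 : (mk a)⁻¹ * mk (a ++ c :: b) ^ (n + 1) =
      mk (c :: (b ++ (List.replicate n (a ++ c :: b)).flatten)) := by
    rw [pow_succ', pow_mk, ← mul_mk, mul_assoc, inv_mul_cancel_left, mul_mk]
    rfl
  rw [h1]
  have h2 := (h.flatten_replicate (n + 1)).isReduced
  rw [List.replicate_succ, List.flatten_cons, List.append_assoc] at h2
  exact mem_startsWith_of_isReduced (List.IsChain.right_of_append h2)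

theorem inv_mk_mul_inv_pow_notMem_startsWith {a b : List (C × Bool)} {c : C × Bool}
    (h : IsCyclicallyReduced (a ++ c :: b)) (n : ℕ) :
    (mk a)⁻¹ * (mk (a ++ c :: b))⁻¹ ^ n ∉ startsWith c := by
  intro h1
  have h2 := (h.flatten_replicate (n + 1)).isReduced
  rw [List.replicate_succ', List.flatten_append, List.flatten_singleton,
    show a ++ c :: b = (a ++ [c]) ++ b by simp, ← List.append_assoc] at h2
  have h3 : IsReduced (invRev ((List.replicate n (a ++ [c] ++ b)).flatten ++ (a ++ [c]))) := by
    rw [isReduced_iff_reduce_eq, reduce_invRev]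
    exact congrArg _ (IsReduced.reduce_eq (List.IsChain.left_of_append h2))
  rw [← List.append_assoc, invRev_append] at h3
  have h4 : mk [(c.1, !c.2)] * ((mk a)⁻¹ * (mk (a ++ c :: b))⁻¹ ^ n) ∈
      startsWith (c.1, !c.2) := by
    have h5 := mem_startsWith_of_isReduced h3
    convert h5 using 1
    rw [← mk_singleton_inv, inv_pow, pow_mk, ← mul_inv_rev, ← mul_inv_rev, mul_mk, mul_mk, inv_mk,
      invRev_append]
    simp [invRev]
  rw [mk_mul_mem_startsWith_iff] at h4
  exact h4 (by rwa [Bool.not_not])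

/-- The cut separating the two ends of the axis of a nontrivial element. -/
theorem exists_cut_of_ne_one {C₁ : Set C} {W : FreeGroup C} (hW : W ≠ 1) :
    ∃ (h : FreeGroup C) (c : C × Bool),
      (c.1 ∉ C₁ ∨ ∀ y, y⁻¹ * h ∈ Subgroup.closure (of '' C₁) →
        y⁻¹ * W * y ∈ Subgroup.closure (of '' C₁)) ∧
      ∃ n₀ : ℕ, ∀ n ≥ n₀, h⁻¹ * W ^ n ∈ startsWith c ∧ h⁻¹ * W⁻¹ ^ n ∉ startsWith c := by
  set u : FreeGroup C := mk (reduceCyclically.conjugator W.toWord) with hu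
  set r := reduceCyclically W.toWord with hr
  have hrc : IsCyclicallyReduced r := reduceCyclically.isCyclicallyReduced isReduced_toWord
  have hWr : W = u * mk r * u⁻¹ := by
    rw [hu, hr, inv_mk, mul_mk, mul_mk, reduceCyclically.conj_conjugator_reduceCyclically,
      mk_toWord]
  have hr1 : mk r ≠ 1 := by
    rintro h
    rw [h] at hWr
    simp [hWr] at hW
  have key : ∀ a b c, r = a ++ c :: b → ∃ n₀ : ℕ, ∀ n ≥ n₀,
      (u * mk a)⁻¹ * W ^ n ∈ startsWith c ∧ (u * mk a)⁻¹ * W⁻¹ ^ n ∉ startsWith c := by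
    intro a b c habc
    have hfin := Set.finite_of_encard_le_coe (encard_startsWith_boundary_le c u⁻¹)
    have hev : ∀ q : FreeGroup C, q ≠ 1 → ∃ n₀ : ℕ, ∀ n ≥ n₀,
        ((mk a)⁻¹ * q ^ n ∈ startsWith c ↔ (mk a)⁻¹ * q ^ n * u⁻¹ ∈ startsWith c) := by
      intro q hq
      have hinj : Function.Injective fun n : ℕ => (mk a)⁻¹ * q ^ n :=
        (mul_right_injective _).comp
          (injective_pow_iff_not_isOfFinOrder.mpr (not_isOfFinOrder_of_isMulTorsionFree hq))
      obtain ⟨n₀, hn₀⟩ := (hfin.preimage hinj.injOn).bddAbove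
      refine ⟨n₀ + 1, fun n hn => ?_⟩
      by_contra hcon
      have := hn₀ (a := n) hcon
      omega
    obtain ⟨n₁, h₁⟩ := hev (mk r) hr1
    obtain ⟨n₂, h₂⟩ := hev (mk r)⁻¹ (inv_ne_one.mpr hr1)
    refine ⟨n₁ + n₂ + 1, fun n hn => ?_⟩
    have e1 : (u * mk a)⁻¹ * W ^ n = (mk a)⁻¹ * mk r ^ n * u⁻¹ := by
      rw [hWr, conj_pow]; group
    have e2 : (u * mk a)⁻¹ * W⁻¹ ^ n = (mk a)⁻¹ * (mk r)⁻¹ ^ n * u⁻¹ := by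
      rw [show W⁻¹ = u * (mk r)⁻¹ * u⁻¹ by rw [hWr]; group, conj_pow]; group
    rw [e1, e2, ← h₁ n (by omega), ← h₂ n (by omega), habc]
    exact ⟨inv_mk_mul_pow_mem_startsWith (habc ▸ hrc) n (by omega),
      inv_mk_mul_inv_pow_notMem_startsWith (habc ▸ hrc) n⟩
  by_cases hrC : ∀ p ∈ r, p.1 ∈ C₁
  · obtain ⟨c, b, hcb⟩ : ∃ c b, r = c :: b := by
      cases h : r with
      | nil => exact absurd (by rw [h]; rfl) hr1
      | cons c b => exact ⟨c, b, rfl⟩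
    refine ⟨u * mk [], c, Or.inr fun y hy => ?_, key [] b c hcb⟩
    have hrL : mk r ∈ Subgroup.closure (of '' C₁) := by
      rw [mem_closure_of_image_iff, toWord_mk, hrc.isReduced.reduce_eq]
      exact hrC
    rw [← one_eq_mk, mul_one] at hy
    rw [hWr, show y⁻¹ * (u * mk r * u⁻¹) * y = (y⁻¹ * u) * mk r * (y⁻¹ * u)⁻¹ by group]
    exact mul_mem (mul_mem hy hrL) (inv_mem hy)
  · push Not at hrC
    obtain ⟨c, hc, hcC⟩ := hrC
    obtain ⟨a, b, hab⟩ := List.append_of_mem hc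
    exact ⟨u * mk a, c, Or.inl hcC, key a b c hab⟩

end Words

end FreeGroup

theorem Set.encard_biUnion_le_sum {α ι : Type*} (s : Finset ι) (t : ι → Set α) (n : ι → ℕ)
    (h : ∀ i ∈ s, (t i).encard ≤ n i) : (⋃ i ∈ s, t i).encard ≤ (∑ i ∈ s, n i : ℕ) := by
  classical
  induction s using Finset.induction_on with
  | empty => simp
  | insert a s ha ih =>
    rw [Finset.set_biUnion_insert, Finset.sum_insert ha, Nat.cast_add]
    exact (Set.encard_union_le _ _).trans (add_le_add (h a (by simp))
      (ih fun i hi => h i (Finset.mem_insert_of_mem hi)))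

namespace RelativeFactor

section Cosets

variable {G : Type w} [Group G] {C : Type*} {F : Subgroup G} {τ : G}
  {j : G → FreeGroup C} {C₁ : Set C} {G₀ : Subgroup G} {S : Set G}

/-- The relative Cayley graph: the vertices are the cosets of `G₀`, and `f G₀` is joined to
`f s G₀` for `s ∈ S` and `f ∈ F`. -/
def cosetGraph (F G₀ : Subgroup G) (S : Set G) (hinv : ∀ s ∈ S, s⁻¹ ∈ S) (hSF : S ⊆ F) :
    SimpleGraph (G ⧸ G₀) where
  Adj v v' := v ≠ v' ∧ ∃ f ∈ F, ∃ s ∈ S, v = (f : G ⧸ G₀) ∧ v' = ((f * s : G) : G ⧸ G₀)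
  symm := ⟨by
    rintro v v' ⟨hne, f, hf, s, hs, rfl, rfl⟩
    exact ⟨hne.symm, f * s, mul_mem hf (hSF hs), s⁻¹, hinv s hs, rfl, by simp⟩⟩
  loopless := ⟨fun v h => h.1 rfl⟩

/-- The cut of the relative Cayley graph determined by a letter and a translation. -/
def cut [DecidableEq C] (F G₀ : Subgroup G) (j : G → FreeGroup C) (h : FreeGroup C)
    (c : C × Bool) : Set (G ⧸ G₀) :=
  {v | ∃ f ∈ F, v = (f : G ⧸ G₀) ∧ h⁻¹ * j f ∈ FreeGroup.startsWith c}

section Hom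

variable (hj : ∀ f ∈ F, ∀ g ∈ F, j (f * g) = j f * j g)
include hj

theorem map_one_of_mul : j 1 = 1 := by
  simpa using hj 1 (one_mem _) 1 (one_mem _)

theorem map_inv_of_mul {f : G} (hf : f ∈ F) : j f⁻¹ = (j f)⁻¹ := by
  rw [eq_inv_iff_mul_eq_one, ← hj _ (inv_mem hf) _ hf, inv_mul_cancel, map_one_of_mul hj]

theorem map_pow_of_mul {f : G} (hf : f ∈ F) (n : ℕ) : j (f ^ n) = j f ^ n := by
  induction n with
  | zero => simpa using map_one_of_mul hj
  | succ n ih => rw [pow_succ, pow_succ, hj _ (pow_mem hf n) _ hf, ih]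

theorem injOn_of_mul (hj1 : ∀ f ∈ F, j f = 1 → f = 1) : Set.InjOn j F := by
  intro f hf g hg hfg
  rw [← inv_mul_eq_one]
  exact hj1 _ (mul_mem (inv_mem hf) hg)
    (by rw [hj _ (inv_mem hf) _ hg, map_inv_of_mul hj hf, hfg, inv_mul_cancel])

variable (hL : ∀ f ∈ F, f ∈ G₀ ↔ j f ∈ Subgroup.closure (FreeGroup.of '' C₁))
include hL

theorem mk_eq_mk_iff {f g : G} (hf : f ∈ F) (hg : g ∈ F) :
    (f : G ⧸ G₀) = (g : G ⧸ G₀) ↔ (j f)⁻¹ * j g ∈ Subgroup.closure (FreeGroup.of '' C₁) := by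
  rw [QuotientGroup.eq, hL _ (mul_mem (inv_mem hf) hg), hj _ (inv_mem hf) _ hg,
    map_inv_of_mul hj hf]

variable [DecidableEq C]

theorem mk_mem_cut_iff {h : FreeGroup C} {c : C × Bool}
    (hc : c.1 ∉ C₁ ∨ ∀ f ∈ F, (j f)⁻¹ * h ∉ Subgroup.closure (FreeGroup.of '' C₁))
    {f : G} (hf : f ∈ F) :
    (f : G ⧸ G₀) ∈ cut F G₀ j h c ↔ h⁻¹ * j f ∈ FreeGroup.startsWith c := by
  refine ⟨?_, fun h => ⟨f, hf, rfl, h⟩⟩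
  rintro ⟨f', hf', he, h'⟩
  rw [mk_eq_mk_iff hj hL hf hf'] at he
  rw [show h⁻¹ * j f' = h⁻¹ * j f * ((j f)⁻¹ * j f') by group,
    FreeGroup.mul_mem_startsWith_iff he] at h'
  · exact h'
  · refine hc.symm.imp (fun H h2 => H f hf ?_) id
    simpa using inv_mem h2

theorem encard_boundary_cut_le (hj1 : ∀ f ∈ F, j f = 1 → f = 1) {hinv : ∀ s ∈ S, s⁻¹ ∈ S}
    {hSF : S ⊆ F} (hS : S.Finite) {h : FreeGroup C} {c : C × Bool}
    (hc : c.1 ∉ C₁ ∨ ∀ f ∈ F, (j f)⁻¹ * h ∉ Subgroup.closure (FreeGroup.of '' C₁)) :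
    (CutSystem.boundary (cosetGraph F G₀ S hinv hSF) (cut F G₀ j h c)).encard ≤
      (∑ s ∈ hS.toFinset, (j s).norm : ℕ) := by
  have hsub : CutSystem.boundary (cosetGraph F G₀ S hinv hSF) (cut F G₀ j h c) ⊆
      ⋃ s ∈ hS.toFinset, (fun f : G => ((f : G ⧸ G₀), ((f * s : G) : G ⧸ G₀))) ''
        {f ∈ (F : Set G) | ¬ (h⁻¹ * j f ∈ FreeGroup.startsWith c ↔
          h⁻¹ * j f * j s ∈ FreeGroup.startsWith c)} := by
    rintro ⟨v, v'⟩ ⟨⟨-, f, hf, s, hs, rfl, rfl⟩, h1, h2⟩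
    rw [mk_mem_cut_iff hj hL hc hf] at h1
    rw [mk_mem_cut_iff hj hL hc (mul_mem hf (hSF hs)), hj _ hf _ (hSF hs), ← mul_assoc] at h2
    exact Set.mem_biUnion (hS.mem_toFinset.mpr hs) ⟨f, ⟨hf, fun h3 => h2 (h3.mp h1)⟩, rfl⟩
  refine (Set.encard_le_encard hsub).trans (Set.encard_biUnion_le_sum _ _ _ fun s _ => ?_)
  refine (Set.encard_image_le _ _).trans ?_
  refine le_trans ?_ (FreeGroup.encard_startsWith_boundary_le c (j s))
  refine Set.encard_le_encard_of_injOn (f := fun f => h⁻¹ * j f) (fun f hf => hf.2) ?_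
  exact fun f hf g hg hfg => injOn_of_mul hj hj1 hf.1 hg.1 (mul_left_cancel hfg)

end Hom

variable (hF : ∀ g h, g ∉ F → h ∉ F → g * h ∈ F) (hτF : τ ∉ F) (hτ : τ * τ = 1)
  (hτG : τ ∈ G₀) (hinv : ∀ s ∈ S, s⁻¹ ∈ S) (hSF : S ⊆ F)
include hF hτF hτG

theorem exists_mk_eq (v : G ⧸ G₀) : ∃ f ∈ F, v = (f : G ⧸ G₀) := by
  induction v using QuotientGroup.induction_on with
  | H g =>
    by_cases hg : g ∈ F
    · exact ⟨g, hg, rfl⟩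
    · exact ⟨g * τ, hF _ _ hg hτF, by rw [QuotientGroup.eq]; simpa using hτG⟩

include hτ

theorem smul_adj_cosetGraph (hconj : ∀ s ∈ S, τ * s * τ ∈ S) (g : G) (v v' : G ⧸ G₀)
    (h : (cosetGraph F G₀ S hinv hSF).Adj v v') :
    (cosetGraph F G₀ S hinv hSF).Adj (g • v) (g • v') := by
  obtain ⟨hne, f, hf, s, hs, rfl, rfl⟩ := h
  refine ⟨fun he => hne (smul_left_cancel g he), ?_⟩
  by_cases hg : g ∈ F
  · exact ⟨g * f, mul_mem hg hf, s, hs, rfl, by rw [mul_assoc]; rfl⟩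
  · refine ⟨g * f * τ, hF _ _ (fun h => hg ?_) hτF, τ * s * τ, hconj s hs, ?_, ?_⟩
    · simpa using mul_mem h (inv_mem hf)
    · rw [MulAction.Quotient.smul_coe, QuotientGroup.eq]
      simpa [mul_assoc] using hτG
    · rw [MulAction.Quotient.smul_coe, QuotientGroup.eq]
      have h1 : g * f * τ * (τ * s * τ) = g * f * s * τ := by
        simp only [mul_assoc]
        rw [← mul_assoc τ τ, hτ, one_mul]
      rw [h1]
      simpa [mul_assoc] using hτG

theorem connected_cosetGraph (hconj : ∀ s ∈ S, τ * s * τ ∈ S)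
    (hgen : F = Subgroup.closure ((G₀ ⊓ F : Subgroup G) ∪ S)) :
    (cosetGraph F G₀ S hinv hSF).Connected := by
  have hsmul : ∀ (g : G) {v v' : G ⧸ G₀}, (cosetGraph F G₀ S hinv hSF).Reachable v v' →
      (cosetGraph F G₀ S hinv hSF).Reachable (g • v) (g • v') := fun g v v' h =>
    h.map ⟨fun v => g • v, fun {v v'} h =>
      smul_adj_cosetGraph hF hτF hτ hτG hinv hSF hconj g v v' h⟩
  have key : ∀ f ∈ F, (cosetGraph F G₀ S hinv hSF).Reachable ((1 : G) : G ⧸ G₀) (f : G ⧸ G₀) := by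
    intro f hf
    rw [hgen] at hf
    induction hf using Subgroup.closure_induction with
    | mem x hx =>
      by_cases hxG : x ∈ G₀
      · rw [show ((1 : G) : G ⧸ G₀) = x by rw [QuotientGroup.eq]; simpa using hxG]
      · have hxS : x ∈ S := hx.resolve_left fun h => hxG h.1
        refine SimpleGraph.Adj.reachable ⟨fun h => hxG ?_, 1, one_mem _, x, hxS, rfl, by simp⟩
        rw [QuotientGroup.eq] at h
        simpa using h
    | one => exact .refl _
    | mul x y _ _ hx hy =>
      refine hx.trans ?_
      simpa [MulAction.Quotient.smul_coe] using hsmul x hy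
    | inv x _ hx => simpa [MulAction.Quotient.smul_coe] using (hsmul x⁻¹ hx).symm
  have hne : Nonempty (G ⧸ G₀) := ⟨((1 : G) : G ⧸ G₀)⟩
  refine SimpleGraph.Connected.mk fun v v' => ?_
  obtain ⟨f, hf, rfl⟩ := exists_mk_eq hF hτF hτG v
  obtain ⟨f', hf', rfl⟩ := exists_mk_eq hF hτF hτG v'
  exact (key f hf).symm.trans (key f' hf')

variable (hj : ∀ f ∈ F, ∀ g ∈ F, j (f * g) = j f * j g) (hj1 : ∀ f ∈ F, j f = 1 → f = 1)
  (hL : ∀ f ∈ F, f ∈ G₀ ↔ j f ∈ Subgroup.closure (FreeGroup.of '' C₁))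
include hj hj1 hL hinv hSF

theorem exists_isAdapted_top_of_symmetric (hconj : ∀ s ∈ S, τ * s * τ ∈ S) (hS : S.Finite)
    (hgen : F = Subgroup.closure ((G₀ ⊓ F : Subgroup G) ∪ S))
    {S₀ : Set G} (hS₀ : IsAdapted F τ S₀ G₀) : ∃ S', S₀ ⊆ S' ∧ IsAdapted F τ S' ⊤ := by
  classical
  have htf : ∀ g ∈ F, ∀ n : ℕ, n ≠ 0 → g ^ n = 1 → g = 1 := by
    intro g hg n hn h
    refine hj1 g hg ?_
    have h1 := map_pow_of_mul hj hg n
    rw [h, map_one_of_mul hj] at h1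
    exact (pow_eq_one_iff_left hn).mp h1.symm
  have hbdry : ∀ {h : FreeGroup C} {c : C × Bool},
      (c.1 ∉ C₁ ∨ ∀ f ∈ F, (j f)⁻¹ * h ∉ Subgroup.closure (FreeGroup.of '' C₁)) →
      (CutSystem.boundary (cosetGraph F G₀ S hinv hSF) (cut F G₀ j h c)).Finite ∧
      (CutSystem.boundary (cosetGraph F G₀ S hinv hSF) (cut F G₀ j h c)).ncard ≤
        ∑ s ∈ hS.toFinset, (j s).norm := by
    intro h c hc
    have := encard_boundary_cut_le hj hL hj1 (hinv := hinv) (hSF := hSF) hS hc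
    exact ⟨Set.finite_of_encard_le_coe this, ENat.toNat_le_of_le_natCast this⟩
  obtain ⟨Q, _, p₀, T, hT, hstab, R, hR, hRT⟩ := CutSystem.exists_treeSystem (F := F)
    (connected_cosetGraph hF hτF hτ hτG hinv hSF hconj hgen)
    (smul_adj_cosetGraph hF hτF hτ hτG hinv hSF hconj)
    (P := (fun s : G => (((1 : G) : G ⧸ G₀), (s : G ⧸ G₀))) '' S) (hS.image _)
    (by
      rintro a b ⟨-, f, hf, s, hs, rfl, rfl⟩
      exact ⟨f⁻¹, s, hs, by simp⟩)
    ((1 : G) : G ⧸ G₀) (∑ s ∈ hS.toFinset, (j s).norm) htf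
    (by
      intro v
      obtain ⟨f, -, rfl⟩ := exists_mk_eq hF hτF hτG v
      exact ⟨f, by simp⟩)
    (by
      rintro g hg a b ⟨hne, f, hf, s, hs, rfl, rfl⟩ h1 h2
      have hsF := hSF hs
      rw [MulAction.Quotient.smul_coe, smul_eq_mul, eq_comm,
        mk_eq_mk_iff hj hL hf (mul_mem hg hf), hj _ hg _ hf] at h1
      rw [MulAction.Quotient.smul_coe, smul_eq_mul, eq_comm,
        mk_eq_mk_iff hj hL (mul_mem hf hsF) (mul_mem hg (mul_mem hf hsF)), hj _ hg _ (mul_mem hf hsF),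
        hj _ hf _ hsF] at h2
      rw [Ne, mk_eq_mk_iff hj hL hf (mul_mem hf hsF), hj _ hf _ hsF, inv_mul_cancel_left] at hne
      have := FreeGroup.eq_one_of_conj_mem_closure h1 (u := j s)
        (by convert h2 using 1; group) hne
      refine hj1 g hg ?_
      rw [inv_mul_eq_one] at this
      exact right_eq_mul.mp this)
    (by
      intro v v' hne
      obtain ⟨f, hf, rfl⟩ := exists_mk_eq hF hτF hτG v
      obtain ⟨f', hf', rfl⟩ := exists_mk_eq hF hτF hτG v'
      rw [ne_comm, Ne, mk_eq_mk_iff hj hL hf' hf] at hne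
      obtain ⟨a, ha, c, hc, hac⟩ := FreeGroup.exists_inv_mul_mem_startsWith hne
      refine ⟨cut F G₀ j (j f' * a) c, (hbdry (Or.inl hc)).1, (hbdry (Or.inl hc)).2, ?_, ?_⟩
      · rw [mk_mem_cut_iff hj hL (Or.inl hc) hf]
        simpa [mul_assoc] using hac
      · rw [mk_mem_cut_iff hj hL (Or.inl hc) hf']
        intro h
        exact hc (FreeGroup.mem_of_mem_startsWith (inv_mem ha) (by simpa using h)))
    (by
      intro g hg hfix
      have hW : j g ≠ 1 := fun h => hfix ((1 : G) : G ⧸ G₀) (by simp [hj1 g hg h])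
      obtain ⟨h, c, hc, n₀, hn₀⟩ := FreeGroup.exists_cut_of_ne_one (C₁ := C₁) hW
      have hc' : c.1 ∉ C₁ ∨ ∀ f ∈ F, (j f)⁻¹ * h ∉ Subgroup.closure (FreeGroup.of '' C₁) := by
        refine hc.imp id fun H f hf h1 => hfix (f : G ⧸ G₀) ?_
        rw [MulAction.Quotient.smul_coe, smul_eq_mul, eq_comm,
          mk_eq_mk_iff hj hL hf (mul_mem hg hf), hj _ hg _ hf, ← mul_assoc]
        exact H _ h1
      refine ⟨cut F G₀ j h c, (hbdry hc').1, (hbdry hc').2, n₀, fun n hn => ?_⟩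
      rw [MulAction.Quotient.smul_coe, MulAction.Quotient.smul_coe, smul_eq_mul, smul_eq_mul,
        mul_one, mul_one, mk_mem_cut_iff hj hL hc' (pow_mem hg n),
        mk_mem_cut_iff hj hL hc' (pow_mem (inv_mem hg) n), map_pow_of_mul hj hg,
        map_pow_of_mul hj (inv_mem hg), map_inv_of_mul hj hg]
      exact hn₀ n hn)
  have hv : hT.vstab = G₀ := by
    ext g
    refine (hstab g).trans ?_
    rw [MulAction.Quotient.smul_coe, smul_eq_mul, mul_one, eq_comm, QuotientGroup.eq]
    simp
  rw [← hv] at hS₀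
  exact hT.exists_isAdapted_top hF (fun g hg h => htf g hg 2 two_ne_zero (by rw [pow_two, h]))
    hτF hτ hS₀ hR hRT

omit hinv in
/-- An adapted basis of a relative free factor extends to an adapted basis of the whole group,
provided the group is finitely generated over the factor. -/
theorem exists_isAdapted_top (hS : S.Finite)
    (hgen : F = Subgroup.closure ((G₀ ⊓ F : Subgroup G) ∪ S))
    {S₀ : Set G} (hS₀ : IsAdapted F τ S₀ G₀) : ∃ S', S₀ ⊆ S' ∧ IsAdapted F τ S' ⊤ := by
  have hτi : τ⁻¹ = τ := inv_eq_of_mul_eq_one_right hτ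
  have hconjF : ∀ s ∈ F, τ * s * τ ∈ F := by
    intro s hs
    refine hF _ _ (fun h => hτF ?_) hτF
    simpa using mul_mem h (inv_mem hs)
  have hcc : ∀ s, τ * (τ * s * τ) * τ = s := by
    intro s
    rw [← mul_assoc, ← mul_assoc, hτ, one_mul, mul_assoc, hτ, mul_one]
  have hci : ∀ s, (τ * s * τ)⁻¹ = τ * s⁻¹ * τ := by
    intro s
    simp [hτi, mul_assoc]
  set c : G → G := fun s => τ * s * τ with hc
  set S' : Set G := (S ∪ S⁻¹) ∪ c '' (S ∪ S⁻¹) with hS'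
  have hU : ∀ s ∈ S ∪ S⁻¹, s⁻¹ ∈ S ∪ S⁻¹ := by
    rintro s (h | h)
    · exact Or.inr (by simpa using h)
    · exact Or.inl h
  have hUF : S ∪ S⁻¹ ⊆ F := by
    rintro s (h | h)
    · exact hSF h
    · simpa using inv_mem (hSF h)
  have hS'F : S' ⊆ F := by
    rintro s (h | ⟨s, h, rfl⟩)
    · exact hUF h
    · exact hconjF s (hUF h)
  refine exists_isAdapted_top_of_symmetric (S := S') hF hτF hτ hτG ?_ hS'F hj hj1 hL ?_ ?_ ?_ hS₀
  · rintro s (h | ⟨s, h, rfl⟩)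
    · exact Or.inl (hU s h)
    · exact Or.inr ⟨s⁻¹, hU s h, (hci s).symm⟩
  · rintro s (h | ⟨s, h, rfl⟩)
    · exact Or.inr ⟨s, h, rfl⟩
    · rw [hc, hcc]
      exact Or.inl h
  · have : (S ∪ S⁻¹).Finite := hS.union hS.inv
    exact this.union (this.image _)
  · refine le_antisymm ?_ ?_
    · conv_lhs => rw [hgen]
      exact Subgroup.closure_mono (Set.union_subset_union_right _ fun s h => Or.inl (Or.inl h))
    · rw [Subgroup.closure_le]
      exact Set.union_subset (fun x hx => hx.2) hS'F

end Cosets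

end RelativeFactor

section Transfer

variable {G : Type w} [Group G] {F : Subgroup G} {τ : G}

theorem IsAdapted.subset {S : Set G} {H : Subgroup G} (h : IsAdapted F τ S H) : S ⊆ H := by
  intro s hs
  have := Subgroup.subset_closure (G := G) hs
  rw [h.closure_eq] at this
  exact this.1

theorem FreeOn.preimage {S : Set G} (h : FreeOn S) (Γ : Subgroup G) :
    FreeOn (Γ.subtype ⁻¹' S) := by
  have h1 := FreeOn.injective_comp h (f := fun s : (Γ.subtype ⁻¹' S : Set Γ) => (s : G))
    (fun a b hab => Subtype.ext (Subtype.ext hab)) fun s => s.2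
  refine Function.Injective.of_comp (f := Γ.subtype) ?_
  have h2 : Γ.subtype.comp (FreeGroup.lift fun s : (Γ.subtype ⁻¹' S : Set Γ) => (s : Γ)) =
      FreeGroup.lift fun s : (Γ.subtype ⁻¹' S : Set Γ) => ((s : Γ) : G) := by
    ext s
    rw [MonoidHom.comp_apply, FreeGroup.lift_apply_of, FreeGroup.lift_apply_of]
    rfl
  rw [← MonoidHom.coe_comp, h2]
  exact h1

theorem IsAdapted.subgroupOf {S : Set G} {H Γ : Subgroup G} (h : IsAdapted F τ S H)
    (hH : H ≤ Γ) :
    IsAdapted (F.subgroupOf Γ) ⟨τ, hH h.mem⟩ (Γ.subtype ⁻¹' S) (H.subgroupOf Γ) where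
  mem := h.mem
  free := h.free.preimage Γ
  closure_eq := by
    have hS : Γ.subtype '' (Γ.subtype ⁻¹' S) = S :=
      Set.image_preimage_eq_of_subset fun s hs => ⟨⟨s, hH (h.subset hs)⟩, rfl⟩
    apply Subgroup.map_injective Γ.subtype_injective
    rw [MonoidHom.map_closure, hS, h.closure_eq, Subgroup.map_inf_eq _ _ _ Γ.subtype_injective,
      Subgroup.map_subgroupOf_eq_of_le hH]
    ext x
    simp only [Subgroup.mem_inf, Subgroup.mem_map, Subgroup.mem_subgroupOf]
    constructor
    · rintro ⟨h1, h2⟩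
      exact ⟨h1, ⟨x, hH h1⟩, h2, rfl⟩
    · rintro ⟨h1, y, h2, rfl⟩
      exact ⟨h1, h2⟩
  elt := by
    have hins : ∀ a ∈ insert 1 S, a ∈ Γ := by
      rintro a (rfl | ha)
      exacts [one_mem _, hH (h.subset ha)]
    have hins' : ∀ (a : G) (ha : a ∈ insert 1 S),
        (⟨a, hins a ha⟩ : Γ) ∈ insert 1 (Γ.subtype ⁻¹' S) := by
      rintro a (rfl | ha)
      exacts [Or.inl rfl, Or.inr ha]
    intro s hs
    rcases h.elt s hs with h1 | ⟨a, ha, b, hb, h1, h2, h3⟩ | h1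
    · exact Or.inl (Subtype.ext h1)
    · exact Or.inr (Or.inl ⟨⟨a, hins a ha⟩, hins' a ha, ⟨b, hins b hb⟩, hins' b hb,
        Subtype.ext h1, Subtype.ext h2, Subtype.ext h3⟩)
    · exact Or.inr (Or.inr h1)
  conj := by
    intro ρ hρ hρF hρ1
    obtain ⟨a, ha, x, hx, h1, h2⟩ := h.conj ρ hρ hρF (congrArg Subtype.val hρ1)
    refine ⟨⟨a, hH ha.1⟩, ha, ?_⟩
    rcases hx with rfl | hx
    · exact ⟨1, Or.inl rfl, Subtype.ext h1, Subtype.ext h2⟩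
    · exact ⟨⟨x, hH (h.subset hx)⟩, Or.inr hx, Subtype.ext h1, Subtype.ext h2⟩

theorem IsAdapted.of_subgroupOf_top {Γ : Subgroup G} {S : Set Γ} {hτ : τ ∈ Γ}
    (h : IsAdapted (F.subgroupOf Γ) ⟨τ, hτ⟩ S ⊤) : IsAdapted F τ (Γ.subtype '' S) Γ where
  mem := hτ
  free := h.free.image Γ.subtype_injective
  closure_eq := by
    rw [← MonoidHom.map_closure, h.closure_eq, top_inf_eq]
    ext x
    simp only [Subgroup.mem_inf, Subgroup.mem_map, Subgroup.mem_subgroupOf]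
    exact ⟨by rintro ⟨y, h2, rfl⟩; exact ⟨y.2, h2⟩, fun ⟨h1, h2⟩ => ⟨⟨x, h1⟩, h2, rfl⟩⟩
  elt := by
    have hins : ∀ a ∈ insert 1 S, (a : G) ∈ insert 1 (Γ.subtype '' S) := by
      rintro a (rfl | ha)
      exacts [Or.inl rfl, Or.inr ⟨a, ha, rfl⟩]
    rintro - ⟨s, hs, rfl⟩
    rcases h.elt s hs with h1 | ⟨a, ha, b, hb, h1, h2, h3⟩ | h1
    · exact Or.inl (congrArg Subtype.val h1)
    · exact Or.inr (Or.inl ⟨a, hins a ha, b, hins b hb, congrArg Subtype.val h1,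
        congrArg Subtype.val h2, congrArg Subtype.val h3⟩)
    · exact Or.inr (Or.inr ⟨_, h1, rfl⟩)
  conj := by
    intro ρ hρ hρF hρ1
    obtain ⟨a, ha, x, hx, h1, h2⟩ := h.conj ⟨ρ, hρ⟩ trivial hρF (Subtype.ext hρ1)
    refine ⟨a, ⟨a.2, ha.2⟩, x, ?_, congrArg Subtype.val h1, congrArg Subtype.val h2⟩
    rcases hx with rfl | hx
    exacts [Or.inl rfl, Or.inr ⟨x, hx, rfl⟩]

/-- The extension theorem for adapted bases of subgroups. -/
theorem IsAdapted.exists_extension {C : Type*} (hF : ∀ g h, g ∉ F → h ∉ F → g * h ∈ F)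
    (hτF : τ ∉ F) (hτ : τ * τ = 1) {H₀ H : Subgroup G} (hH : H₀ ≤ H) {j : G → FreeGroup C}
    {C₁ : Set C} (hj : ∀ f ∈ F, ∀ g ∈ F, j (f * g) = j f * j g) (hj1 : ∀ f ∈ F, j f = 1 → f = 1)
    (hL : ∀ f ∈ H ⊓ F, f ∈ H₀ ↔ j f ∈ Subgroup.closure (FreeGroup.of '' C₁))
    {S : Set G} (hS : S.Finite) (hgen : H ⊓ F = Subgroup.closure ((H₀ ⊓ F : Subgroup G) ∪ S))
    {S₀ : Set G} (hS₀ : IsAdapted F τ S₀ H₀) : ∃ S', S₀ ⊆ S' ∧ IsAdapted F τ S' H := by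
  have hSH : S ⊆ (H ⊓ F : Subgroup G) := by
    rw [hgen]
    exact Set.subset_union_right.trans Subgroup.subset_closure
  obtain ⟨S', hS', hA⟩ := RelativeFactor.exists_isAdapted_top (G := H) (F := F.subgroupOf H)
    (τ := ⟨τ, hH hS₀.mem⟩) (j := fun g => j g) (C₁ := C₁) (G₀ := H₀.subgroupOf H)
    (S := H.subtype ⁻¹' S) (fun g h => hF g h) hτF (Subtype.ext hτ) hS₀.mem
    (fun s hs => (hSH hs).2) (fun f hf g hg => hj f hf g hg)
    (fun f hf h => Subtype.ext (hj1 f hf h)) (fun f hf => hL f ⟨f.2, hf⟩)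
    (hS.preimage H.subtype_injective.injOn)
    (by
      apply Subgroup.map_injective H.subtype_injective
      have h3 : H.subtype '' (H.subtype ⁻¹' S) = S :=
        Set.image_preimage_eq_of_subset fun s hs => ⟨⟨s, (hSH hs).1⟩, rfl⟩
      rw [MonoidHom.map_closure, Set.image_union, h3]
      have h1 : (F.subgroupOf H).map H.subtype = H ⊓ F := by
        rw [Subgroup.subgroupOf_map_subtype, inf_comm]
      have h2 : H.subtype '' ((H₀.subgroupOf H ⊓ F.subgroupOf H : Subgroup H) : Set H) =
          (H₀ ⊓ F : Subgroup G) := by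
        ext x
        simp only [Set.mem_image, SetLike.mem_coe, Subgroup.mem_inf, Subgroup.mem_subgroupOf]
        exact ⟨by rintro ⟨y, h, rfl⟩; exact h, fun h => ⟨⟨x, hH h.1⟩, h, rfl⟩⟩
      rw [h1, h2, hgen])
    (hS₀.subgroupOf hH)
  exact ⟨H.subtype '' S', fun s hs => ⟨⟨s, hH (hS₀.subset hs)⟩, hS' hs, rfl⟩, hA.of_subgroupOf_top⟩

theorem IsAdapted.iSup_of_directed {ι : Type*} [Nonempty ι] {S : ι → Set G} {H : ι → Subgroup G}
    (hdir : ∀ i k, ∃ l, S i ⊆ S l ∧ S k ⊆ S l ∧ H i ≤ H l ∧ H k ≤ H l)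
    (h : ∀ i, IsAdapted F τ (S i) (H i)) : IsAdapted F τ (⋃ i, S i) (⨆ i, H i) := by
  have hH : Directed (· ≤ ·) H := fun i k =>
    let ⟨l, _, _, h1, h2⟩ := hdir i k; ⟨l, h1, h2⟩
  have hSd : Directed (· ⊆ ·) S := fun i k =>
    let ⟨l, h1, h2, _, _⟩ := hdir i k; ⟨l, h1, h2⟩
  have hmem : ∀ x, x ∈ ⨆ i, H i ↔ ∃ i, x ∈ H i := fun x => Subgroup.mem_iSup_of_directed hH
  refine ⟨(hmem _).mpr ⟨Classical.arbitrary ι, (h _).mem⟩, ?_, ?_, ?_, ?_⟩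
  · rw [FreeOn, injective_iff_map_eq_one]
    intro w hw
    classical
    obtain ⟨i, hi⟩ : ∃ i, ((w.toWord.map fun p => (p.1 : G)).toFinset : Set G) ⊆ S i := by
      refine hSd.exists_mem_subset_of_finset_subset_biUnion fun x hx => ?_
      simp only [List.coe_toFinset, List.mem_map, Set.mem_ofPred_eq] at hx
      obtain ⟨p, -, rfl⟩ := hx
      exact p.1.2
    have hcl : w ∈ Subgroup.closure (FreeGroup.of '' {s : (⋃ i, S i : Set G) | s.1 ∈ S i}) := by
      rw [FreeGroup.mem_closure_of_image_iff]
      rintro ⟨s, b⟩ hb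
      refine hi ?_
      rw [List.coe_toFinset]
      exact List.mem_map.mpr ⟨_, hb, rfl⟩
    set e : S i → (⋃ i, S i : Set G) := fun s => ⟨s.1, Set.mem_iUnion_of_mem i s.2⟩ with he
    have hr : w ∈ (FreeGroup.map e).range := by
      refine (Subgroup.closure_le _).mpr ?_ hcl
      rintro - ⟨s, hs, rfl⟩
      exact ⟨FreeGroup.of ⟨s.1, hs⟩, by simp [he]⟩
    obtain ⟨v, rfl⟩ := hr
    have h1 : FreeGroup.lift (fun s : S i => (s : G)) v = 1 := by
      rw [← hw, ← MonoidHom.comp_apply]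
      congr 1
      ext s
      simp [he]
    rw [(injective_iff_map_eq_one _).mp (h i).free v h1, _root_.map_one]
  · rw [Subgroup.closure_iUnion]
    apply le_antisymm
    · refine iSup_le fun i => ?_
      rw [(h i).closure_eq]
      exact inf_le_inf_right _ (le_iSup H i)
    · rintro x ⟨hx, hxF⟩
      obtain ⟨i, hi⟩ := (hmem x).mp hx
      refine (le_iSup (fun i => Subgroup.closure (S i)) i) ?_
      rw [(h i).closure_eq]
      exact ⟨hi, hxF⟩
  · intro s hs
    obtain ⟨i, hi⟩ := Set.mem_iUnion.mp hs
    exact ((h i).elt s hi).mono (Set.subset_iUnion S i)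
  · intro ρ hρ hρF hρ1
    obtain ⟨i, hi⟩ := (hmem ρ).mp hρ
    obtain ⟨a, ha, x, hx, h1, h2⟩ := (h i).conj ρ hi hρF hρ1
    exact ⟨a, ⟨le_iSup H i ha.1, ha.2⟩, x, Set.insert_subset_insert (Set.subset_iUnion S i) hx,
      h1, h2⟩

end Transfer

section TwoExtension

variable {A : Type u} [Group A]

/-- The action of the group of order two on `A` through an involutory automorphism. -/
def involutionHom (ψ : MulAut A) (hψ : ψ * ψ = 1) : ℤˣ →* MulAut A where
  toFun u := if u = 1 then 1 else ψ
  map_one' := if_pos rfl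
  map_mul' u v := by
    rcases Int.units_eq_one_or u with rfl | rfl <;> rcases Int.units_eq_one_or v with rfl | rfl <;>
      simp [hψ]

variable {ψ : MulAut A} {hψ : ψ * ψ = 1}

/-- The base group of the extension of `A` by an involutory automorphism. -/
def extBase (ψ : MulAut A) (hψ : ψ * ψ = 1) : Subgroup (A ⋊[involutionHom ψ hψ] ℤˣ) where
  carrier := {g | g.right = 1}
  one_mem' := rfl
  mul_mem' {a b} ha hb := by
    simp only [Set.mem_ofPred_eq, SemidirectProduct.mul_right] at *
    rw [ha, hb, one_mul]
  inv_mem' {a} ha := by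
    simp only [Set.mem_ofPred_eq, SemidirectProduct.inv_right] at *
    rw [ha, inv_one]

/-- The involution inducing the automorphism `ψ`. -/
def extInv (ψ : MulAut A) (hψ : ψ * ψ = 1) : A ⋊[involutionHom ψ hψ] ℤˣ := ⟨1, -1⟩

theorem mem_extBase {g : A ⋊[involutionHom ψ hψ] ℤˣ} : g ∈ extBase ψ hψ ↔ g.right = 1 := Iff.rfl

theorem involutionHom_neg_one : involutionHom ψ hψ (-1) = ψ := by
  simp [involutionHom]

theorem extInv_notMem : extInv ψ hψ ∉ extBase ψ hψ := by
  rw [mem_extBase]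
  simp [extInv]

theorem extInv_mul_self : extInv ψ hψ * extInv ψ hψ = 1 := by
  ext <;> simp [extInv]

theorem extBase_mul_mem (g h : A ⋊[involutionHom ψ hψ] ℤˣ) (hg : g ∉ extBase ψ hψ)
    (hh : h ∉ extBase ψ hψ) : g * h ∈ extBase ψ hψ := by
  rw [mem_extBase] at *
  rw [SemidirectProduct.mul_right, (Int.units_eq_one_or g.right).resolve_left hg,
    (Int.units_eq_one_or h.right).resolve_left hh]
  rfl

theorem left_mul_of_mem {g h : A ⋊[involutionHom ψ hψ] ℤˣ} (hg : g ∈ extBase ψ hψ) :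
    (g * h).left = g.left * h.left := by
  rw [mem_extBase] at hg
  simp [SemidirectProduct.mul_left, hg]

theorem eq_inl_of_mem {g : A ⋊[involutionHom ψ hψ] ℤˣ} (hg : g ∈ extBase ψ hψ) :
    g = SemidirectProduct.inl g.left := by
  ext
  · simp
  · rw [SemidirectProduct.right_inl, mem_extBase.mp hg]

theorem extInv_conj_inl (a : A) : extInv ψ hψ * SemidirectProduct.inl a * extInv ψ hψ =
    SemidirectProduct.inl (ψ a) := by
  ext
  · simp [extInv, SemidirectProduct.mul_left, involutionHom_neg_one]
  · simp [extInv]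

/-- The extension of an invariant subgroup. -/
def extSubgroup (H : Subgroup A) (hH : ∀ a ∈ H, ψ a ∈ H) :
    Subgroup (A ⋊[involutionHom ψ hψ] ℤˣ) where
  carrier := {g | g.left ∈ H}
  one_mem' := one_mem H
  mul_mem' {a b} ha hb := by
    simp only [Set.mem_ofPred_eq, SemidirectProduct.mul_left] at *
    refine mul_mem ha ?_
    rcases Int.units_eq_one_or a.right with h | h
    · simpa [h] using hb
    · simpa [h, involutionHom_neg_one] using hH _ hb
  inv_mem' {a} ha := by
    simp only [Set.mem_ofPred_eq, SemidirectProduct.inv_left] at *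
    rcases Int.units_eq_one_or a.right with h | h
    · simpa [h] using ha
    · simpa [h, involutionHom_neg_one] using hH _ ha

theorem mem_extSubgroup {H : Subgroup A} {hH : ∀ a ∈ H, ψ a ∈ H}
    {g : A ⋊[involutionHom ψ hψ] ℤˣ} : g ∈ extSubgroup H hH ↔ g.left ∈ H := Iff.rfl

theorem extSubgroup_inf_extBase (H : Subgroup A) (hH : ∀ a ∈ H, ψ a ∈ H) :
    extSubgroup H hH ⊓ extBase ψ hψ = H.map SemidirectProduct.inl := by
  ext g
  constructor
  · rintro ⟨h1, h2⟩
    exact ⟨g.left, h1, (eq_inl_of_mem h2).symm⟩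
  · rintro ⟨a, ha, rfl⟩
    exact ⟨by simpa [mem_extSubgroup] using ha, by simp [mem_extBase]⟩

/-- The set `S` is a basis of the invariant subgroup `H` adapted to the involution `ψ`. -/
def IsAdaptedTo (ψ : MulAut A) (hψ : ψ * ψ = 1) (S : Set A) (H : Subgroup A)
    (hH : ∀ a ∈ H, ψ a ∈ H) : Prop :=
  IsAdapted (extBase ψ hψ) (extInv ψ hψ) (SemidirectProduct.inl '' S)
    (extSubgroup (hψ := hψ) H hH)

theorem IsAdaptedTo.freeOn {S : Set A} {H : Subgroup A} {hH : ∀ a ∈ H, ψ a ∈ H}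
    (h : IsAdaptedTo ψ hψ S H hH) : FreeOn S := by
  have h1 := FreeOn.injective_comp h.free (f := fun s : S => SemidirectProduct.inl (s : A))
    (fun a b hab => Subtype.ext (SemidirectProduct.inl_injective hab)) fun s => ⟨s, s.2, rfl⟩
  refine Function.Injective.of_comp
    (f := (SemidirectProduct.inl : A →* A ⋊[involutionHom ψ hψ] ℤˣ)) ?_
  convert h1 using 1
  rw [← MonoidHom.coe_comp]
  congr 1
  ext s
  · rw [MonoidHom.comp_apply, FreeGroup.lift_apply_of, FreeGroup.lift_apply_of]
  · rw [MonoidHom.comp_apply, FreeGroup.lift_apply_of, FreeGroup.lift_apply_of]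

theorem IsAdaptedTo.closure_eq {S : Set A} {H : Subgroup A} {hH : ∀ a ∈ H, ψ a ∈ H}
    (h : IsAdaptedTo ψ hψ S H hH) : Subgroup.closure S = H := by
  have h1 := IsAdapted.closure_eq h
  rw [extSubgroup_inf_extBase, ← MonoidHom.map_closure] at h1
  exact Subgroup.map_injective SemidirectProduct.inl_injective h1

theorem exists_eq_inl_image {S : Set (A ⋊[involutionHom ψ hψ] ℤˣ)} (hS : S ⊆ extBase ψ hψ) :
    ∃ S' : Set A, S = SemidirectProduct.inl '' S' := by
  refine ⟨SemidirectProduct.left '' S, ?_⟩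
  rw [Set.image_image]
  ext g
  constructor
  · exact fun hg => ⟨g, hg, (eq_inl_of_mem (hS hg)).symm⟩
  · rintro ⟨x, hx, rfl⟩
    exact (eq_inl_of_mem (hS hx)) ▸ hx

theorem IsAdaptedTo.exists_extension {S₀ : Set A} {H₀ H : Subgroup A} {hH₀ : ∀ a ∈ H₀, ψ a ∈ H₀}
    (hH : ∀ a ∈ H, ψ a ∈ H) (hle : H₀ ≤ H) {C : Type*} {j : A →* FreeGroup C}
    (hj : Function.Injective j) {C₁ : Set C}
    (hL : ∀ f ∈ H, f ∈ H₀ ↔ j f ∈ Subgroup.closure (FreeGroup.of '' C₁))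
    {S : Set A} (hS : S.Finite) (hgen : H = Subgroup.closure (H₀ ∪ S))
    (h : IsAdaptedTo ψ hψ S₀ H₀ hH₀) : ∃ S', S₀ ⊆ S' ∧ IsAdaptedTo ψ hψ S' H hH := by
  obtain ⟨S', hS', hA⟩ := IsAdapted.exists_extension (F := extBase ψ hψ)
    (τ := extInv ψ hψ) extBase_mul_mem extInv_notMem extInv_mul_self
    (H₀ := extSubgroup (hψ := hψ) H₀ hH₀) (H := extSubgroup (hψ := hψ) H hH)
    (fun g hg => hle hg) (j := fun g => j g.left) (C₁ := C₁)
    (fun f hf g _ => by rw [left_mul_of_mem hf, _root_.map_mul])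
    (fun f hf h1 => by
      rw [eq_inl_of_mem hf, (map_eq_one_iff j hj).mp h1, _root_.map_one])
    (fun f hf => hL f.left hf.1) (hS.image SemidirectProduct.inl)
    (by
      rw [extSubgroup_inf_extBase, extSubgroup_inf_extBase, hgen, MonoidHom.map_closure,
        Set.image_union]
      rfl) h
  have hS'F : S' ⊆ extBase ψ hψ := by
    intro s hs
    have := Subgroup.subset_closure (G := A ⋊[involutionHom ψ hψ] ℤˣ) hs
    rw [hA.closure_eq] at this
    exact this.2
  obtain ⟨S'', rfl⟩ := exists_eq_inl_image hS'F
  exact ⟨S'', (Set.image_subset_image_iff SemidirectProduct.inl_injective).mp hS', hA⟩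

/-- What an adapted basis looks like inside the base group. -/
theorem IsAdaptedTo.elt {S : Set A} {H : Subgroup A} {hH : ∀ a ∈ H, ψ a ∈ H}
    (h : IsAdaptedTo ψ hψ S H hH) {s : A} (hs : s ∈ S) :
    ψ s = s⁻¹ ∨ (∃ a ∈ insert 1 S, ∃ b ∈ insert 1 S, ψ a = a⁻¹ ∧ ψ b = b⁻¹ ∧
      ψ s = b * s * a⁻¹) ∨ ψ s ∈ S := by
  have hinj := SemidirectProduct.inl_injective (φ := involutionHom ψ hψ)
  have hins : ∀ g ∈ insert 1 (SemidirectProduct.inl '' S : Set (A ⋊[involutionHom ψ hψ] ℤˣ)),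
      ∃ a ∈ insert 1 S, g = SemidirectProduct.inl a := by
    rintro g (rfl | ⟨a, ha, rfl⟩)
    exacts [⟨1, Or.inl rfl, (_root_.map_one _).symm⟩, ⟨a, Or.inr ha, rfl⟩]
  rcases IsAdapted.elt h _ ⟨s, hs, rfl⟩ with h1 | ⟨a, ha, b, hb, h1, h2, h3⟩ | h1
  · left
    rw [extInv_conj_inl, ← _root_.map_inv] at h1
    exact hinj h1
  · right; left
    obtain ⟨a, ha', rfl⟩ := hins a ha
    obtain ⟨b, hb', rfl⟩ := hins b hb
    rw [extInv_conj_inl, ← _root_.map_inv] at h1 h2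
    rw [extInv_conj_inl, ← _root_.map_inv, ← _root_.map_mul, ← _root_.map_mul] at h3
    exact ⟨a, ha', b, hb', hinj h1, hinj h2, hinj h3⟩
  · right; right
    rw [extInv_conj_inl] at h1
    obtain ⟨y, hy, h1⟩ := h1
    exact hinj h1 ▸ hy

/-- With respect to the trivial automorphism every basis is adapted. -/
theorem isAdaptedTo_one (htf : ∀ a : A, a * a = 1 → a = 1) {S : Set A} (hS : FreeOn S) :
    IsAdaptedTo (1 : MulAut A) (one_mul 1) S (Subgroup.closure S)
      (fun a h => by simpa using h) := by
  have hcomm : ∀ g, extInv (1 : MulAut A) (one_mul 1) * g * extInv (1 : MulAut A) (one_mul 1) = g := by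
    intro g
    have h1 : involutionHom (1 : MulAut A) (one_mul 1) = 1 := by
      ext u a
      simp [involutionHom]
    ext
    · simp [extInv, SemidirectProduct.mul_left, h1]
    · simp [extInv, mul_comm]
  refine ⟨mem_extSubgroup.mpr (one_mem _), hS.image SemidirectProduct.inl_injective, ?_, ?_, ?_⟩
  · rw [extSubgroup_inf_extBase, MonoidHom.map_closure]
  · rintro - ⟨s, hs, rfl⟩
    refine Or.inr (Or.inl ⟨1, Or.inl rfl, 1, Or.inl rfl, ?_, ?_, ?_⟩)
    · rw [hcomm, inv_one]
    · rw [hcomm, inv_one]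
    · rw [hcomm, inv_one, one_mul, mul_one]
  · intro ρ _ hρF hρ
    have hmem := extBase_mul_mem _ _ extInv_notMem hρF
    have h3 : (extInv (1 : MulAut A) (one_mul 1) * ρ).left = 1 := by
      apply htf
      rw [← left_mul_of_mem hmem, ← mul_assoc, hcomm, hρ]
      rfl
    have h1 : extInv (1 : MulAut A) (one_mul 1) * ρ = 1 := by
      rw [eq_inl_of_mem hmem, h3, _root_.map_one]
    have h2 : ρ = extInv 1 (one_mul 1) := by
      rw [← inv_eq_of_mul_eq_one_right h1, inv_eq_of_mul_eq_one_right extInv_mul_self]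
    exact ⟨1, one_mem _, 1, Or.inl rfl, by rw [hcomm, inv_one], by simp [h2]⟩

end TwoExtension

section FreeFactors

variable {X : Type u}

/-- A subgroup of a free group generated by a part of a basis. -/
def IsFreeFactor (H : Subgroup (FreeGroup X)) : Prop :=
  ∃ (C : Type u) (j : FreeGroup X ≃* FreeGroup C) (C₁ : Set C),
    ∀ f, f ∈ H ↔ j f ∈ Subgroup.closure (FreeGroup.of '' C₁)

theorem isFreeFactor_closure_of (Z : Set X) :
    IsFreeFactor (Subgroup.closure (FreeGroup.of '' Z)) :=
  ⟨X, MulEquiv.refl _, Z, fun _ => Iff.rfl⟩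

theorem IsFreeFactor.exists_retraction {H : Subgroup (FreeGroup X)} (h : IsFreeFactor H) :
    ∃ r : FreeGroup X →* FreeGroup X, (∀ f, r f ∈ H) ∧ ∀ f ∈ H, r f = f := by
  classical
  obtain ⟨C, j, C₁, hj⟩ := h
  let p : FreeGroup C →* FreeGroup C :=
    FreeGroup.lift fun c => if c ∈ C₁ then FreeGroup.of c else 1
  have hp : ∀ f, p f ∈ Subgroup.closure (FreeGroup.of '' C₁) := by
    intro f
    have h1 : p.range ≤ Subgroup.closure (FreeGroup.of '' C₁) := by
      rw [FreeGroup.range_lift_eq_closure, Subgroup.closure_le]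
      rintro - ⟨c, rfl⟩
      dsimp only
      split_ifs with hc
      exacts [Subgroup.subset_closure ⟨c, hc, rfl⟩, one_mem _]
    exact h1 ⟨f, rfl⟩
  have hp' : Set.EqOn p (MonoidHom.id _) (Subgroup.closure (FreeGroup.of '' C₁)) := by
    apply MonoidHom.eqOn_closure
    rintro - ⟨c, hc, rfl⟩
    simp [p, hc]
  refine ⟨j.symm.toMonoidHom.comp (p.comp j.toMonoidHom), fun f => ?_, fun f hf => ?_⟩
  · rw [hj]
    simpa using hp (j f)
  · have := hp' ((hj f).mp hf)
    simp only [MonoidHom.id_apply] at this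
    simp [this]

theorem exists_freeOn_closure_eq (H : Subgroup (FreeGroup X)) :
    ∃ S, FreeOn S ∧ Subgroup.closure S = H := by
  let m : FreeGroup (IsFreeGroup.Generators H) →* FreeGroup X :=
    H.subtype.comp (IsFreeGroup.mulEquiv H).toMonoidHom
  have hm : Function.Injective m :=
    H.subtype_injective.comp (IsFreeGroup.mulEquiv H).injective
  have hm' : m = FreeGroup.lift (fun x => m (FreeGroup.of x)) := by
    ext
    simp
  refine ⟨Set.range fun x => m (FreeGroup.of x), FreeOn.range (hm' ▸ hm), ?_⟩
  rw [← FreeGroup.range_lift_eq_closure, ← hm']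
  simp only [m, MonoidHom.range_comp]
  rw [MonoidHom.range_eq_top.mpr (IsFreeGroup.mulEquiv H).surjective, ← MonoidHom.range_eq_map,
    Subgroup.range_subtype]

/-- A basis of the subgroup generated by a part of the free generators extends to a basis of the
whole group by the remaining free generators. -/
theorem FreeOn.bijective_lift_sum {S : Set (FreeGroup X)} (hS : FreeOn S) {X₁ : Set X}
    (hS' : Subgroup.closure S = Subgroup.closure (FreeGroup.of '' X₁)) :
    Function.Bijective (FreeGroup.lift
      (Sum.elim (fun s : S => (s : FreeGroup X)) fun x : (X₁ᶜ : Set X) => FreeGroup.of (x : X))) := by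
  classical
  set Λ := FreeGroup.lift
      (Sum.elim (fun s : S => (s : FreeGroup X)) fun x : (X₁ᶜ : Set X) => FreeGroup.of (x : X))
  have hv : ∀ x : X, ∃ v : FreeGroup S, x ∈ X₁ →
      FreeGroup.lift (fun s : S => (s : FreeGroup X)) v = FreeGroup.of x := by
    intro x
    by_cases hx : x ∈ X₁
    · have h1 : FreeGroup.of x ∈ Subgroup.closure S := hS' ▸ Subgroup.subset_closure ⟨x, hx, rfl⟩
      rw [← range_lift_coe] at h1
      obtain ⟨v, hv⟩ := h1
      exact ⟨v, fun _ => hv⟩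
    · exact ⟨1, fun h => absurd h hx⟩
  choose v hv using hv
  let e : FreeGroup X →* FreeGroup (S ⊕ (X₁ᶜ : Set X)) := FreeGroup.lift fun x =>
    if h : x ∈ X₁ then FreeGroup.map Sum.inl (v x) else FreeGroup.of (Sum.inr ⟨x, h⟩)
  have he : ∀ g ∈ Subgroup.closure (FreeGroup.of '' X₁), ∃ w : FreeGroup S,
      FreeGroup.lift (fun s : S => (s : FreeGroup X)) w = g ∧ e g = FreeGroup.map Sum.inl w := by
    intro g hg
    induction hg using Subgroup.closure_induction with
    | mem g hg =>
      obtain ⟨x, hx, rfl⟩ := hg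
      exact ⟨v x, hv x hx, by simp [e, hx]⟩
    | one => exact ⟨1, by simp, by simp⟩
    | mul a b _ _ ha hb =>
      obtain ⟨w₁, h₁, h₁'⟩ := ha
      obtain ⟨w₂, h₂, h₂'⟩ := hb
      exact ⟨w₁ * w₂, by rw [_root_.map_mul, h₁, h₂], by rw [_root_.map_mul, h₁', h₂', _root_.map_mul]⟩
    | inv a _ ha =>
      obtain ⟨w₁, h₁, h₁'⟩ := ha
      exact ⟨w₁⁻¹, by rw [_root_.map_inv, h₁], by rw [_root_.map_inv, h₁', _root_.map_inv]⟩
  have heΛ : e.comp Λ = MonoidHom.id _ := by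
    apply FreeGroup.ext_hom
    rintro (s | x)
    · rw [MonoidHom.comp_apply, FreeGroup.lift_apply_of, MonoidHom.id_apply, Sum.elim_inl]
      obtain ⟨w, hw, hw'⟩ := he s (hS' ▸ Subgroup.subset_closure s.2)
      rw [hw']
      have : w = FreeGroup.of s := hS (by rw [hw, FreeGroup.lift_apply_of])
      rw [this, FreeGroup.map.of]
    · rw [MonoidHom.comp_apply, FreeGroup.lift_apply_of, MonoidHom.id_apply, Sum.elim_inr]
      rw [FreeGroup.lift_apply_of, dif_neg x.2]
  refine ⟨Function.LeftInverse.injective (g := e) fun w => DFunLike.congr_fun heΛ w, ?_⟩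
  rw [← MonoidHom.range_eq_top, FreeGroup.range_lift_eq_closure, Set.Sum.elim_range,
    Subtype.range_coe, Subgroup.closure_union, hS', ← Subgroup.closure_union, eq_top_iff,
    ← FreeGroup.closure_range_of, Subgroup.closure_le]
  rintro - ⟨x, rfl⟩
  by_cases hx : x ∈ X₁
  · exact Subgroup.subset_closure (Or.inl ⟨x, hx, rfl⟩)
  · exact Subgroup.subset_closure (Or.inr ⟨⟨x, hx⟩, rfl⟩)

theorem FreeOn.isFreeFactor {S₀ S : Set (FreeGroup X)} (hS : FreeOn S) {X₁ : Set X}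
    (hS' : Subgroup.closure S = Subgroup.closure (FreeGroup.of '' X₁)) (h : S₀ ⊆ S) :
    IsFreeFactor (Subgroup.closure S₀) := by
  let Λ := MulEquiv.ofBijective _ (hS.bijective_lift_sum hS')
  have hΛ : ∀ s : S, Λ (FreeGroup.of (Sum.inl s)) = s := fun s => by
    rw [MulEquiv.ofBijective_apply, FreeGroup.lift_apply_of, Sum.elim_inl]
  refine ⟨S ⊕ (X₁ᶜ : Set X), Λ.symm, Sum.inl '' {s | (s : FreeGroup X) ∈ S₀}, fun f => ?_⟩
  have h1 : Subgroup.closure S₀ =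
      (Subgroup.closure (FreeGroup.of '' (Sum.inl '' {s : S | (s : FreeGroup X) ∈ S₀}))).map
        Λ.toMonoidHom := by
    rw [MonoidHom.map_closure, Set.image_image, Set.image_image]
    congr 1
    ext g
    constructor
    · intro hg
      exact ⟨⟨g, h hg⟩, hg, hΛ _⟩
    · rintro ⟨s, hs, rfl⟩
      exact Set.mem_of_eq_of_mem (hΛ s) hs
  rw [h1]
  exact Subgroup.mem_map_equiv

theorem FreeGroup.eq_one_of_mul_self_eq_one {g : FreeGroup X} (h : g * g = 1) : g = 1 :=
  (pow_eq_one_iff_left two_ne_zero).mp ((pow_two g).trans h)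

/-- If a standard free factor `K` is finitely generated over its intersection with its image under
an automorphism, then this intersection is a free factor. -/
theorem isFreeFactor_inf_map {X₁ : Set X} (φ : MulAut (FreeGroup X)) {K : Subgroup (FreeGroup X)}
    (hK : K = Subgroup.closure (FreeGroup.of '' X₁)) {S : Set (FreeGroup X)} (hS : S.Finite)
    (hgen : K = Subgroup.closure (↑(K ⊓ K.map φ.toMonoidHom) ∪ S)) :
    IsFreeFactor (K ⊓ K.map φ.toMonoidHom) := by
  obtain ⟨S₀, hS₀, hS₀'⟩ := exists_freeOn_closure_eq (K ⊓ K.map φ.toMonoidHom)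
  have hS₀A := isAdaptedTo_one (fun a => FreeGroup.eq_one_of_mul_self_eq_one) hS₀
  obtain ⟨S', hS', hA⟩ := hS₀A.exists_extension (H := K) (fun a h => by simpa using h)
    (hS₀'.trans_le inf_le_left) (j := φ.symm.toMonoidHom) φ.symm.injective (C₁ := X₁)
    (fun f hf => by
      rw [hS₀', Subgroup.mem_inf, and_iff_right hf, Subgroup.mem_map_equiv, hK]
      rfl) hS (by rw [hS₀']; exact hgen)
  rw [← hS₀']
  exact hA.freeOn.isFreeFactor (hA.closure_eq.trans hK) hS'

end FreeFactors

section AdaptedUnion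

variable {A : Type u} [Group A] {ψ : MulAut A} {hψ : ψ * ψ = 1}

theorem IsAdaptedTo.iUnion {ι : Type*} [Nonempty ι] {S : ι → Set A} {H : ι → Subgroup A}
    {hinv : ∀ i, ∀ a ∈ H i, ψ a ∈ H i}
    (hdir : ∀ i k, ∃ l, S i ⊆ S l ∧ S k ⊆ S l ∧ H i ≤ H l ∧ H k ≤ H l)
    (h : ∀ i, IsAdaptedTo ψ hψ (S i) (H i) (hinv i)) {L : Subgroup A}
    (hL : ∀ a, a ∈ L ↔ ∃ i, a ∈ H i) (hLinv : ∀ a ∈ L, ψ a ∈ L) :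
    IsAdaptedTo ψ hψ (⋃ i, S i) L hLinv := by
  have hdir' : ∀ i k, ∃ l, (SemidirectProduct.inl '' S i : Set (A ⋊[involutionHom ψ hψ] ℤˣ)) ⊆
      SemidirectProduct.inl '' S l ∧
      (SemidirectProduct.inl '' S k : Set (A ⋊[involutionHom ψ hψ] ℤˣ)) ⊆
        SemidirectProduct.inl '' S l ∧
      extSubgroup (hψ := hψ) (H i) (hinv i) ≤ extSubgroup (H l) (hinv l) ∧
      extSubgroup (hψ := hψ) (H k) (hinv k) ≤ extSubgroup (H l) (hinv l) := by
    intro i k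
    obtain ⟨l, h1, h2, h3, h4⟩ := hdir i k
    exact ⟨l, Set.image_mono h1, Set.image_mono h2, fun g hg => h3 hg, fun g hg => h4 hg⟩
  have h1 := IsAdapted.iSup_of_directed hdir' h
  have h2 : ⨆ i, extSubgroup (hψ := hψ) (H i) (hinv i) = extSubgroup L hLinv := by
    ext g
    rw [Subgroup.mem_iSup_of_directed (fun i k => (hdir' i k).imp fun l hl => hl.2.2),
      mem_extSubgroup, hL]
    rfl
  rw [h2, ← Set.image_iUnion] at h1
  exact h1

end AdaptedUnion

section AdaptedBasis

variable {X : Type u} {ψ : MulAut (FreeGroup X)}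

/-- The subgroup generated by a set of free generators. -/
def FreeGroup.span (Z : Set X) : Subgroup (FreeGroup X) := Subgroup.closure (FreeGroup.of '' Z)

theorem FreeGroup.span_mono {Z Z' : Set X} (h : Z ⊆ Z') : span Z ≤ span Z' :=
  Subgroup.closure_mono (Set.image_mono h)

theorem FreeGroup.span_union (Z Z' : Set X) : span (Z ∪ Z') = span Z ⊔ span Z' := by
  rw [span, Set.image_union, Subgroup.closure_union]
  rfl

theorem FreeGroup.of_mem_span {Z : Set X} {x : X} (h : x ∈ Z) : of x ∈ span Z :=
  Subgroup.subset_closure ⟨x, h, rfl⟩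

theorem FreeGroup.mem_span_iUnion_of_directed {ι : Type*} [Nonempty ι] {Z : ι → Set X}
    (hdir : Directed (· ⊆ ·) Z) {g : FreeGroup X} :
    g ∈ span (⋃ i, Z i) ↔ ∃ i, g ∈ span (Z i) := by
  rw [span, Set.image_iUnion, Subgroup.closure_iUnion, Subgroup.mem_iSup_of_directed]
  · rfl
  · exact fun i k => (hdir i k).imp fun l hl => ⟨span_mono hl.1, span_mono hl.2⟩

theorem mem_inf_map_of_involution (hψ : ψ * ψ = 1) (K : Subgroup (FreeGroup X)) :
    ∀ a ∈ K ⊓ K.map ψ.toMonoidHom, ψ a ∈ K ⊓ K.map ψ.toMonoidHom := by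
  rintro - ⟨h1, a, ha, rfl⟩
  have h2 : ψ (ψ a) = a := DFunLike.congr_fun hψ a
  exact ⟨by simpa [h2] using ha, ⟨ψ a, h1, rfl⟩⟩

theorem isFreeFactor_span_inf_map {Z W : Set X} (hW : W.Finite) {K : Subgroup (FreeGroup X)}
    (hK : K = FreeGroup.span (Z ∪ W))
    (hZ : FreeGroup.span Z ≤ K ⊓ K.map ψ.toMonoidHom) :
    IsFreeFactor (K ⊓ K.map ψ.toMonoidHom) := by
  refine isFreeFactor_inf_map ψ hK (hW.image FreeGroup.of) (le_antisymm ?_ ?_)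
  · conv_lhs => rw [hK]
    rw [FreeGroup.span_union, Subgroup.closure_union, Subgroup.closure_eq]
    exact sup_le_sup_right hZ _
  · rw [Subgroup.closure_le]
    refine Set.union_subset inf_le_left ?_
    rintro - ⟨w, hw, rfl⟩
    rw [hK]
    exact FreeGroup.of_mem_span (Or.inr hw)

theorem IsAdaptedTo.exists_extension_inf_map {hψ : ψ * ψ = 1} {Z W : Set X} (hW : W.Finite)
    {K : Subgroup (FreeGroup X)} (hK : K = FreeGroup.span (Z ∪ W))
    {H₀ : Subgroup (FreeGroup X)} {S₀ : Set (FreeGroup X)} (hZ : FreeGroup.span Z ≤ H₀)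
    (hfac : IsFreeFactor H₀) {hinv : ∀ a ∈ H₀, ψ a ∈ H₀} (hle : H₀ ≤ K ⊓ K.map ψ.toMonoidHom)
    (h : IsAdaptedTo ψ hψ S₀ H₀ hinv) : ∃ S, S₀ ⊆ S ∧
      IsAdaptedTo ψ hψ S (K ⊓ K.map ψ.toMonoidHom) (mem_inf_map_of_involution hψ K) := by
  obtain ⟨C, j, C₁, hj⟩ := hfac
  obtain ⟨r, hr, hr'⟩ :=
    (isFreeFactor_span_inf_map hW hK (hZ.trans hle)).exists_retraction
  refine h.exists_extension _ hle (j := j.toMonoidHom) j.injective (fun f _ => hj f)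
    ((hW.image FreeGroup.of).image r) (le_antisymm ?_ ?_)
  · intro g hg
    have h1 : g ∈ K.map r := ⟨g, hg.1, hr' g hg⟩
    rw [hK, FreeGroup.span, MonoidHom.map_closure, Set.image_union, Set.image_union] at h1
    refine Subgroup.closure_mono (Set.union_subset_union_left _ ?_) h1
    rintro - ⟨-, ⟨z, hz, rfl⟩, rfl⟩
    have := FreeGroup.of_mem_span hz
    rw [hr' _ (hle (hZ this))]
    exact hZ this
  · rw [Subgroup.closure_le]
    refine Set.union_subset hle ?_
    rintro - ⟨w, -, rfl⟩
    exact hr w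

/-- A finite set of free generators, enlarged step by step by the letters occurring in the images
of its elements. -/
noncomputable def letterHull [DecidableEq X] (ψ : MulAut (FreeGroup X)) (x : X) : ℕ → Finset X
  | 0 => {x}
  | n + 1 => letterHull ψ x n ∪ (letterHull ψ x n).biUnion fun a =>
      ((ψ (FreeGroup.of a)).toWord.map Prod.fst).toFinset

theorem monotone_letterHull [DecidableEq X] (ψ : MulAut (FreeGroup X)) (x : X) :
    Monotone (letterHull ψ x) :=
  monotone_nat_of_le_succ fun _ => Finset.subset_union_left

theorem map_mem_span_letterHull [DecidableEq X] {Z : Set X} {x : X}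
    (hZ : ∀ a ∈ FreeGroup.span Z, ψ a ∈ FreeGroup.span Z) (n : ℕ) {g : FreeGroup X}
    (hg : g ∈ FreeGroup.span (Z ∪ letterHull ψ x n)) :
    ψ g ∈ FreeGroup.span (Z ∪ letterHull ψ x (n + 1)) := by
  have h : FreeGroup.span (Z ∪ letterHull ψ x n) ≤
      (FreeGroup.span (Z ∪ letterHull ψ x (n + 1))).comap ψ.toMonoidHom := by
    rw [FreeGroup.span, Subgroup.closure_le]
    rintro - ⟨a, ha | ha, rfl⟩
    · exact FreeGroup.span_mono Set.subset_union_left (hZ _ (FreeGroup.of_mem_span ha))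
    · refine (FreeGroup.mem_closure_of_image_iff).mpr fun p hp => Or.inr ?_
      refine Finset.mem_union_right _ (Finset.mem_biUnion.mpr ⟨a, ha, ?_⟩)
      exact List.mem_toFinset.mpr (List.mem_map_of_mem hp)
  exact h hg

theorem IsAdaptedTo.exists_extension_insert {hψ : ψ * ψ = 1} {Z : Set X} {S : Set (FreeGroup X)}
    {hZ : ∀ a ∈ FreeGroup.span Z, ψ a ∈ FreeGroup.span Z}
    (h : IsAdaptedTo ψ hψ S (FreeGroup.span Z) hZ) (x : X) :
    ∃ Z' S', Z ⊆ Z' ∧ x ∈ Z' ∧ S ⊆ S' ∧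
      ∃ hZ', IsAdaptedTo ψ hψ S' (FreeGroup.span Z') hZ' := by
  classical
  let K : ℕ → Subgroup (FreeGroup X) := fun n => FreeGroup.span (Z ∪ letterHull ψ x n)
  let H : ℕ → Subgroup (FreeGroup X) := fun n => K n ⊓ (K n).map ψ.toMonoidHom
  have hinv : ∀ n, ∀ a ∈ H n, ψ a ∈ H n := fun n => mem_inf_map_of_involution hψ _
  have hψψ : ∀ a, ψ (ψ a) = a := DFunLike.congr_fun hψ
  have hKmono : Monotone K := fun m n hmn => FreeGroup.span_mono
    (Set.union_subset_union_right _ (Finset.coe_subset.mpr (monotone_letterHull ψ x hmn)))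
  have hKψ : ∀ n, ∀ g ∈ K n, ψ g ∈ K (n + 1) := fun n g hg => map_mem_span_letterHull hZ n hg
  have hHK : ∀ n, H n ≤ K n := fun n => inf_le_left
  have hKH : ∀ n, K n ≤ H (n + 1) := fun n g hg =>
    ⟨hKmono n.le_succ hg, ψ g, hKψ n g hg, hψψ g⟩
  have hHmono : Monotone H := monotone_nat_of_le_succ fun n => (hHK n).trans (hKH n)
  have hZK : ∀ n, FreeGroup.span Z ≤ K n := fun n => FreeGroup.span_mono Set.subset_union_left
  have hZH : ∀ n, FreeGroup.span Z ≤ H n := fun n g hg =>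
    ⟨hZK n hg, ψ g, hZK n (hZ g hg), hψψ g⟩
  obtain ⟨S₀, hS₀, hA₀⟩ := h.exists_extension_inf_map (letterHull ψ x 0).finite_toSet
    (K := K 0) rfl le_rfl (isFreeFactor_closure_of Z) (hZH 0)
  have hnext : ∀ n (T : {T // IsAdaptedTo ψ hψ T (H n) (hinv n)}),
      ∃ T' : {T // IsAdaptedTo ψ hψ T (H (n + 1)) (hinv (n + 1))}, T.1 ⊆ T'.1 := by
    rintro n ⟨T, hT⟩
    obtain ⟨T', h1, h2⟩ := hT.exists_extension_inf_map (letterHull ψ x (n + 1)).finite_toSet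
      (K := K (n + 1)) rfl (hZH n)
      (isFreeFactor_span_inf_map (letterHull ψ x n).finite_toSet rfl (hZH n))
      (hHmono n.le_succ)
    exact ⟨⟨T', h2⟩, h1⟩
  choose next hnext using hnext
  let T : ∀ n, {T // IsAdaptedTo ψ hψ T (H n) (hinv n)} := fun n => Nat.rec ⟨S₀, hA₀⟩ next n
  have hTmono : Monotone fun n => (T n).1 := monotone_nat_of_le_succ fun n => hnext n (T n)
  have hdir : Directed (· ⊆ ·) fun n => Z ∪ (letterHull ψ x n : Set X) :=
    (monotone_nat_of_le_succ fun n => Set.union_subset_union_right _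
      (Finset.coe_subset.mpr (monotone_letterHull ψ x n.le_succ))).directed_le
  have hmem : ∀ g, g ∈ FreeGroup.span (⋃ n, Z ∪ (letterHull ψ x n : Set X)) ↔ ∃ n, g ∈ H n := by
    intro g
    rw [FreeGroup.mem_span_iUnion_of_directed hdir]
    exact ⟨fun ⟨n, hn⟩ => ⟨n + 1, hKH n hn⟩, fun ⟨n, hn⟩ => ⟨n, hHK n hn⟩⟩
  refine ⟨⋃ n, Z ∪ (letterHull ψ x n : Set X), ⋃ n, (T n).1, ?_, ?_, ?_, ?_, ?_⟩
  · exact Set.subset_iUnion_of_subset 0 Set.subset_union_left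
  · exact Set.mem_iUnion.mpr ⟨0, Or.inr (Finset.mem_singleton_self x)⟩
  · exact Set.subset_iUnion_of_subset 0 hS₀
  · intro a ha
    obtain ⟨n, hn⟩ := (hmem a).mp ha
    exact (hmem _).mpr ⟨n, hinv n a hn⟩
  · exact IsAdaptedTo.iUnion (fun i k => ⟨max i k, hTmono (le_max_left i k),
      hTmono (le_max_right i k), hHmono (le_max_left i k), hHmono (le_max_right i k)⟩)
      (fun n => (T n).2) hmem _

theorem isAdaptedTo_empty (hψ : ψ * ψ = 1) : ∃ hZ,
    IsAdaptedTo ψ hψ ∅ (FreeGroup.span ∅) hZ := by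
  have hbot : FreeGroup.span (∅ : Set X) = ⊥ := by simp [FreeGroup.span]
  rw [hbot]
  refine ⟨fun a ha => by simpa using ha, mem_extSubgroup.mpr (one_mem _), ?_, ?_, ?_, ?_⟩
  · rw [Set.image_empty]
    exact Function.injective_of_subsingleton _
  · rw [extSubgroup_inf_extBase, Set.image_empty, Subgroup.closure_empty, Subgroup.map_bot]
  · rintro - ⟨s, hs, rfl⟩
    exact hs.elim
  · intro ρ hρ hρF _
    refine ⟨1, one_mem _, 1, Or.inl rfl, by rw [mul_one, extInv_mul_self, inv_one], ?_⟩
    rw [mul_one, one_mul, inv_one, mul_one]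
    ext
    · rw [Subgroup.mem_bot.mp (mem_extSubgroup.mp hρ)]
      rfl
    · rw [(Int.units_eq_one_or ρ.right).resolve_left hρF]
      rfl

/-- Every involutory automorphism of a free group has an adapted basis. -/
theorem exists_adapted_basis (hψ : ψ * ψ = 1) : ∃ S : Set (FreeGroup X), FreeGroup.IsBasis S ∧
    ∀ s ∈ S, ψ s = s⁻¹ ∨ (∃ a ∈ insert 1 S, ∃ b ∈ insert 1 S, ψ a = a⁻¹ ∧ ψ b = b⁻¹ ∧
      ψ s = b * s * a⁻¹) ∨ ψ s ∈ S := by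
  obtain ⟨⟨Z, S⟩, hmax⟩ := zorn_le₀ {p : Set X × Set (FreeGroup X) |
      ∃ hZ, IsAdaptedTo ψ hψ p.2 (FreeGroup.span p.1) hZ} (by
    intro c hc hchain
    rcases c.eq_empty_or_nonempty with rfl | hne
    · exact ⟨(∅, ∅), isAdaptedTo_empty hψ, by simp⟩
    have : Nonempty c := hne.to_subtype
    have hdir : ∀ i k : c, ∃ l : c, i.1 ≤ l.1 ∧ k.1 ≤ l.1 := fun i k =>
      (hchain.total i.2 k.2).elim (fun h => ⟨k, h, le_rfl⟩) fun h => ⟨i, le_rfl, h⟩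
    choose hinv hA using fun i : c => hc i.2
    have hmem : ∀ g, g ∈ FreeGroup.span (⋃ i : c, i.1.1) ↔ ∃ i : c, g ∈ FreeGroup.span i.1.1 :=
      fun g => FreeGroup.mem_span_iUnion_of_directed
        fun i k => (hdir i k).imp fun l hl => ⟨hl.1.1, hl.2.1⟩
    have hLinv : ∀ g ∈ FreeGroup.span (⋃ i : c, i.1.1), ψ g ∈ FreeGroup.span (⋃ i : c, i.1.1) := by
      intro g hg
      obtain ⟨i, hi⟩ := (hmem g).mp hg
      exact (hmem _).mpr ⟨i, hinv i g hi⟩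
    refine ⟨(⋃ i : c, i.1.1, ⋃ i : c, i.1.2), ⟨hLinv, ?_⟩, fun p hp => ?_⟩
    · exact IsAdaptedTo.iUnion (fun i k => (hdir i k).imp fun l hl =>
        ⟨hl.1.2, hl.2.2, FreeGroup.span_mono hl.1.1, FreeGroup.span_mono hl.2.1⟩) hA hmem hLinv
    · exact ⟨Set.subset_iUnion (fun i : c => i.1.1) ⟨p, hp⟩,
        Set.subset_iUnion (fun i : c => i.1.2) ⟨p, hp⟩⟩)
  obtain ⟨hZ, hA⟩ := hmax.prop
  have hZuniv : Z = Set.univ := by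
    refine Set.eq_univ_of_forall fun x => ?_
    obtain ⟨Z', S', h1, h2, h3, h4⟩ := hA.exists_extension_insert x
    exact (hmax.le_of_ge (y := (Z', S')) h4 ⟨h1, h3⟩).1 h2
  refine ⟨S, ⟨hA.freeOn, ?_⟩, fun s hs => hA.elt hs⟩
  rw [← MonoidHom.range_eq_top, range_lift_coe, hA.closure_eq, FreeGroup.span]
  subst hZuniv
  rw [Set.image_univ, FreeGroup.closure_range_of]

end AdaptedBasis

section PairForm

variable {X : Type u}

/-- An outer automorphism of a free group induced by an automorphism `ψ` which, for a suitable
basis `e`, interchanges two basis elements up to conjugation by `t`, preserves the subgroup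
generated by the remaining basis elements, and whose square is conjugation by `t`. -/
def HasPairForm (f : OutAut (FreeGroup X)) : Prop :=
  ∃ (ι : Type u) (e : FreeGroup (Bool ⊕ ι) ≃* FreeGroup X) (ψ : MulAut (FreeGroup X))
    (t : FreeGroup ι), (t = 1 ∨ ∃ i, t = FreeGroup.of i) ∧ toOut ψ = f ∧
    ψ (e (FreeGroup.of (Sum.inl false))) = e (FreeGroup.of (Sum.inl true)) ∧
    (∀ i, ∃ w, ψ (e (FreeGroup.of (Sum.inr i))) = e (FreeGroup.map Sum.inr w)) ∧
    (∀ g, ψ (ψ g) = e (FreeGroup.map Sum.inr t) * g * (e (FreeGroup.map Sum.inr t))⁻¹) ∧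
    ψ (e (FreeGroup.map Sum.inr t)) = e (FreeGroup.map Sum.inr t)

theorem HasPairForm.of_involution {ι : Type u} {ψ : MulAut (FreeGroup X)} (hψ : ψ * ψ = 1)
    {b : Bool ⊕ ι → FreeGroup X} (hb : Function.Bijective (FreeGroup.lift b))
    (h1 : ψ (b (Sum.inl false)) = b (Sum.inl true))
    (h2 : ∀ i, ψ (b (Sum.inr i)) ∈ Subgroup.closure (Set.range fun i => b (Sum.inr i))) :
    HasPairForm (toOut ψ) := by
  refine ⟨ι, MulEquiv.ofBijective _ hb, ψ, 1, Or.inl rfl, rfl, ?_, fun i => ?_, fun g => ?_, ?_⟩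
  · simpa using h1
  · have h3 := h2 i
    rw [← FreeGroup.range_lift_eq_closure] at h3
    obtain ⟨w, hw⟩ := h3
    refine ⟨w, ?_⟩
    have h4 : (FreeGroup.lift b).comp (FreeGroup.map Sum.inr) =
        FreeGroup.lift fun i => b (Sum.inr i) := by
      ext
      simp
    simp only [MulEquiv.ofBijective_apply, FreeGroup.lift_apply_of]
    rw [← hw, ← h4]
    rfl
  · simpa using DFunLike.congr_fun hψ g
  · simp

namespace FreeGroup

theorem IsBasis.ext {S : Set (FreeGroup X)} (hS : IsBasis S) {G : Type*} [Group G]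
    {f g : FreeGroup X →* G} (h : ∀ s ∈ S, f s = g s) : f = g := by
  refine MonoidHom.eq_of_eqOn_dense ?_ h
  rw [← range_lift_coe, MonoidHom.range_eq_top]
  exact hS.2

theorem IsBasis.exists_lift {S : Set (FreeGroup X)} (hS : IsBasis S) {G : Type*} [Group G]
    (m : S → G) : ∃ f : FreeGroup X →* G, ∀ s : S, f s = m s := by
  let B := MulEquiv.ofBijective _ hS
  refine ⟨(FreeGroup.lift m).comp B.symm.toMonoidHom, fun s => ?_⟩
  have h : B.symm s = of s := by
    rw [MulEquiv.symm_apply_eq]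
    exact lift_apply_of.symm
  change FreeGroup.lift m (B.symm s) = m s
  rw [h, lift_apply_of]

theorem IsBasis.inv_notMem {S : Set (FreeGroup X)} (hS : IsBasis S) {s : FreeGroup X}
    (hs : s ∈ S) : s⁻¹ ∉ S := by
  intro hs'
  obtain ⟨f, hf⟩ := hS.exists_lift fun _ : S => Multiplicative.ofAdd (1 : ℤ)
  have h1 := hf ⟨s⁻¹, hs'⟩
  rw [_root_.map_inv, hf ⟨s, hs⟩] at h1
  exact absurd h1 (by decide)

end FreeGroup

variable {ψ : MulAut (FreeGroup X)} {S : Set (FreeGroup X)}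

/-- The shape of the image of an element of an adapted basis. -/
def AdaptedImage (ψ : MulAut (FreeGroup X)) (S : Set (FreeGroup X)) (s : FreeGroup X) : Prop :=
  ψ s = s⁻¹ ∨ (∃ a ∈ insert 1 S, ∃ b ∈ insert 1 S, ψ a = a⁻¹ ∧ ψ b = b⁻¹ ∧
    ψ s = b * s * a⁻¹) ∨ ψ s ∈ S

theorem HasPairForm.of_swap (hψ : ψ * ψ = 1) (hS : FreeGroup.IsBasis S)
    (h : ∀ s ∈ S, AdaptedImage ψ S s) {s : FreeGroup X} (hs : s ∈ S) (hs' : ψ s ∈ S)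
    (hne : ψ s ≠ s) : HasPairForm (toOut ψ) := by
  have hψψ : ∀ a, ψ (ψ a) = a := DFunLike.congr_fun hψ
  let ι := {r // r ∈ S ∧ r ≠ s ∧ r ≠ ψ s}
  let b : Bool ⊕ ι → FreeGroup X := Sum.elim (fun c => bif c then ψ s else s) Subtype.val
  have hbS : ∀ c, b c ∈ S := by
    rintro ((_ | _) | r)
    exacts [hs, hs', r.2.1]
  have hb : Function.Injective b := by
    rintro ((_ | _) | r) ((_ | _) | r') hrr <;> simp only [b, Sum.elim_inl, Sum.elim_inr,
      cond_true, cond_false] at hrr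
    · rfl
    · exact absurd hrr.symm hne
    · exact absurd hrr.symm r'.2.2.1
    · exact absurd hrr hne
    · rfl
    · exact absurd hrr.symm r'.2.2.2
    · exact absurd hrr r.2.2.1
    · exact absurd hrr r.2.2.2
    · exact congrArg _ (Subtype.ext hrr)
  have hrest : Set.range (fun i : ι => b (Sum.inr i)) = {r | r ∈ S ∧ r ≠ s ∧ r ≠ ψ s} :=
    Subtype.range_coe
  refine HasPairForm.of_involution hψ (b := b) ⟨FreeOn.injective_comp hS.1 hb hbS, ?_⟩ rfl ?_
  · rw [← MonoidHom.range_eq_top, FreeGroup.range_lift_eq_closure, eq_top_iff,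
      ← MonoidHom.range_eq_top.mpr hS.2, range_lift_coe]
    refine Subgroup.closure_mono fun r hr => ?_
    by_cases h1 : r = s
    · exact ⟨Sum.inl false, h1.symm⟩
    by_cases h2 : r = ψ s
    · exact ⟨Sum.inl true, h2.symm⟩
    · exact ⟨Sum.inr ⟨r, hr, h1, h2⟩, rfl⟩
  · rw [hrest]
    have hins : ∀ a ∈ insert 1 S, ψ a = a⁻¹ →
        a ∈ Subgroup.closure {r | r ∈ S ∧ r ≠ s ∧ r ≠ ψ s} := by
      rintro a (rfl | ha) ha'
      · exact one_mem _
      · refine Subgroup.subset_closure ⟨ha, ?_, ?_⟩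
        · rintro rfl
          exact hS.inv_notMem ha (ha' ▸ hs')
        · rintro rfl
          rw [hψψ] at ha'
          exact hS.inv_notMem hs' (ha' ▸ hs)
    rintro ⟨r, hr, hr1, hr2⟩
    change ψ r ∈ _
    have hr' : r ∈ Subgroup.closure {r | r ∈ S ∧ r ≠ s ∧ r ≠ ψ s} :=
      Subgroup.subset_closure ⟨hr, hr1, hr2⟩
    rcases h r hr with h1 | ⟨a, ha, b, hb, h1, h2, h3⟩ | h1
    · rw [h1]
      exact inv_mem hr'
    · rw [h3]
      exact mul_mem (mul_mem (hins b hb h2) hr') (inv_mem (hins a ha h1))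
    · refine Subgroup.subset_closure ⟨h1, fun h2 => hr2 ?_, fun h2 => hr1 (ψ.injective h2)⟩
      rw [← h2, hψψ]

end PairForm

section SoftOrPair

variable {X : Type u} {ψ : MulAut (FreeGroup X)} {S : Set (FreeGroup X)}

theorem HasPairForm.of_ne (hψ : ψ * ψ = 1) (hS : FreeGroup.IsBasis S)
    {α β : FreeGroup X → FreeGroup X}
    (hα : ∀ s ∈ S, ψ s ≠ s⁻¹ → α s ∈ insert 1 {x ∈ S | ψ x = x⁻¹})
    (hβ : ∀ s ∈ S, ψ s ≠ s⁻¹ → β s ∈ insert 1 {x ∈ S | ψ x = x⁻¹})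
    (hαβ : ∀ s ∈ S, ψ s ≠ s⁻¹ → ψ s = β s * s * (α s)⁻¹)
    {y a b : FreeGroup X} (hy : y ∈ S) (hy' : ψ y ≠ y⁻¹) {ε : ℤ} (hε : ε * ε = 1) (ha : a ∈ S)
    (ha' : ψ a = a⁻¹) (hb : b ∈ insert 1 {x ∈ S | ψ x = x⁻¹}) (hab : b ≠ a)
    (hz : ψ (y ^ ε) = b * y ^ ε * a⁻¹) : HasPairForm (toOut ψ) := by
  classical
  have hψψ : ∀ a, ψ (ψ a) = a := DFunLike.congr_fun hψ
  set z := y ^ ε with hzdef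
  let ι := {r // r ∈ S ∧ r ≠ y ∧ r ≠ a}
  let g : FreeGroup X → FreeGroup X := fun r => if ψ r = r⁻¹ then r else
    (if β r = a then z else 1) * r * (if α r = a then z else 1)⁻¹
  let c : Bool ⊕ ι → FreeGroup X :=
    Sum.elim (fun i => bif i then ψ z else z) fun r => g r
  have hya : y ≠ a := fun h => hy' (h ▸ ha')
  have hins : ∀ x ∈ insert 1 {x ∈ S | ψ x = x⁻¹}, x ≠ a → x = 1 ∨ ∃ r : ι, r.1 = x ∧ g x = x := by
    rintro x (rfl | hx) hxa
    · exact Or.inl rfl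
    · exact Or.inr ⟨⟨x, hx.1, fun h => hy' (h ▸ hx.2), hxa⟩, rfl, if_pos hx.2⟩
  have hmem : ∀ x ∈ insert 1 {x ∈ S | ψ x = x⁻¹}, x ≠ a →
      x ∈ Subgroup.closure (Set.range fun i => c (Sum.inr i)) := by
    intro x hx hxa
    rcases hins x hx hxa with rfl | ⟨r, rfl, hr⟩
    exacts [one_mem _, Subgroup.subset_closure ⟨r, hr⟩]
  have hzero : (z ^ ε : FreeGroup X) = y := by rw [hzdef, ← zpow_mul, hε, zpow_one]
  refine HasPairForm.of_involution hψ (b := c) ⟨?_, ?_⟩ rfl ?_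
  · let Z : FreeGroup (Bool ⊕ ι) := FreeGroup.of (Sum.inl false)
    let Z' : FreeGroup (Bool ⊕ ι) := FreeGroup.of (Sum.inl true)
    obtain ⟨b', hb'⟩ : ∃ b' : FreeGroup (Bool ⊕ ι), ∀ M : FreeGroup X →* FreeGroup (Bool ⊕ ι),
        (∀ r : ι, ψ r = (r : FreeGroup X)⁻¹ → M r = FreeGroup.of (Sum.inr r)) → M b = b' := by
      rcases hb with rfl | hb
      · exact ⟨1, fun M _ => _root_.map_one M⟩
      · exact ⟨FreeGroup.of (Sum.inr ⟨b, hb.1, fun h => hy' (h ▸ hb.2), hab⟩),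
          fun M hM => hM ⟨b, _⟩ hb.2⟩
    obtain ⟨M, hM⟩ := hS.exists_lift fun s : S => if hsy : s.1 = y then Z ^ ε else
      if hsa : s.1 = a then Z'⁻¹ * b' * Z else
      if ψ s = (s : FreeGroup X)⁻¹ then FreeGroup.of (Sum.inr ⟨s, s.2, hsy, hsa⟩) else
      (if β s = a then Z else 1)⁻¹ * FreeGroup.of (Sum.inr ⟨s, s.2, hsy, hsa⟩) *
        (if α s = a then Z else 1)
    have hMz : M z = Z := by
      have h1 := hM ⟨y, hy⟩
      rw [dif_pos rfl] at h1
      rw [hzdef, _root_.map_zpow, h1, ← zpow_mul, hε, zpow_one]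
    have hMa : M a = Z'⁻¹ * b' * Z := by
      have h1 := hM ⟨a, ha⟩
      rwa [dif_neg hya.symm, dif_pos rfl] at h1
    have hMr : ∀ r : ι, ψ r = (r : FreeGroup X)⁻¹ → M r = FreeGroup.of (Sum.inr r) := by
      intro r hr
      have h1 := hM ⟨r, r.2.1⟩
      rwa [dif_neg r.2.2.1, dif_neg r.2.2.2, if_pos hr] at h1
    have hMr' : ∀ r : ι, ψ r ≠ (r : FreeGroup X)⁻¹ → M r = (if β r = a then Z else 1)⁻¹ *
        FreeGroup.of (Sum.inr r) * (if α r = a then Z else 1) := by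
      intro r hr
      have h1 := hM ⟨r, r.2.1⟩
      rwa [dif_neg r.2.2.1, dif_neg r.2.2.2, if_neg hr] at h1
    have hMite : ∀ p : Prop, ∀ [Decidable p], M (if p then z else 1) = if p then Z else 1 := by
      intro p _
      split_ifs
      exacts [hMz, _root_.map_one M]
    have hMc : M.comp (FreeGroup.lift c) = MonoidHom.id _ := by
      apply FreeGroup.ext_hom
      rintro ((_ | _) | r) <;> rw [MonoidHom.comp_apply, FreeGroup.lift_apply_of,
        MonoidHom.id_apply]
      · exact hMz
      · change M (ψ z) = Z'
        rw [hz, _root_.map_mul, _root_.map_mul, _root_.map_inv, hMa, hMz, hb' M hMr]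
        group
      · change M (g r) = _
        by_cases hr : ψ r = (r : FreeGroup X)⁻¹
        · simp only [g, if_pos hr]
          exact hMr r hr
        · simp only [g, if_neg hr]
          rw [_root_.map_mul, _root_.map_mul, _root_.map_inv, hMite, hMite, hMr' r hr]
          group
    exact Function.LeftInverse.injective (g := M) fun w => DFunLike.congr_fun hMc w
  · rw [← MonoidHom.range_eq_top, FreeGroup.range_lift_eq_closure, eq_top_iff,
      ← MonoidHom.range_eq_top.mpr hS.2, range_lift_coe, Subgroup.closure_le]
    have hrest : Subgroup.closure (Set.range fun i => c (Sum.inr i)) ≤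
        Subgroup.closure (Set.range c) :=
      Subgroup.closure_mono (Set.range_comp_subset_range Sum.inr c)
    have hzmem : z ∈ Subgroup.closure (Set.range c) :=
      Subgroup.subset_closure ⟨Sum.inl false, rfl⟩
    have hite : ∀ p : Prop, ∀ [Decidable p],
        (if p then z else 1) ∈ Subgroup.closure (Set.range c) := by
      intro p _
      split_ifs
      exacts [hzmem, one_mem _]
    intro r hr
    change r ∈ Subgroup.closure (Set.range c)
    by_cases hry : r = y
    · rw [hry, ← hzero]
      exact zpow_mem hzmem ε
    by_cases hra : r = a
    · have h1 : r = (ψ z)⁻¹ * b * z := by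
        rw [hz, hra]
        group
      rw [h1]
      exact mul_mem (mul_mem (inv_mem (Subgroup.subset_closure ⟨Sum.inl true, rfl⟩))
        (hrest (hmem b hb hab))) hzmem
    have h1 : g r ∈ Subgroup.closure (Set.range c) :=
      Subgroup.subset_closure ⟨Sum.inr ⟨r, hr, hry, hra⟩, rfl⟩
    by_cases hr' : ψ r = r⁻¹
    · simpa only [g, if_pos hr'] using h1
    · simp only [g, if_neg hr'] at h1
      have h2 := mul_mem (mul_mem (inv_mem (hite (β r = a))) h1) (hite (α r = a))
      convert h2 using 1
      group
  · rintro ⟨r, hr, hry, hra⟩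
    have h1 : g r ∈ Subgroup.closure (Set.range fun i => c (Sum.inr i)) :=
      Subgroup.subset_closure ⟨⟨r, hr, hry, hra⟩, rfl⟩
    change ψ (g r) ∈ _
    by_cases hr' : ψ r = r⁻¹
    · simp only [g, if_pos hr'] at h1 ⊢
      rw [hr']
      exact inv_mem h1
    · have hψite : ∀ x, ψ (if x = a then z else 1) * x =
          (if x = a then b else x) * (if x = a then z else 1) := by
        intro x
        split_ifs with hx
        · rw [hz, hx]
          group
        · simp
      have h2 : ψ (g r) = (if β r = a then b else β r) * g r * (if α r = a then b else α r)⁻¹ := by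
        have h3 := hψite (β r)
        have h4 := congrArg Inv.inv (hψite (α r))
        rw [mul_inv_rev, mul_inv_rev] at h4
        simp only [g, if_neg hr']
        rw [_root_.map_mul, _root_.map_mul, _root_.map_inv, hαβ r hr hr',
          show ∀ p q s t u : FreeGroup X, p * (q * s * t) * u = p * q * s * (t * u) by
            intros; group, h3, h4]
        group
      have hmem' : ∀ x ∈ insert 1 {x ∈ S | ψ x = x⁻¹}, (if x = a then b else x) ∈
          Subgroup.closure (Set.range fun i => c (Sum.inr i)) := by
        intro x hx
        split_ifs with hxa
        exacts [hmem b hb hab, hmem x hx hxa]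
      rw [h2]
      exact mul_mem (mul_mem (hmem' _ (hβ r hr hr')) h1) (inv_mem (hmem' _ (hα r hr hr')))

/-- An involutory automorphism of a free group is soft or has a pair form. -/
theorem isSoftInvolution_or_hasPairForm (hψ : IsInvolution ψ) :
    IsSoftInvolution ψ ∨ HasPairForm (toOut ψ) := by
  have hψ2 : ψ * ψ = 1 := (pow_two ψ).symm.trans hψ.2
  obtain ⟨S, hS, h⟩ := exists_adapted_basis hψ2
  by_cases hswap : ∃ s ∈ S, ψ s ∈ S ∧ ψ s ≠ s
  · obtain ⟨s, hs, hs', hne⟩ := hswap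
    exact Or.inr (HasPairForm.of_swap hψ2 hS h hs hs' hne)
  push Not at hswap
  have h1 : ∀ s, ∃ a b, s ∈ S → ψ s ≠ s⁻¹ → a ∈ insert 1 {x ∈ S | ψ x = x⁻¹} ∧
      b ∈ insert 1 {x ∈ S | ψ x = x⁻¹} ∧ ψ s = b * s * a⁻¹ := by
    intro s
    by_cases hs : s ∈ S
    swap
    · exact ⟨1, 1, fun h => absurd h hs⟩
    rcases h s hs with h1 | ⟨a, ha, b, hb, h1, h2, h3⟩ | h1
    · exact ⟨1, 1, fun _ h => absurd h1 h⟩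
    · exact ⟨a, b, fun _ _ => ⟨ha.imp_right fun h => ⟨h, h1⟩, hb.imp_right fun h => ⟨h, h2⟩, h3⟩⟩
    · exact ⟨1, 1, fun _ _ => ⟨Or.inl rfl, Or.inl rfl, by simpa using hswap s hs h1⟩⟩
  choose α β h1 using h1
  by_cases hne : ∃ y ∈ S, ψ y ≠ y⁻¹ ∧ α y ≠ β y
  · right
    obtain ⟨y, hy, hy', hne⟩ := hne
    obtain ⟨h2, h3, h4⟩ := h1 y hy hy'
    rcases h2 with h2 | h2
    · rcases h3 with h3 | h3
      · exact absurd (h2.trans h3.symm) hne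
      · refine HasPairForm.of_ne hψ2 hS (fun s hs hs' => (h1 s hs hs').1)
          (fun s hs hs' => (h1 s hs hs').2.1) (fun s hs hs' => (h1 s hs hs').2.2) hy hy'
          (ε := -1) (by norm_num) h3.1 h3.2 (Or.inl h2) hne ?_
        rw [zpow_neg_one, _root_.map_inv, h4]
        group
    · refine HasPairForm.of_ne hψ2 hS (fun s hs hs' => (h1 s hs hs').1)
        (fun s hs hs' => (h1 s hs hs').2.1) (fun s hs hs' => (h1 s hs hs').2.2) hy hy'
        (ε := 1) (by norm_num) h2.1 h2.2 h3 hne.symm ?_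
      rw [zpow_one, h4]
  · left
    push Not at hne
    have hy : ∀ s ∈ S, ψ s ≠ s⁻¹ → ψ s = α s * s * (α s)⁻¹ := fun s hs hs' => by
      conv_lhs => rw [(h1 s hs hs').2.2, ← hne s hs hs']
    have hunion : {s ∈ S | ψ s ≠ s⁻¹ ∧ α s = 1} ∪ {s ∈ S | ψ s = s⁻¹} ∪
        ⋃ x ∈ {s ∈ S | ψ s = s⁻¹}, {s ∈ S | ψ s ≠ s⁻¹ ∧ α s = x ∧ x ≠ 1} = S := by
      ext s
      simp only [Set.mem_union, Set.mem_iUnion, Set.mem_ofPred_eq]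
      constructor
      · rintro ((h | h) | ⟨x, _, h⟩) <;> exact h.1
      · intro hs
        by_cases hs' : ψ s = s⁻¹
        · exact Or.inl (Or.inr ⟨hs, hs'⟩)
        by_cases hs1 : α s = 1
        · exact Or.inl (Or.inl ⟨hs, hs', hs1⟩)
        · exact Or.inr ⟨α s, (h1 s hs hs').1.resolve_left hs1, hs, hs', rfl, hs1⟩
    refine ⟨hψ, {s ∈ S | ψ s ≠ s⁻¹ ∧ α s = 1}, {s ∈ S | ψ s = s⁻¹},
      fun x => {s ∈ S | ψ s ≠ s⁻¹ ∧ α s = x ∧ x ≠ 1}, ⟨?_, ?_, ?_, ?_, ?_⟩, ?_, ?_, ?_⟩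
    · rw [hunion]
      exact hS
    · exact Set.disjoint_left.mpr fun s hs hs' => hs.2.1 hs'.2
    · exact fun x _ => Set.disjoint_left.mpr fun s hs hs' =>
        hs'.2.2.2 (hs'.2.2.1.symm.trans hs.2.2)
    · exact fun x _ => Set.disjoint_left.mpr fun s hs hs' => hs'.2.1 hs.2
    · exact fun x _ x' _ hxx => Set.disjoint_left.mpr fun s hs hs' =>
        hxx (hs.2.2.1.symm.trans hs'.2.2.1)
    · intro u hu
      rw [hy u hu.1 hu.2.1, hu.2.2]
      simp
    · exact fun x hx => hx.2
    · intro x _ y hyx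
      rw [hy y hyx.1 hyx.2.1, hyx.2.2.1]

end SoftOrPair

theorem mulAut_mul_conj_mul_inv {G : Type*} [Group G] (σ : MulAut G) (g : G) :
    σ * MulAut.conj g * σ⁻¹ = MulAut.conj (σ g) := by
  ext h
  simp [MulAut.mul_apply]

namespace FreeGroup

variable {C : Type u}

theorem mem_span_of_commute {g : FreeGroup C} {x : C} (h : Commute g (of x)) :
    g ∈ span ({x} : Set C) := by
  classical
  by_contra hg
  have h1 : of x ∈ span ({x} : Set C) := of_mem_span rfl
  refine of_ne_one x (eq_one_of_conj_mem_closure h1 ?_ hg)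
  rwa [mul_assoc, ← h.eq, inv_mul_cancel_left]

theorem eq_one_of_commute {g : FreeGroup C} {x y : C} (hxy : x ≠ y) (hx : Commute g (of x))
    (hy : Commute g (of y)) : g = 1 := by
  classical
  have h1 := mem_closure_of_image_iff.mp (mem_span_of_commute hx)
  have h2 := mem_closure_of_image_iff.mp (mem_span_of_commute hy)
  rw [← toWord_eq_nil_iff, List.eq_nil_iff_forall_not_mem]
  exact fun p hp => hxy ((h1 p hp).symm.trans (h2 p hp))

theorem conj_injective [Nontrivial C] :
    Function.Injective (MulAut.conj : FreeGroup C →* MulAut (FreeGroup C)) := by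
  rw [injective_iff_map_eq_one]
  intro g hg
  obtain ⟨x, y, hxy⟩ := exists_pair_ne C
  have h : ∀ z, Commute g z := fun z => by
    have := DFunLike.congr_fun hg z
    rw [MulAut.conj_apply, MulAut.one_apply] at this
    exact mul_inv_eq_iff_eq_mul.mp this
  exact eq_one_of_commute hxy (h _) (h _)

variable (K : Type u)

/-- The Schreier generators of the subgroup of index two of the free group on `Option K` consisting
of the elements in which the generator `none` has even exponent sum. -/
def evenGenerator : Option (Bool × K) → FreeGroup (Option K)
  | none => of none * of none
  | some (false, k) => of (some k)
  | some (true, k) => of none * of (some k) * (of none)⁻¹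

/-- The action of the generator `none` on the abstract free group on the Schreier generators. -/
def evenShift : FreeGroup (Option (Bool × K)) →* FreeGroup (Option (Bool × K)) :=
  lift fun
    | none => of none
    | some (false, k) => of (some (true, k))
    | some (true, k) => of none * of (some (false, k)) * (of none)⁻¹

/-- The inverse of `evenShift`. -/
def evenUnshift : FreeGroup (Option (Bool × K)) →* FreeGroup (Option (Bool × K)) :=
  lift fun
    | none => of none
    | some (false, k) => (of none)⁻¹ * of (some (true, k)) * of none
    | some (true, k) => of (some (false, k))

/-- `evenShift` as an automorphism. -/
def evenShiftAut : MulAut (FreeGroup (Option (Bool × K))) :=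
  MonoidHom.toMulEquiv (evenShift K) (evenUnshift K)
    (by
      apply ext_hom
      rintro (_ | ⟨_ | _, k⟩) <;> simp [evenShift, evenUnshift, mul_assoc])
    (by
      apply ext_hom
      rintro (_ | ⟨_ | _, k⟩) <;> simp [evenShift, evenUnshift, mul_assoc])

theorem evenShift_comp_evenShift : evenShiftAut K * evenShiftAut K = MulAut.conj (of none) := by
  apply MulEquiv.toMonoidHom_injective
  apply ext_hom
  rintro (_ | ⟨_ | _, k⟩) <;>
    simp [evenShiftAut, evenShift, MulAut.mul_apply]

theorem injective_lift_evenGenerator [Nonempty K] :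
    Function.Injective (lift (evenGenerator K)) := by
  let κ : FreeGroup (Option K) →* MulAut (FreeGroup (Option (Bool × K))) :=
    lift fun o => o.elim (evenShiftAut K) fun k => MulAut.conj (of (some (false, k)))
  have h : κ.comp (lift (evenGenerator K)) = MulAut.conj := by
    apply ext_hom
    rintro (_ | ⟨_ | _, k⟩)
    · simp [evenGenerator, κ, evenShift_comp_evenShift]
    · simp [evenGenerator, κ]
    · simp only [evenGenerator, κ, MonoidHom.comp_apply, lift_apply_of, _root_.map_mul,
        _root_.map_inv, Option.elim_none, Option.elim_some]
      rw [mulAut_mul_conj_mul_inv]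
      simp [evenShiftAut, evenShift]
  have hinj := conj_injective (C := Option (Bool × K))
  rw [← h] at hinj
  exact Function.Injective.of_comp hinj

variable {K}

/-- A subgroup of index two of the free group on `Option K` which contains all generators other
than `none` is generated by the Schreier generators. -/
theorem range_lift_evenGenerator {N : Subgroup (FreeGroup (Option K))}
    (hN : ∀ g h, g ∉ N → h ∉ N → g * h ∈ N) (h0 : of none ∉ N) (h1 : ∀ k, of (some k) ∈ N) :
    (lift (evenGenerator K)).range = N := by
  set R := (lift (evenGenerator K)).range
  have hgen : ∀ o, evenGenerator K o ∈ R := fun o => ⟨of o, lift_apply_of⟩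
  have hRN : R ≤ N := by
    rw [show R = _ from range_lift_eq_closure, Subgroup.closure_le]
    rintro - ⟨_ | ⟨_ | _, k⟩, rfl⟩
    · exact hN _ _ h0 h0
    · exact h1 k
    · refine hN _ _ (fun h => h0 ?_) fun h => h0 (inv_mem_iff.mp h)
      exact (Subgroup.mul_mem_cancel_right _ (h1 k)).mp h
  have hconj : ∀ g ∈ R, of none * g * (of none)⁻¹ ∈ R := by
    have : R ≤ R.comap (MulAut.conj (of none)).toMonoidHom := by
      rw [show R = _ from range_lift_eq_closure, Subgroup.closure_le,
        ← show R = _ from range_lift_eq_closure]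
      rintro - ⟨_ | ⟨_ | _, k⟩, rfl⟩
      · simpa [evenGenerator, mul_assoc] using hgen none
      · exact hgen (some (true, k))
      · have := mul_mem (mul_mem (hgen none) (hgen (some (false, k)))) (inv_mem (hgen none))
        simpa [evenGenerator, mul_assoc] using this
    exact this
  have hconj' : ∀ g ∈ R, (of none)⁻¹ * g * of none ∈ R := by
    intro g hg
    have := mul_mem (mul_mem (inv_mem (hgen none)) (hconj g hg)) (hgen none)
    simpa [evenGenerator, mul_assoc] using this
  have hall : ∀ g, g ∈ R ∨ g * of none ∈ R := by
    intro g
    induction g using FreeGroup.induction_on with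
    | C1 => exact Or.inl (one_mem R)
    | of o =>
      rcases o with _ | k
      exacts [Or.inr (hgen none), Or.inl (hgen (some (false, k)))]
    | inv_of o =>
      rcases o with _ | k
      · right
        rw [inv_mul_cancel]
        exact one_mem R
      · exact Or.inl (inv_mem (hgen (some (false, k))))
    | mul g h hg hh =>
      rcases hg with hg | hg <;> rcases hh with hh | hh
      · exact Or.inl (mul_mem hg hh)
      · exact Or.inr (by simpa [mul_assoc] using mul_mem hg hh)
      · exact Or.inr (by simpa [mul_assoc] using mul_mem hg (hconj' h hh))
      · left
        have := mul_mem (mul_mem hg (hconj' _ hh)) (inv_mem (hgen none))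
        simpa [evenGenerator, mul_assoc] using this
  refine le_antisymm hRN fun g hg => (hall g).resolve_right fun h => h0 ?_
  exact (Subgroup.mul_mem_cancel_left _ hg).mp (hRN h)

end FreeGroup

section IndexTwo

variable {X : Type u}

theorem toOut_conj_mul {G : Type*} [Group G] (w : G) (φ : MulAut G) :
    toOut (MulAut.conj w * φ) = toOut φ := by
  have h : toOut (MulAut.conj w) = 1 := (QuotientGroup.eq_one_iff _).mpr ⟨w, rfl⟩
  rw [_root_.map_mul, h, one_mul]

theorem HasPairForm.of_option {K : Type u} [Nonempty K] {φ : MulAut (FreeGroup X)}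
    {m : FreeGroup X →* FreeGroup (Option K)} (hm : Function.Injective m)
    (hφ : ∀ f, m (φ f) = FreeGroup.of none * m f * (FreeGroup.of none)⁻¹)
    (hN : ∀ g h, g ∉ m.range → h ∉ m.range → g * h ∈ m.range)
    (h0 : FreeGroup.of none ∉ m.range) (h1 : ∀ k, FreeGroup.of (some k) ∈ m.range) :
    HasPairForm (toOut φ) := by
  classical
  have hrange := FreeGroup.range_lift_evenGenerator hN h0 h1
  let e : FreeGroup (Option (Bool × K)) ≃* FreeGroup X :=
    ((MonoidHom.ofInjective (FreeGroup.injective_lift_evenGenerator K)).trans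
      (MulEquiv.subgroupCongr hrange)).trans (MonoidHom.ofInjective hm).symm
  have he : ∀ p, m (e p) = FreeGroup.lift (FreeGroup.evenGenerator K) p := fun p =>
    MonoidHom.apply_ofInjective_symm hm _
  let k₀ : K := Classical.arbitrary K
  let idx : Bool ⊕ Option (Bool × {k // k ≠ k₀}) → Option (Bool × K) :=
    Sum.elim (fun b => some (b, k₀)) (Option.map (Prod.map id Subtype.val))
  have hidx : Function.Bijective idx := by
    constructor
    · rintro (b | _ | ⟨b, k, hk⟩) (b' | _ | ⟨b', k', hk'⟩) h <;>
        simp only [idx, Sum.elim_inl, Sum.elim_inr, Option.map_none, Option.map_some, Prod.map_apply,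
          id, Option.some.injEq, Prod.mk.injEq, reduceCtorEq] at h ⊢
      · simpa using h
      · exact absurd h.2.symm hk'
      · exact absurd h.2 hk
      · simpa using h
    · rintro (_ | ⟨b, k⟩)
      · exact ⟨Sum.inr none, rfl⟩
      · by_cases hk : k = k₀
        · exact ⟨Sum.inl b, by rw [hk]; rfl⟩
        · exact ⟨Sum.inr (some (b, ⟨k, hk⟩)), rfl⟩
  let E := (FreeGroup.freeGroupCongr (Equiv.ofBijective idx hidx)).trans e
  have hE : ∀ c, m (E (FreeGroup.of c)) = FreeGroup.evenGenerator K (idx c) := by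
    intro c
    change m (e (FreeGroup.map idx (FreeGroup.of c))) = _
    rw [he, FreeGroup.map.of, FreeGroup.lift_apply_of]
  refine ⟨Option (Bool × {k // k ≠ k₀}), E, φ, FreeGroup.of none, Or.inr ⟨none, rfl⟩, rfl, ?_, ?_,
    ?_, ?_⟩
  · apply hm
    rw [hφ, hE, hE]
    rfl
  · rintro (_ | ⟨_ | _, k⟩)
    · refine ⟨FreeGroup.of none, hm ?_⟩
      rw [hφ, FreeGroup.map.of, hE]
      simp [idx, FreeGroup.evenGenerator, mul_assoc]
    · refine ⟨FreeGroup.of (some (true, k)), hm ?_⟩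
      rw [hφ, FreeGroup.map.of, hE, hE]
      rfl
    · refine ⟨FreeGroup.of none * FreeGroup.of (some (false, k)) * (FreeGroup.of none)⁻¹, hm ?_⟩
      simp only [hφ, _root_.map_mul, _root_.map_inv, FreeGroup.map.of, hE]
      simp [idx, FreeGroup.evenGenerator, mul_assoc]
  · intro g
    apply hm
    simp only [hφ, _root_.map_mul, _root_.map_inv, FreeGroup.map.of, hE]
    simp [idx, FreeGroup.evenGenerator, mul_assoc]
  · apply hm
    rw [hφ, FreeGroup.map.of, hE]
    simp [idx, FreeGroup.evenGenerator, mul_assoc]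

theorem FreeGroup.commute_of_subsingleton {C : Type*} [Subsingleton C] (g h : FreeGroup C) :
    Commute g h := by
  rcases isEmpty_or_nonempty C with hC | ⟨⟨c⟩⟩
  · rw [Subsingleton.elim g h]
  · have hall : ∀ g : FreeGroup C, g ∈ Subgroup.zpowers (FreeGroup.of c) := by
      intro g
      rw [Subgroup.zpowers_eq_closure, ← Set.image_singleton,
        Set.eq_univ_of_forall (s := ({c} : Set C)) fun d => Subsingleton.elim d c, Set.image_univ,
        FreeGroup.closure_range_of]
      trivial
    obtain ⟨i, rfl⟩ := hall g
    obtain ⟨j, rfl⟩ := hall h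
    exact (Commute.refl _).zpow_zpow i j

/-- If a free group is embedded as a subgroup of index two in a free group, then conjugation by an
element outside of the subgroup has a pair form. -/
theorem HasPairForm.of_index_two [Nontrivial X] {Q : Type u} {φ : MulAut (FreeGroup X)}
    {m : FreeGroup X →* FreeGroup Q} (hm : Function.Injective m) {σ : FreeGroup Q}
    (hφ : ∀ f, m (φ f) = σ * m f * σ⁻¹)
    (hN : ∀ g h, g ∉ m.range → h ∉ m.range → g * h ∈ m.range) (hσ : σ ∉ m.range) :
    HasPairForm (toOut φ) := by
  classical
  obtain ⟨q₀, hq₀⟩ : ∃ q, FreeGroup.of q ∉ m.range := by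
    by_contra! h
    have h1 : Subgroup.closure (Set.range FreeGroup.of) ≤ m.range := by
      rw [Subgroup.closure_le]
      rintro - ⟨q, rfl⟩
      exact h q
    rw [FreeGroup.closure_range_of] at h1
    exact hσ (h1 trivial)
  let K := {q // q ≠ q₀}
  let a : FreeGroup (Option K) →* FreeGroup Q := FreeGroup.lift fun o =>
    o.elim (FreeGroup.of q₀) fun k => if FreeGroup.of (k : Q) ∈ m.range then FreeGroup.of (k : Q)
      else FreeGroup.of (k : Q) * (FreeGroup.of q₀)⁻¹
  let b : FreeGroup Q →* FreeGroup (Option K) := FreeGroup.lift fun q =>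
    if h : q = q₀ then FreeGroup.of none else
      if FreeGroup.of q ∈ m.range then FreeGroup.of (some ⟨q, h⟩) else
        FreeGroup.of (some ⟨q, h⟩) * FreeGroup.of none
  have hab : a.comp b = MonoidHom.id _ := by
    apply FreeGroup.ext_hom
    intro q
    rw [MonoidHom.comp_apply, FreeGroup.lift_apply_of, MonoidHom.id_apply]
    split_ifs with h1 h2
    · simp [a, h1]
    · simp only [a, FreeGroup.lift_apply_of, Option.elim_some, if_pos h2]
    · simp only [a, _root_.map_mul, FreeGroup.lift_apply_of, Option.elim_some, if_neg h2,
        Option.elim_none, inv_mul_cancel_right]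
  have hba : b.comp a = MonoidHom.id _ := by
    apply FreeGroup.ext_hom
    rintro (_ | ⟨q, hq⟩)
    · simp [a, b]
    · rw [MonoidHom.comp_apply, FreeGroup.lift_apply_of, MonoidHom.id_apply, Option.elim_some]
      split_ifs with h
      · simp only [b, FreeGroup.lift_apply_of, dif_neg hq, if_pos h]
      · simp only [b, _root_.map_mul, _root_.map_inv, FreeGroup.lift_apply_of, dif_neg hq, if_neg h,
          dif_pos, mul_inv_cancel_right]
  have hab' : ∀ g, a (b g) = g := DFunLike.congr_fun hab
  have hba' : ∀ g, b (a g) = g := DFunLike.congr_fun hba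
  have hb : Function.Injective b := Function.LeftInverse.injective hab'
  have hmem : ∀ g, g ∈ (b.comp m).range ↔ a g ∈ m.range := by
    intro g
    constructor
    · rintro ⟨f, rfl⟩
      exact ⟨f, (hab' _).symm⟩
    · rintro ⟨f, hf⟩
      exact ⟨f, by rw [MonoidHom.comp_apply, hf, hba']⟩
  have hbm : Function.Injective (b.comp m) := hb.comp hm
  have hK : Nonempty K := by
    by_contra hK
    rw [not_nonempty_iff] at hK
    have hcomm : ∀ f g : FreeGroup X, Commute f g := fun f g => hbm (by
      rw [_root_.map_mul, _root_.map_mul]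
      exact FreeGroup.commute_of_subsingleton _ _)
    obtain ⟨x, y, hxy⟩ := exists_pair_ne X
    exact FreeGroup.of_ne_one x (FreeGroup.eq_one_of_commute hxy (hcomm _ _) (hcomm _ _))
  obtain ⟨w, hw⟩ : FreeGroup.of q₀ * σ⁻¹ ∈ m.range :=
    hN _ _ hq₀ fun h => hσ (inv_mem_iff.mp h)
  rw [← toOut_conj_mul w φ]
  refine HasPairForm.of_option hbm (fun f => ?_) (fun g h hg hh => ?_) ?_ fun k => ?_
  · have h0 : b (FreeGroup.of q₀) = FreeGroup.of none := by simp [b]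
    have h1 : m ((MulAut.conj w * φ) f) = FreeGroup.of q₀ * m f * (FreeGroup.of q₀)⁻¹ := by
      rw [MulAut.mul_apply, MulAut.conj_apply, _root_.map_mul, _root_.map_mul, _root_.map_inv, hφ,
        hw]
      group
    rw [MonoidHom.comp_apply, h1, _root_.map_mul, _root_.map_mul, _root_.map_inv, h0]
    rfl
  · rw [hmem, _root_.map_mul]
    exact hN _ _ (by rwa [← hmem]) (by rwa [← hmem])
  · rw [hmem]
    simpa [a] using hq₀
  · rw [hmem]
    simp only [a, FreeGroup.lift_apply_of, Option.elim_some]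
    split_ifs with h
    · exact h
    · exact hN _ _ h fun h' => hq₀ (inv_mem_iff.mp h')

end IndexTwo

section Nonsplit

variable {X : Type u}

theorem FreeGroup.eq_map_or_eq_map_mul {G : Type*} [Group G] {m : FreeGroup X →* G} {σ : G}
    {φ : MulAut (FreeGroup X)} {t : FreeGroup X} (hφ : ∀ f, m (φ f) = σ * m f * σ⁻¹)
    (ht : σ * σ = m t) {ρ : FreeGroup (Option X) →* G}
    (hρ : ∀ x, ρ (of (some x)) = m (of x)) (hρ' : ρ (of none) = σ⁻¹) (g : FreeGroup (Option X)) :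
    ∃ f, ρ g = m f ∨ ρ g = m f * σ := by
  induction g using FreeGroup.induction_on with
  | C1 => exact ⟨1, Or.inl (by simp)⟩
  | of o =>
    rcases o with _ | x
    · refine ⟨t⁻¹, Or.inr ?_⟩
      rw [hρ', _root_.map_inv, ← ht]
      group
    · exact ⟨of x, Or.inl (hρ x)⟩
  | inv_of o =>
    rcases o with _ | x
    · exact ⟨1, Or.inr (by simp [hρ'])⟩
    · exact ⟨(of x)⁻¹, Or.inl (by simp [hρ])⟩
  | mul g h hg hh =>
    obtain ⟨f, hf | hf⟩ := hg <;> obtain ⟨f', hf' | hf'⟩ := hh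
    · exact ⟨f * f', Or.inl (by simp [hf, hf'])⟩
    · exact ⟨f * f', Or.inr (by simp [hf, hf', mul_assoc])⟩
    · exact ⟨f * φ f', Or.inr (by simp [hf, hf', hφ, mul_assoc])⟩
    · exact ⟨f * φ f' * t, Or.inl (by simp [hf, hf', hφ, ← ht, mul_assoc])⟩

/-- An automorphism whose square is inner, such that no automorphism in its outer class squares to
the identity, has a pair form. -/
theorem HasPairForm.of_nonsplit [Nontrivial X] {φ : MulAut (FreeGroup X)} {t : FreeGroup X}
    (ht : φ * φ = MulAut.conj t) (hφ : ∀ w, φ ≠ MulAut.conj w)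
    (hsplit : ∀ w, (MulAut.conj w * φ) * (MulAut.conj w * φ) ≠ 1) : HasPairForm (toOut φ) := by
  classical
  have htφ : φ t = t := by
    apply FreeGroup.conj_injective
    rw [← mulAut_mul_conj_mul_inv, ← ht]
    group
  let inc : FreeGroup X →* FreeGroup (Option X) := FreeGroup.map some
  let s : FreeGroup (Option X) := FreeGroup.of none
  let ψ₀ : FreeGroup (Option X) →* FreeGroup (Option X) := FreeGroup.lift fun o =>
    o.elim ((inc t)⁻¹ * s⁻¹) fun x => s * inc (φ (FreeGroup.of x)) * s⁻¹
  have hψs : ψ₀ s = (inc t)⁻¹ * s⁻¹ := FreeGroup.lift_apply_of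
  have hψinc : ∀ f, ψ₀ (inc f) = s * inc (φ f) * s⁻¹ := by
    have : ψ₀.comp inc = (MulAut.conj s).toMonoidHom.comp (inc.comp φ.toMonoidHom) := by
      apply FreeGroup.ext_hom
      intro x
      simp only [MonoidHom.comp_apply, inc, FreeGroup.map.of]
      exact FreeGroup.lift_apply_of
    exact DFunLike.congr_fun this
  have hφφ : ∀ g, φ (φ g) = t * g * t⁻¹ := fun g => DFunLike.congr_fun ht g
  have hψψ : ψ₀.comp ψ₀ = MonoidHom.id _ := by
    apply FreeGroup.ext_hom
    rintro (_ | x)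
    · change ψ₀ (ψ₀ s) = s
      simp only [hψs, _root_.map_mul, _root_.map_inv, hψinc, htφ]
      group
    · have hx : (FreeGroup.of (some x)) = inc (FreeGroup.of x) := FreeGroup.map.of.symm
      rw [hx, MonoidHom.comp_apply, hψinc]
      simp only [hψs, _root_.map_mul, _root_.map_inv, hψinc, hφφ]
      simp [mul_assoc]
  let ψ : MulAut (FreeGroup (Option X)) := MonoidHom.toMulEquiv ψ₀ ψ₀ hψψ hψψ
  have hψ : ψ * ψ = 1 := by
    ext g
    exact DFunLike.congr_fun hψψ g
  let r : FreeGroup (Option X) →* MulAut (FreeGroup X) := FreeGroup.lift fun o =>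
    o.elim φ⁻¹ fun x => MulAut.conj (FreeGroup.of x)
  have hrs : r s = φ⁻¹ := FreeGroup.lift_apply_of
  have hrinc : ∀ f, r (inc f) = MulAut.conj f := by
    have : r.comp inc = MulAut.conj := by
      apply FreeGroup.ext_hom
      intro x
      simp only [MonoidHom.comp_apply, inc, FreeGroup.map.of]
      exact FreeGroup.lift_apply_of
    exact DFunLike.congr_fun this
  have hrψ : r.comp ψ₀ = r := by
    apply FreeGroup.ext_hom
    rintro (_ | x)
    · change r (ψ₀ s) = r s
      rw [hψs, _root_.map_mul, _root_.map_inv, _root_.map_inv, hrinc, hrs, ← ht]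
      group
    · have hx : (FreeGroup.of (some x)) = inc (FreeGroup.of x) := FreeGroup.map.of.symm
      rw [hx, MonoidHom.comp_apply, hψinc, _root_.map_mul, _root_.map_mul, _root_.map_inv, hrinc,
        hrinc, hrs, ← mulAut_mul_conj_mul_inv]
      group
  have hrψ' : ∀ g, r (ψ g) = r g := DFunLike.congr_fun hrψ
  have hr1 : ∀ g, ψ g = g⁻¹ → r g = 1 := by
    intro g hg
    have h2 : r g * r g = 1 := by
      nth_rewrite 2 [← hrψ']
      rw [hg, _root_.map_inv, mul_inv_cancel]
    obtain ⟨f, hf | hf⟩ := FreeGroup.eq_map_or_eq_map_mul (m := MulAut.conj) (σ := φ)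
      (fun f => (mulAut_mul_conj_mul_inv φ f).symm) ht (ρ := r) (fun x => FreeGroup.lift_apply_of)
      hrs g
    · rw [hf, ← _root_.map_mul] at h2
      have hff : f * f = 1 := FreeGroup.conj_injective (h2.trans (_root_.map_one _).symm)
      rw [hf, FreeGroup.eq_one_of_mul_self_eq_one hff, _root_.map_one]
    · rw [hf] at h2
      exact absurd h2 (hsplit f)
  obtain ⟨S, hS, hadapt⟩ := exists_adapted_basis hψ
  let Q : Type u := Quot fun a b : {a : FreeGroup (Option X) // a ∈ S ∧ ψ a ≠ a⁻¹} =>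
    ψ a = (b : FreeGroup (Option X))
  obtain ⟨ρ, hρ⟩ := hS.exists_lift fun a : S =>
    if h : ψ a = (a : FreeGroup (Option X))⁻¹ then (1 : FreeGroup Q)
    else FreeGroup.of (Quot.mk _ ⟨a, a.2, h⟩)
  have hρ1 : ∀ a ∈ S, ψ a = a⁻¹ → ρ a = 1 := fun a ha h => by
    rw [hρ ⟨a, ha⟩, dif_pos h]
  have hρ2 : ∀ (a) (ha : a ∈ S) (h : ψ a ≠ a⁻¹), ρ a = FreeGroup.of (Quot.mk _ ⟨a, ha, h⟩) :=
    fun a ha h => by rw [hρ ⟨a, ha⟩, dif_neg h]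
  have hψψ' : ∀ g, ψ (ψ g) = g := DFunLike.congr_fun hψψ
  have hρψ : ρ.comp ψ.toMonoidHom = ρ := by
    refine hS.ext fun a ha => ?_
    change ρ (ψ a) = ρ a
    rcases hadapt a ha with h | ⟨b, hb, c, hc, hψb, hψc, h⟩ | h
    · rw [h, _root_.map_inv, hρ1 a ha h, inv_one]
    · have h1 : ∀ b ∈ insert 1 S, ψ b = b⁻¹ → ρ b = 1 := by
        rintro b (rfl | hb) hψb
        exacts [_root_.map_one ρ, hρ1 b hb hψb]
      rw [h, _root_.map_mul, _root_.map_mul, _root_.map_inv, h1 b hb hψb, h1 c hc hψc]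
      simp
    · by_cases h' : ψ a = a⁻¹
      · rw [h', _root_.map_inv, hρ1 a ha h', inv_one]
      · have h'' : ψ (ψ a) ≠ (ψ a)⁻¹ := by
          rw [hψψ']
          intro h''
          exact h' (inv_eq_iff_eq_inv.mpr h'').symm
        rw [hρ2 a ha h', hρ2 _ h h'']
        refine congrArg FreeGroup.of (Eq.symm (Quot.sound ?_))
        rfl
  have hρψ' : ∀ g, ρ (ψ g) = ρ g := DFunLike.congr_fun hρψ
  let rbar : FreeGroup Q →* MulAut (FreeGroup X) := FreeGroup.lift
    (Quot.lift (fun a => r a) fun a b h => by rw [← h, hrψ'])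
  have hrbar : rbar.comp ρ = r := by
    refine hS.ext fun a ha => ?_
    rw [MonoidHom.comp_apply]
    by_cases h : ψ a = a⁻¹
    · rw [hρ1 a ha h, _root_.map_one, hr1 a h]
    · rw [hρ2 a ha h]
      exact FreeGroup.lift_apply_of
  have hrbar' : ∀ g, rbar (ρ g) = r g := DFunLike.congr_fun hrbar
  have hsurj : Function.Surjective ρ := by
    rw [← MonoidHom.range_eq_top, ← top_le_iff, ← FreeGroup.closure_range_of, Subgroup.closure_le]
    rintro - ⟨⟨a, ha, h⟩, rfl⟩
    exact ⟨a, hρ2 a ha h⟩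
  let m : FreeGroup X →* FreeGroup Q := ρ.comp inc
  have hmφ : ∀ f, m (φ f) = (ρ s)⁻¹ * m f * (ρ s)⁻¹⁻¹ := by
    intro f
    have h := hρψ' (inc f)
    have h' : ψ (inc f) = s * inc (φ f) * s⁻¹ := hψinc f
    rw [h', _root_.map_mul, _root_.map_mul, _root_.map_inv] at h
    change ρ (inc (φ f)) = (ρ s)⁻¹ * ρ (inc f) * (ρ s)⁻¹⁻¹
    rw [← h]
    group
  have hmt : (ρ s)⁻¹ * (ρ s)⁻¹ = m t := by
    have h := hρψ' s
    have h' : ψ s = (inc t)⁻¹ * s⁻¹ := hψs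
    rw [h', _root_.map_mul, _root_.map_inv, _root_.map_inv] at h
    change _ = ρ (inc t)
    nth_rewrite 2 [← h]
    group
  have hall : ∀ g, ∃ f, g = m f ∨ g = m f * (ρ s)⁻¹ := by
    intro g
    obtain ⟨g', rfl⟩ := hsurj g
    refine FreeGroup.eq_map_or_eq_map_mul hmφ hmt (ρ := ρ) (fun x => ?_) (inv_inv _).symm g'
    rw [MonoidHom.comp_apply]
    exact congrArg ρ FreeGroup.map.of.symm
  refine HasPairForm.of_index_two (m := m) ?_ hmφ ?_ ?_
  · rw [injective_iff_map_eq_one]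
    intro f hf
    have h := hrbar' (inc f)
    have hf' : ρ (inc f) = 1 := hf
    rw [hf', _root_.map_one, hrinc] at h
    exact FreeGroup.conj_injective (h.symm.trans (_root_.map_one _).symm)
  · intro g h hg hh
    obtain ⟨f, rfl | rfl⟩ := hall g
    · exact absurd ⟨f, rfl⟩ hg
    obtain ⟨f', rfl | rfl⟩ := hall h
    · exact absurd ⟨f', rfl⟩ hh
    refine ⟨f * φ f' * t, ?_⟩
    rw [_root_.map_mul, _root_.map_mul, hmφ, ← hmt]
    group
  · rintro ⟨f, hf⟩
    apply hφ f
    have h := hrbar' (inc f)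
    have hf' : ρ (inc f) = (ρ s)⁻¹ := hf
    rw [hf', _root_.map_inv, hrbar', hrs, hrinc, inv_inv] at h
    exact h

/-- Every involution of the outer automorphism group of a free group is soft or has a pair form. -/
theorem isSoftOutInvolution_or_hasPairForm [Nontrivial X] {f : OutAut (FreeGroup X)}
    (hf : IsInvolution f) : IsSoftOutInvolution f ∨ HasPairForm f := by
  obtain ⟨φ, rfl⟩ := QuotientGroup.mk'_surjective _ f
  change IsSoftOutInvolution (toOut φ) ∨ HasPairForm (toOut φ)
  change IsInvolution (toOut φ) at hf
  by_cases hsplit : ∃ w, (MulAut.conj w * φ) * (MulAut.conj w * φ) = 1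
  · obtain ⟨w, hw⟩ := hsplit
    rw [← toOut_conj_mul w φ] at hf ⊢
    have hne : MulAut.conj w * φ ≠ 1 := fun h => hf.1 (by rw [h, _root_.map_one])
    rcases isSoftInvolution_or_hasPairForm ⟨hne, (pow_two _).trans hw⟩ with h | h
    exacts [Or.inl ⟨hf, _, h, rfl⟩, Or.inr h]
  · push Not at hsplit
    have h2 := hf.2
    rw [pow_two, ← _root_.map_mul] at h2
    obtain ⟨t, ht⟩ := (QuotientGroup.eq_one_iff _).mp h2
    exact Or.inr (HasPairForm.of_nonsplit ht.symm
      (fun w hw => hf.1 ((QuotientGroup.eq_one_iff _).mpr ⟨w, hw.symm⟩)) hsplit)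

end Nonsplit

section AugmentationPowers

variable {G : Type u} [Group G] {H : Type v} [Group H] {q k : ℕ}

open scoped MonoidAlgebra

/-- The kernel of the augmentation `ℤ[G] → ℤ/q`, as a `ℤ`-submodule. -/
noncomputable def augmentationMod (q : ℕ) (G : Type u) [Group G] : Submodule ℤ ℤ[G] :=
  Submodule.span ℤ ({(q : ℤ[G])} ∪ Set.range fun g => MonoidAlgebra.of ℤ G g - 1)

theorem natCast_mem_augmentationMod : (q : ℤ[G]) ∈ augmentationMod q G :=
  Submodule.subset_span (Or.inl rfl)

theorem of_sub_one_mem_augmentationMod (g : G) :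
    MonoidAlgebra.of ℤ G g - 1 ∈ augmentationMod q G :=
  Submodule.subset_span (Or.inr ⟨g, rfl⟩)

theorem augmentationMod_le {p : Submodule ℤ ℤ[G]} (hq : (q : ℤ[G]) ∈ p)
    (h : ∀ g, MonoidAlgebra.of ℤ G g - 1 ∈ p) : augmentationMod q G ≤ p := by
  rw [augmentationMod, Submodule.span_le]
  rintro - (rfl | ⟨g, rfl⟩)
  exacts [hq, h g]

theorem mul_of_mem_augmentationMod {a : ℤ[G]} (ha : a ∈ augmentationMod q G) (g : G) :
    a * MonoidAlgebra.of ℤ G g ∈ augmentationMod q G := by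
  have h : augmentationMod q G ≤ (augmentationMod q G).comap
      (LinearMap.mulRight ℤ (MonoidAlgebra.of ℤ G g)) := by
    apply augmentationMod_le
    · rw [Submodule.mem_comap, LinearMap.mulRight_apply]
      have h1 := (augmentationMod q G).add_mem ((augmentationMod q G).smul_mem (q : ℤ)
        (of_sub_one_mem_augmentationMod g)) natCast_mem_augmentationMod
      rwa [zsmul_eq_mul, Int.cast_natCast, mul_sub_one, sub_add_cancel] at h1
    · intro h
      rw [Submodule.mem_comap, LinearMap.mulRight_apply]
      have h1 := (augmentationMod q G).sub_mem (of_sub_one_mem_augmentationMod (q := q) (h * g))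
        (of_sub_one_mem_augmentationMod g)
      rwa [sub_sub_sub_cancel_right, _root_.map_mul, ← sub_one_mul] at h1
  exact h ha

theorem of_mul_mem_augmentationMod {a : ℤ[G]} (ha : a ∈ augmentationMod q G) (g : G) :
    MonoidAlgebra.of ℤ G g * a ∈ augmentationMod q G := by
  have h : augmentationMod q G ≤ (augmentationMod q G).comap
      (LinearMap.mulLeft ℤ (MonoidAlgebra.of ℤ G g)) := by
    apply augmentationMod_le
    · rw [Submodule.mem_comap, LinearMap.mulLeft_apply, ← Nat.cast_comm]
      have h1 := (augmentationMod q G).add_mem ((augmentationMod q G).smul_mem (q : ℤ)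
        (of_sub_one_mem_augmentationMod g)) natCast_mem_augmentationMod
      rwa [zsmul_eq_mul, Int.cast_natCast, mul_sub_one, sub_add_cancel] at h1
    · intro h
      rw [Submodule.mem_comap, LinearMap.mulLeft_apply]
      have h1 := (augmentationMod q G).sub_mem (of_sub_one_mem_augmentationMod (q := q) (g * h))
        (of_sub_one_mem_augmentationMod g)
      rwa [sub_sub_sub_cancel_right, _root_.map_mul, ← mul_sub_one] at h1
  exact h ha

theorem augmentationMod_mul_self_le :
    augmentationMod q G * augmentationMod q G ≤ augmentationMod q G := by
  rw [Submodule.mul_le]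
  intro a ha b hb
  have h : augmentationMod q G ≤ (augmentationMod q G).comap (LinearMap.mulLeft ℤ a) := by
    apply augmentationMod_le
    · rw [Submodule.mem_comap, LinearMap.mulLeft_apply, ← Nat.cast_comm]
      have := (augmentationMod q G).smul_mem (q : ℤ) ha
      simpa [zsmul_eq_mul] using this
    · intro g
      rw [Submodule.mem_comap, LinearMap.mulLeft_apply, mul_sub_one]
      exact (augmentationMod q G).sub_mem (mul_of_mem_augmentationMod ha g) ha
  exact h hb

theorem augmentationMod_pow_succ_le (k : ℕ) :
    augmentationMod q G ^ (k + 1 + 1) ≤ augmentationMod q G ^ (k + 1) := by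
  induction k with
  | zero =>
    rw [zero_add, pow_succ, pow_one]
    exact augmentationMod_mul_self_le
  | succ k ih =>
    rw [pow_succ, pow_succ _ (k + 1)]
    exact mul_le_mul_left ih _

theorem mul_of_mem_augmentationMod_pow {a : ℤ[G]} (ha : a ∈ augmentationMod q G ^ (k + 1)) (g : G) :
    a * MonoidAlgebra.of ℤ G g ∈ augmentationMod q G ^ (k + 1) := by
  rw [pow_succ] at ha ⊢
  induction ha using Submodule.mul_induction_on' with
  | mem_mul_mem a ha b hb =>
    rw [mul_assoc]
    exact Submodule.mul_mem_mul ha (mul_of_mem_augmentationMod hb g)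
  | add a _ b _ ha hb =>
    rw [add_mul]
    exact add_mem ha hb

theorem of_mul_mem_augmentationMod_pow {a : ℤ[G]} (ha : a ∈ augmentationMod q G ^ (k + 1)) (g : G) :
    MonoidAlgebra.of ℤ G g * a ∈ augmentationMod q G ^ (k + 1) := by
  rw [pow_succ'] at ha ⊢
  induction ha using Submodule.mul_induction_on' with
  | mem_mul_mem a ha b hb =>
    rw [← mul_assoc]
    exact Submodule.mul_mem_mul (of_mul_mem_augmentationMod ha g) hb
  | add a _ b _ ha hb =>
    rw [mul_add]
    exact add_mem ha hb

/-- The endomorphism of group rings induced by a homomorphism of groups. -/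
noncomputable def groupRingMap (φ : G →* H) : ℤ[G] →ₐ[ℤ] ℤ[H] :=
  MonoidAlgebra.lift ℤ _ G ((MonoidAlgebra.of ℤ H).comp φ)

@[simp]
theorem groupRingMap_of (φ : G →* H) (g : G) :
    groupRingMap φ (MonoidAlgebra.of ℤ G g) = MonoidAlgebra.of ℤ H (φ g) :=
  MonoidAlgebra.lift_of _ _

theorem groupRingMap_mem_pow (φ : G →* H) {a : ℤ[G]} (ha : a ∈ augmentationMod q G ^ k) :
    groupRingMap φ a ∈ augmentationMod q H ^ k := by
  have h : (augmentationMod q G).map (groupRingMap φ).toLinearMap ≤ augmentationMod q H := by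
    rw [Submodule.map_le_iff_le_comap]
    apply augmentationMod_le
    · rw [Submodule.mem_comap, AlgHom.toLinearMap_apply, map_natCast]
      exact natCast_mem_augmentationMod
    · intro g
      rw [Submodule.mem_comap, AlgHom.toLinearMap_apply, map_sub, groupRingMap_of, _root_.map_one]
      exact of_sub_one_mem_augmentationMod _
  have h' := pow_le_pow_left' h k
  rw [← Submodule.map_pow] at h'
  exact h' ⟨a, ha, rfl⟩

/-- Congruence of group elements modulo the `k + 1`-st power of the kernel of the augmentation
modulo `q`. -/
def AugCongr (q k : ℕ) (g h : G) : Prop :=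
  MonoidAlgebra.of ℤ G g - MonoidAlgebra.of ℤ G h ∈ augmentationMod q G ^ (k + 1)

namespace AugCongr

variable {g h g' h' : G}

theorem refl (g : G) : AugCongr q k g g := by
  rw [AugCongr, sub_self]
  exact zero_mem _

theorem symm (hg : AugCongr q k g h) : AugCongr q k h g := by
  rw [AugCongr, ← neg_sub]
  exact neg_mem hg

theorem trans (hg : AugCongr q k g h) (hh : AugCongr q k h g') : AugCongr q k g g' := by
  rw [AugCongr, ← sub_add_sub_cancel _ (MonoidAlgebra.of ℤ G h)]
  exact add_mem hg hh

theorem mul_left (hg : AugCongr q k g h) (c : G) : AugCongr q k (c * g) (c * h) := by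
  rw [AugCongr, _root_.map_mul, _root_.map_mul, ← mul_sub]
  exact of_mul_mem_augmentationMod_pow hg c

theorem mul_right (hg : AugCongr q k g h) (c : G) : AugCongr q k (g * c) (h * c) := by
  rw [AugCongr, _root_.map_mul, _root_.map_mul, ← sub_mul]
  exact mul_of_mem_augmentationMod_pow hg c

theorem map (hg : AugCongr q k g h) (φ : G →* H) : AugCongr q k (φ g) (φ h) := by
  rw [AugCongr, ← groupRingMap_of, ← groupRingMap_of, ← map_sub]
  exact groupRingMap_mem_pow φ hg

theorem of_succ (hg : AugCongr q (k + 1) g h) : AugCongr q k g h :=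
  augmentationMod_pow_succ_le k hg

end AugCongr

/-- An automorphism acting trivially on the abelianization modulo `q`. -/
def IsTrivialMod (q : ℕ) (φ : MulAut G) : Prop :=
  ∀ (A : Type u) [CommGroup A] (χ : G →* A), (∀ g, χ g ^ q = 1) → ∀ g, χ (φ g) = χ g

theorem IsTrivialMod.augCongr {φ : MulAut G} (hφ : IsTrivialMod q φ) (g : G) :
    AugCongr q 1 (φ g) g := by
  let χ : G →* Multiplicative (ℤ[G] ⧸ augmentationMod q G ^ (1 + 1)) :=
    { toFun := fun g => Multiplicative.ofAdd (Submodule.Quotient.mk (MonoidAlgebra.of ℤ G g - 1))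
      map_one' := by
        rw [_root_.map_one, sub_self]
        rfl
      map_mul' := fun g h => by
        rw [← ofAdd_add, ← Submodule.Quotient.mk_add]
        refine congrArg _ ((Submodule.Quotient.eq _).mpr ?_)
        have h1 := Submodule.mul_mem_mul (of_sub_one_mem_augmentationMod (q := q) g)
          (of_sub_one_mem_augmentationMod (q := q) h)
        rw [pow_succ, pow_one]
        convert h1 using 1
        rw [_root_.map_mul]
        noncomm_ring }
  have hχ : ∀ g, χ g = Multiplicative.ofAdd (Submodule.Quotient.mk (MonoidAlgebra.of ℤ G g - 1)) :=
    fun g => rfl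
  have h := hφ _ χ (fun g => ?_) g
  · rw [hχ, hχ] at h
    have h' := (Submodule.Quotient.eq _).mp (Multiplicative.ofAdd.injective h)
    rwa [sub_sub_sub_cancel_right] at h'
  · rw [hχ, ← ofAdd_nsmul, ← Submodule.Quotient.mk_smul, ← ofAdd_zero]
    refine congrArg _ ((Submodule.Quotient.mk_eq_zero _).mpr ?_)
    have h1 := Submodule.mul_mem_mul (natCast_mem_augmentationMod (q := q))
      (of_sub_one_mem_augmentationMod (q := q) g)
    rw [pow_succ, pow_one, nsmul_eq_mul]
    exact h1

/-- The additive endomorphisms of the group ring which raise the filtration by powers of the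
kernel of the augmentation modulo `q` by `r`. -/
noncomputable def filtrationEnd (q r : ℕ) (G : Type u) [Group G] :
    AddSubgroup (Module.End ℤ ℤ[G]) where
  carrier := {T | ∀ j, ∀ a ∈ augmentationMod q G ^ (j + 1), T a ∈ augmentationMod q G ^ (j + r + 1)}
  zero_mem' _ _ _ := zero_mem _
  add_mem' hS hT j a ha := add_mem (hS j a ha) (hT j a ha)
  neg_mem' hT j a ha := neg_mem (hT j a ha)

theorem mul_mem_filtrationEnd {r s : ℕ} {S T : Module.End ℤ ℤ[G]} (hS : S ∈ filtrationEnd q r G)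
    (hT : T ∈ filtrationEnd q s G) : S * T ∈ filtrationEnd q (s + r) G := by
  intro j a ha
  rw [← add_assoc]
  exact hS _ _ (hT j a ha)

theorem natCast_mem_filtrationEnd : (q : Module.End ℤ ℤ[G]) ∈ filtrationEnd q 1 G := by
  intro j a ha
  rw [Module.End.natCast_apply, pow_succ', nsmul_eq_mul]
  exact Submodule.mul_mem_mul natCast_mem_augmentationMod ha

theorem one_mem_filtrationEnd : (1 : Module.End ℤ ℤ[G]) ∈ filtrationEnd q 0 G :=
  fun _ _ ha => ha

theorem pow_mem_filtrationEnd_zero {T : Module.End ℤ ℤ[G]} (hT : T ∈ filtrationEnd q 0 G) (n : ℕ) :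
    T ^ n ∈ filtrationEnd q 0 G := by
  induction n with
  | zero => exact one_mem_filtrationEnd
  | succ n ih =>
    have h := mul_mem_filtrationEnd ih hT
    rwa [add_zero, ← pow_succ] at h

theorem pow_sub_one_mem_filtrationEnd {r : ℕ} {T : Module.End ℤ ℤ[G]}
    (hT0 : T ∈ filtrationEnd q 0 G) (hT : T - 1 ∈ filtrationEnd q r G) (n : ℕ) :
    T ^ n - 1 ∈ filtrationEnd q r G := by
  have h := mul_mem_filtrationEnd
    (sum_mem (t := Finset.range n) fun i _ => pow_mem_filtrationEnd_zero hT0 i) hT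
  rwa [add_zero, geom_sum_mul] at h

theorem pow_natCast_sub_one_mem_filtrationEnd {r : ℕ} {T : Module.End ℤ ℤ[G]}
    (hT0 : T ∈ filtrationEnd q 0 G) (hT1 : T - 1 ∈ filtrationEnd q 1 G)
    (hT : T - 1 ∈ filtrationEnd q r G) : T ^ q - 1 ∈ filtrationEnd q (r + 1) G := by
  rw [← geom_sum_mul]
  refine mul_mem_filtrationEnd ?_ hT
  have h : ∑ i ∈ Finset.range q, T ^ i = ∑ i ∈ Finset.range q, (T ^ i - 1) + q := by
    rw [Finset.sum_sub_distrib]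
    simp
  rw [h]
  exact add_mem (sum_mem fun i _ => pow_sub_one_mem_filtrationEnd hT0 hT1 i)
    natCast_mem_filtrationEnd

theorem pow_pow_sub_one_mem_filtrationEnd {T : Module.End ℤ ℤ[G]}
    (hT0 : T ∈ filtrationEnd q 0 G) (hT1 : T - 1 ∈ filtrationEnd q 1 G) (m : ℕ) :
    T ^ q ^ m - 1 ∈ filtrationEnd q (m + 1) G := by
  induction m with
  | zero => simpa using hT1
  | succ m ih =>
    rw [pow_succ, pow_mul]
    exact pow_natCast_sub_one_mem_filtrationEnd (pow_mem_filtrationEnd_zero hT0 _)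
      (pow_sub_one_mem_filtrationEnd hT0 hT1 _) ih

theorem IsTrivialMod.sub_one_mem_filtrationEnd {φ : MulAut G} (hφ : IsTrivialMod q φ) :
    (groupRingMap φ.toMonoidHom).toLinearMap - 1 ∈ filtrationEnd q 1 G := by
  intro j
  have hbase : ∀ a ∈ augmentationMod q G, groupRingMap φ.toMonoidHom a - a ∈
      augmentationMod q G ^ 2 := by
    have h : augmentationMod q G ≤ (augmentationMod q G ^ 2).comap
        ((groupRingMap φ.toMonoidHom).toLinearMap - 1) := by
      apply augmentationMod_le
      · simp
      · intro g
        have := hφ.augCongr g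
        change groupRingMap φ.toMonoidHom (MonoidAlgebra.of ℤ G g - 1) -
          (MonoidAlgebra.of ℤ G g - 1) ∈ augmentationMod q G ^ 2
        rw [map_sub, groupRingMap_of, _root_.map_one, sub_sub_sub_cancel_right]
        exact this
    exact fun a ha => h ha
  induction j with
  | zero =>
    intro a ha
    rw [zero_add, pow_one] at ha
    exact hbase a ha
  | succ j ih =>
    intro a ha
    rw [pow_succ] at ha
    induction ha using Submodule.mul_induction_on' with
    | mem_mul_mem a ha b hb =>
      have h1 := Submodule.mul_mem_mul (ih a ha) (groupRingMap_mem_pow (q := q) (k := 1)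
        φ.toMonoidHom (by rwa [pow_one]))
      have h2 := Submodule.mul_mem_mul ha (hbase b hb)
      rw [← pow_add] at h1 h2
      have h3 := add_mem h1 h2
      convert h3 using 1
      simp only [LinearMap.sub_apply, AlgHom.toLinearMap_apply, Module.End.one_apply,
        _root_.map_mul]
      noncomm_ring
    | add a _ b _ ha hb =>
      rw [map_add]
      exact add_mem ha hb

theorem IsTrivialMod.augCongr_pow {φ : MulAut G} (hφ : IsTrivialMod q φ) (m n : ℕ) (g : G) :
    AugCongr q (m + 1) ((φ ^ (q ^ m * n)) g) g := by
  let T := (groupRingMap φ.toMonoidHom).toLinearMap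
  have hT0 : T ∈ filtrationEnd q 0 G := fun j a ha => groupRingMap_mem_pow _ ha
  have hT := pow_sub_one_mem_filtrationEnd (pow_mem_filtrationEnd_zero hT0 _)
    (pow_pow_sub_one_mem_filtrationEnd hT0 hφ.sub_one_mem_filtrationEnd m) n
  rw [← pow_mul] at hT
  have h := hT 0 (MonoidAlgebra.of ℤ G g - 1) (by
    rw [zero_add, pow_one]
    exact of_sub_one_mem_augmentationMod g)
  have hpow : ∀ i (g : G), (T ^ i) (MonoidAlgebra.of ℤ G g) = MonoidAlgebra.of ℤ G ((φ ^ i) g) := by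
    intro i
    induction i with
    | zero => simp
    | succ i ih =>
      intro g
      rw [pow_succ, Module.End.mul_apply, pow_succ, MulAut.mul_apply, ← ih]
      exact congrArg _ (groupRingMap_of _ g)
  have h1 : (T ^ (q ^ m * n)) 1 = 1 := by
    have h1 := hpow (q ^ m * n) 1
    rwa [(φ ^ _).map_one, MonoidHom.map_one] at h1
  rw [LinearMap.sub_apply, map_sub, Module.End.one_apply, hpow, h1, sub_sub_sub_cancel_right,
    zero_add] at h
  exact h

end AugmentationPowers

namespace FreeGroup

section Residual

variable {X : Type u}

/-- Every element of a free group is a product of nontrivial powers of generators in which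
consecutive generators are distinct. -/
theorem exists_syllables (g : FreeGroup X) : ∃ L : List (X × ℤ),
    L.IsChain (fun a b => a.1 ≠ b.1) ∧ (∀ a ∈ L, a.2 ≠ 0) ∧
      g = (L.map fun a => of a.1 ^ a.2).prod := by
  classical
  have hpow : ∀ (x : X) (n : ℤ), n ≠ 0 → ∀ g : FreeGroup X, (∃ L : List (X × ℤ),
      L.IsChain (fun a b => a.1 ≠ b.1) ∧ (∀ a ∈ L, a.2 ≠ 0) ∧
        g = (L.map fun a => of a.1 ^ a.2).prod) → ∃ L : List (X × ℤ),
      L.IsChain (fun a b => a.1 ≠ b.1) ∧ (∀ a ∈ L, a.2 ≠ 0) ∧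
        of x ^ n * g = (L.map fun a => of a.1 ^ a.2).prod := by
    rintro x n hn g ⟨L, hL, hL0, rfl⟩
    rcases L with _ | ⟨⟨y, e⟩, t⟩
    · exact ⟨[(x, n)], by simp, by simpa using hn, by simp⟩
    · by_cases hxy : x = y
      · subst hxy
        by_cases he : n + e = 0
        · refine ⟨t, hL.tail, fun a ha => hL0 a (List.mem_cons_of_mem _ ha), ?_⟩
          rw [List.map_cons, List.prod_cons, ← mul_assoc, ← zpow_add, he, zpow_zero, one_mul]
        · refine ⟨(x, n + e) :: t, ?_, ?_, ?_⟩
          · rw [List.isChain_cons] at hL ⊢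
            exact hL
          · intro a ha
            rcases List.mem_cons.mp ha with rfl | ha
            exacts [he, hL0 a (List.mem_cons_of_mem _ ha)]
          · rw [List.map_cons, List.prod_cons, List.map_cons, List.prod_cons, ← mul_assoc,
              ← zpow_add]
      · refine ⟨(x, n) :: (y, e) :: t, List.isChain_cons_cons.mpr ⟨hxy, hL⟩, ?_, ?_⟩
        · intro a ha
          rcases List.mem_cons.mp ha with rfl | ha
          exacts [hn, hL0 a ha]
        · rw [List.map_cons (a := (x, n)), List.prod_cons (a := of x ^ n)]
  have hall : ∀ g h : FreeGroup X, (∃ L : List (X × ℤ),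
      L.IsChain (fun a b => a.1 ≠ b.1) ∧ (∀ a ∈ L, a.2 ≠ 0) ∧
        h = (L.map fun a => of a.1 ^ a.2).prod) → ∃ L : List (X × ℤ),
      L.IsChain (fun a b => a.1 ≠ b.1) ∧ (∀ a ∈ L, a.2 ≠ 0) ∧
        g * h = (L.map fun a => of a.1 ^ a.2).prod := by
    intro g
    induction g using FreeGroup.induction_on with
    | C1 => simp
    | of x =>
      intro h hh
      simpa using hpow x 1 one_ne_zero h hh
    | inv_of x =>
      intro h hh
      simpa using hpow x (-1) (by decide) h hh
    | mul g g' hg hg' =>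
      intro h hh
      rw [mul_assoc]
      exact hg _ (hg' h hh)
  simpa using hall g 1 ⟨[], by simp, by simp, by simp⟩

open Classical in
/-- The operator removing the head of a list if it is the only copy of `x` at its beginning. -/
noncomputable def headShift (x : X) : Module.End ℤ (List X → ℤ) where
  toFun v l := if l.head? = some x ∧ l.tail.head? ≠ some x then v l.tail else 0
  map_add' v w := by
    ext l
    simp only [Pi.add_apply]
    split_ifs <;> simp
  map_smul' c v := by
    ext l
    simp only [Pi.smul_apply]
    split_ifs <;> simp

theorem headShift_mul_self (x : X) : headShift x * headShift x = 0 := by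
  classical
  ext v l
  change (if _ then (if _ then _ else _) else _) = (0 : ℤ)
  split_ifs with h1 h2
  · exact absurd h2.1 h1.2
  · rfl
  · rfl

theorem headShift_apply_of_length {n : ℕ} {v : List X → ℤ} (hv : ∀ l, n < l.length → v l = 0)
    (x : X) {l : List X} (hl : n + 1 < l.length) : headShift x v l = 0 := by
  classical
  change (if _ then _ else _) = (0 : ℤ)
  split_ifs
  · exact hv _ (by rw [List.length_tail]; omega)
  · rfl

/-- The unitriangular representation of a free group sending each generator `x` to
`1 + q * headShift x`. -/
noncomputable def shiftRep (q : ℕ) : FreeGroup X →* (Module.End ℤ (List X → ℤ))ˣ :=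
  FreeGroup.lift fun x =>
    { val := 1 + (q : ℤ) • headShift x
      inv := 1 - (q : ℤ) • headShift x
      val_inv := by
        rw [add_mul, mul_sub, one_mul, mul_sub, smul_mul_smul_comm, headShift_mul_self]
        simp
      inv_val := by
        rw [sub_mul, mul_add, one_mul, mul_add, smul_mul_smul_comm, headShift_mul_self]
        simp }

theorem shiftRep_of_zpow (q : ℕ) (x : X) (n : ℤ) :
    ((shiftRep q (of x ^ n) : (Module.End ℤ (List X → ℤ))ˣ) : Module.End ℤ (List X → ℤ)) =
      1 + (q * n : ℤ) • headShift x := by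
  have hmul : ∀ a b : ℤ, (1 + a • headShift x) * (1 + b • headShift x) =
      1 + (a + b) • headShift x := by
    intro a b
    rw [add_mul, mul_add, mul_add, one_mul, one_mul, mul_one, smul_mul_smul_comm,
      headShift_mul_self, smul_zero, add_zero, add_smul]
    abel
  induction n with
  | zero => simp
  | succ n ih =>
    rw [zpow_add_one, _root_.map_mul, Units.val_mul, ih]
    have h1 : ((shiftRep q (of x) : (Module.End ℤ (List X → ℤ))ˣ) :
        Module.End ℤ (List X → ℤ)) = 1 + (q : ℤ) • headShift x := by
      rw [shiftRep, lift_apply_of]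
    rw [h1, hmul, mul_add, mul_one]
  | pred n ih =>
    rw [zpow_sub_one, _root_.map_mul, Units.val_mul, ih]
    have h1 : ((shiftRep q (of x)⁻¹ : (Module.End ℤ (List X → ℤ))ˣ) :
        Module.End ℤ (List X → ℤ)) = 1 + (-q : ℤ) • headShift x := by
      rw [_root_.map_inv, shiftRep, lift_apply_of, neg_smul, ← sub_eq_add_neg]
      rfl
    rw [h1, hmul, mul_sub, mul_one, sub_eq_add_neg]

open Classical in
theorem shiftRep_prod_apply (q : ℕ) (L : List (X × ℤ)) (hL : L.IsChain fun a b => a.1 ≠ b.1) :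
    (∀ l : List X, L.length < l.length → (shiftRep q (L.map fun a => of a.1 ^ a.2).prod :
      Module.End ℤ (List X → ℤ)) (Pi.single [] 1) l = 0) ∧
    (shiftRep q (L.map fun a => of a.1 ^ a.2).prod :
      Module.End ℤ (List X → ℤ)) (Pi.single [] 1) (L.map Prod.fst) =
        (L.map fun a => (q * a.2 : ℤ)).prod := by
  induction L with
  | nil =>
    refine ⟨fun l hl => ?_, by simp⟩
    have : l ≠ [] := by
      rintro rfl
      exact absurd hl (lt_irrefl _)
    simp [this]
  | cons a t ih =>
    obtain ⟨h1, h2⟩ := ih hL.tail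
    rw [List.map_cons, List.prod_cons, _root_.map_mul, Units.val_mul, shiftRep_of_zpow]
    set v := (shiftRep q (t.map fun a => of a.1 ^ a.2).prod :
      Module.End ℤ (List X → ℤ)) (Pi.single [] 1) with hv
    have hstep : ∀ l, ((1 + (q * a.2 : ℤ) • headShift a.1) * (shiftRep q
        (t.map fun a => of a.1 ^ a.2).prod : Module.End ℤ (List X → ℤ))) (Pi.single [] 1) l =
        v l + (q * a.2) * headShift a.1 v l := by
      intro l
      rfl
    refine ⟨fun l hl => ?_, ?_⟩
    · rw [List.length_cons] at hl
      rw [hstep, h1 l (by omega), headShift_apply_of_length h1 _ hl, mul_zero, add_zero]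
    · rw [hstep, h1 _ (by simp), zero_add, List.map_cons, List.map_cons, List.prod_cons, ← h2]
      congr 1
      refine if_pos ⟨rfl, ?_⟩
      rw [List.isChain_cons] at hL
      rw [List.tail_cons, List.head?_map]
      intro h
      obtain ⟨b, hb, hba⟩ := Option.map_eq_some_iff.mp h
      exact hL.1 b hb hba.symm

/-- The additive endomorphisms whose values are divisible by `c`. -/
def divisibleEnd (c : ℤ) (I : Type u) : Submodule ℤ (Module.End ℤ (I → ℤ)) where
  carrier := {T | ∀ v i, c ∣ T v i}
  zero_mem' _ _ := dvd_zero _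
  add_mem' hS hT v i := dvd_add (hS v i) (hT v i)
  smul_mem' n _ hT v i := Dvd.dvd.mul_left (hT v i) n

theorem divisibleEnd_mul_le (c d : ℤ) (I : Type u) :
    divisibleEnd c I * divisibleEnd d I ≤ divisibleEnd (c * d) I := by
  rw [Submodule.mul_le]
  intro S hS T hT v i
  choose w hw using hT v
  have h : T v = d • w := by
    ext j
    exact hw j
  rw [Module.End.mul_apply, h, map_smul, mul_comm]
  exact mul_dvd_mul_left d (hS w i)

theorem divisibleEnd_pow_le (c : ℤ) (I : Type u) (k : ℕ) :
    divisibleEnd c I ^ k ≤ divisibleEnd (c ^ k) I := by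
  induction k with
  | zero =>
    intro T _ v i
    simp
  | succ k ih =>
    rw [pow_succ c, pow_succ (divisibleEnd c I)]
    exact (mul_le_mul_left ih _).trans (divisibleEnd_mul_le _ _ _)

theorem shiftRep_sub_one_mem (q : ℕ) (g : FreeGroup X) :
    (shiftRep q g : Module.End ℤ (List X → ℤ)) - 1 ∈ divisibleEnd (q : ℤ) (List X) := by
  have hmul : ∀ S T : Module.End ℤ (List X → ℤ), S - 1 ∈ divisibleEnd (q : ℤ) (List X) →
      T - 1 ∈ divisibleEnd (q : ℤ) (List X) → S * T - 1 ∈ divisibleEnd (q : ℤ) (List X) := by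
    intro S T hS hT v i
    have h : (S * T - 1) v i = (S - 1) (T v) i + (T - 1) v i := by
      simp [LinearMap.sub_apply]
    rw [h]
    exact dvd_add (hS _ _) (hT _ _)
  have hgen : ∀ (x : X) (n : ℤ), (shiftRep q (of x ^ n) : Module.End ℤ (List X → ℤ)) - 1 ∈
      divisibleEnd (q : ℤ) (List X) := by
    intro x n v i
    rw [shiftRep_of_zpow, add_sub_cancel_left, LinearMap.smul_apply, Pi.smul_apply, smul_eq_mul,
      mul_assoc]
    exact dvd_mul_right _ _
  induction g using FreeGroup.induction_on with
  | C1 =>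
    rw [_root_.map_one, Units.val_one, sub_self]
    exact zero_mem _
  | of x => simpa using hgen x 1
  | inv_of x => simpa using hgen x (-1)
  | mul g h hg hh =>
    rw [_root_.map_mul, Units.val_mul]
    exact hmul _ _ hg hh

/-- The powers of the augmentation ideal modulo `q` separate the elements of a free group. -/
theorem eq_of_augCongr {q : ℕ} (hq : 2 ≤ q) {g h : FreeGroup X} (hgh : ∀ k, AugCongr q k g h) :
    g = h := by
  classical
  rw [← mul_inv_eq_one]
  have hgh' : ∀ k, AugCongr q k (g * h⁻¹) 1 := fun k => by
    have := (hgh k).mul_right h⁻¹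
    rwa [mul_inv_cancel] at this
  generalize g * h⁻¹ = g at hgh'
  obtain ⟨L, hL, hL0, rfl⟩ := exists_syllables g
  by_contra hne
  set g := (L.map fun a => of a.1 ^ a.2).prod with hg
  let Θ : MonoidAlgebra ℤ (FreeGroup X) →ₐ[ℤ] Module.End ℤ (List X → ℤ) :=
    MonoidAlgebra.lift ℤ _ _ ((Units.coeHom _).comp (shiftRep q))
  have hΘ : ∀ g, Θ (MonoidAlgebra.of ℤ _ g) = shiftRep q g := fun g => MonoidAlgebra.lift_of _ _
  have hJ : (augmentationMod q (FreeGroup X)).map Θ.toLinearMap ≤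
      divisibleEnd (q : ℤ) (List X) := by
    rw [Submodule.map_le_iff_le_comap]
    apply augmentationMod_le
    · rw [Submodule.mem_comap, AlgHom.toLinearMap_apply, map_natCast]
      intro v i
      rw [Module.End.natCast_apply, Pi.smul_apply, nsmul_eq_mul]
      exact dvd_mul_right _ _
    · intro g
      rw [Submodule.mem_comap, AlgHom.toLinearMap_apply, map_sub, hΘ, _root_.map_one]
      exact shiftRep_sub_one_mem q g
  have hdvd : ∀ k : ℕ, (q : ℤ) ^ (k + 1) ∣ (L.map fun a => (q * a.2 : ℤ)).prod := by
    intro k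
    have h1 := pow_le_pow_left' hJ (k + 1)
    rw [← Submodule.map_pow] at h1
    have h2 := divisibleEnd_pow_le _ _ _ (h1 ⟨_, hgh' k, rfl⟩) (Pi.single [] 1) (L.map Prod.fst)
    rw [AlgHom.toLinearMap_apply, map_sub, hΘ, _root_.map_one, _root_.map_one,
      LinearMap.sub_apply, Pi.sub_apply, hg, (shiftRep_prod_apply q L hL).2,
      Module.End.one_apply, Pi.single_eq_of_ne, sub_zero] at h2
    · exact h2
    · intro h
      rw [List.map_eq_nil_iff] at h
      rw [hg, h] at hne
      simp at hne
  have hprod : (L.map fun a => (q * a.2 : ℤ)).prod ≠ 0 := by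
    intro h
    rw [List.prod_eq_zero_iff] at h
    obtain ⟨a, ha, h⟩ := List.mem_map.mp h
    rcases mul_eq_zero.mp h with h | h
    · rw [Nat.cast_eq_zero] at h
      omega
    · exact hL0 a ha h
  obtain ⟨n, hn⟩ := Nat.exists_eq_succ_of_ne_zero (Int.natAbs_ne_zero.mpr hprod)
  have h1 := Int.natAbs_dvd_natAbs.mpr (hdvd n)
  rw [hn, Int.natAbs_pow, Int.natAbs_natCast] at h1
  have h2 := Nat.le_of_dvd (Nat.succ_pos n) h1
  have h3 := Nat.lt_pow_self (n := n + 1) (show 1 < q by omega)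
  omega

end Residual

end FreeGroup

section Roots

open MonoidAlgebra

theorem MonoidAlgebra.exists_pow_eq_of_twoUniqueProds {H : Type*} [Group H] [TwoUniqueProds H]
    {D : MonoidAlgebra ℤ H} {p : ℕ} (hp : p ≠ 0) {w : H} (hD : D ^ p = of ℤ H w) :
    ∃ v, v ^ p = w := by
  classical
  have hmul : D * D ^ (p - 1) = of ℤ H w := by rw [mul_pow_sub_one hp, hD]
  have hw : ∀ a b, UniqueMul D.coeff.support (D ^ (p - 1)).coeff.support a b →
      a ∈ D.coeff.support → b ∈ (D ^ (p - 1)).coeff.support → a * b = w := by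
    intro a b hab ha hb
    by_contra hne
    have h := coeff_mul_mul_of_uniqueMul hab
    rw [hmul, of_apply, coeff_single, Finsupp.single_eq_of_ne hne] at h
    rw [Finsupp.mem_support_iff] at ha hb
    exact mul_ne_zero ha hb h.symm
  have hne : of ℤ H w ≠ 0 := by simp [of_apply]
  have hcard : D.coeff.support.card ≤ 1 := by
    by_contra hlt
    have h2 : 0 < (D ^ (p - 1)).coeff.support.card := by
      rw [Finset.card_pos, Finsupp.support_nonempty_iff]
      intro h
      rw [coeff_eq_zero] at h
      rw [h, mul_zero] at hmul
      exact hne hmul.symm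
    obtain ⟨x, hx, y, hy, hxy, ux, uy⟩ := TwoUniqueProds.uniqueMul_of_one_lt_card
      (lt_of_lt_of_le (not_le.mp hlt) (Nat.le_mul_of_pos_right _ h2))
    rw [Finset.mem_product] at hx hy
    have := ux hy.1 hy.2 ((hw _ _ uy hy.1 hy.2).trans (hw _ _ ux hx.1 hx.2).symm)
    exact hxy (Prod.ext this.1.symm this.2.symm)
  obtain ⟨v, c, hvc⟩ := Finsupp.card_support_le_one'.mp hcard
  have hD' : D = single v c := by
    ext1
    rw [hvc, coeff_single]
  refine ⟨v, ?_⟩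
  by_contra hvw
  rw [hD', single_pow, of_apply] at hD
  have h := congrArg (fun a => a.coeff w) hD
  simp only [coeff_single, Finsupp.single_eq_same] at h
  rw [Finsupp.single_eq_of_ne (Ne.symm hvw)] at h
  exact zero_ne_one h

theorem FreeGroup.twoUniqueProds_of_subsingleton (C : Type*) [Subsingleton C] :
    TwoUniqueProds (FreeGroup C) := by
  rcases isEmpty_or_nonempty C with hC | ⟨⟨c⟩⟩
  · exact TwoUniqueProds.of_injective_mulHom
      ((1 : FreeGroup C →* Multiplicative ℤ) : FreeGroup C →ₙ* Multiplicative ℤ)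
      (Function.injective_of_subsingleton _) inferInstance
  · have : Unique C := { default := c, uniq := fun _ => Subsingleton.elim _ _ }
    exact FreeGroup.mulEquivIntOfUnique.twoUniqueProds_iff.mpr inferInstance

/-- A free group with nontrivial center has unique products. -/
theorem IsFreeGroup.twoUniqueProds_of_mem_center {H : Type*} [Group H] [IsFreeGroup H] {z : H}
    (hz : z ∈ Subgroup.center H) (hz1 : z ≠ 1) : TwoUniqueProds H := by
  let e := IsFreeGroup.mulEquiv H
  have : Subsingleton (IsFreeGroup.Generators H) := by
    by_contra h
    rw [not_subsingleton_iff_nontrivial] at h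
    obtain ⟨x, y, hxy⟩ := h
    have hcomm : ∀ g, Commute (e.symm z) g := by
      intro g
      apply e.injective
      rw [map_mul, map_mul, e.apply_symm_apply]
      exact (Subgroup.mem_center_iff.mp hz _).symm
    exact hz1 (e.symm.map_eq_one_iff.mp (FreeGroup.eq_one_of_commute hxy (hcomm _) (hcomm _)))
  exact e.twoUniqueProds_iff.mp (FreeGroup.twoUniqueProds_of_subsingleton _)

theorem MonoidAlgebra.coeff_conj_of_commute {G : Type*} [Group G] {D : MonoidAlgebra ℤ G} {w : G}
    (h : Commute D (of ℤ G w)) (n : ℕ) (f : G) :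
    D.coeff (w ^ n * f * (w ^ n)⁻¹) = D.coeff f := by
  have h1 : D * single (w ^ n) 1 = single (w ^ n) 1 * D := by
    have := (h.pow_right n).eq
    rwa [← map_pow, of_apply] at this
  have h2 := congrArg (fun a => a.coeff (w ^ n * f)) h1
  simpa [coeff_mul_single_apply, coeff_single_mul_apply] using h2

/-- If a root in the group ring commutes with `w`, its support commutes with a power of `w`. -/
theorem MonoidAlgebra.exists_pow_commute_of_commute {G : Type*} [Group G] {D : MonoidAlgebra ℤ G}
    {w : G} (h : Commute D (of ℤ G w)) :
    ∃ M : ℕ, M ≠ 0 ∧ ∀ f ∈ D.coeff.support, Commute (w ^ M) f := by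
  have hf : ∀ f ∈ D.coeff.support, ∃ M : ℕ, M ≠ 0 ∧ Commute (w ^ M) f := by
    intro f hf
    have hmem : ∀ n : ℕ, w ^ n * f * (w ^ n)⁻¹ ∈ D.coeff.support := by
      intro n
      rw [Finsupp.mem_support_iff, coeff_conj_of_commute h]
      exact Finsupp.mem_support_iff.mp hf
    obtain ⟨a, b, hab, heq⟩ := Finite.exists_ne_map_eq_of_infinite
      fun n : ℕ => (⟨_, hmem n⟩ : D.coeff.support)
    rw [Subtype.mk.injEq] at heq
    have key : ∀ a b : ℕ, a < b → w ^ a * f * (w ^ a)⁻¹ = w ^ b * f * (w ^ b)⁻¹ →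
        ∃ M : ℕ, M ≠ 0 ∧ Commute (w ^ M) f := by
      intro a b hab heq
      refine ⟨b - a, by omega, ?_⟩
      obtain ⟨c, rfl⟩ := Nat.exists_eq_add_of_lt hab
      rw [show a + c + 1 - a = c + 1 by omega]
      rw [add_assoc, pow_add, mul_inv_rev, ← mul_assoc, mul_left_inj, mul_assoc, mul_assoc,
        mul_right_inj, ← mul_assoc, eq_mul_inv_iff_mul_eq] at heq
      exact heq.symm
    rcases lt_or_gt_of_ne hab with hlt | hlt
    exacts [key a b hlt heq, key b a hlt heq.symm]
  choose! M hM hcomm using hf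
  refine ⟨∏ f ∈ D.coeff.support, M f, Finset.prod_ne_zero_iff.mpr hM, fun f hf => ?_⟩
  obtain ⟨k, hk⟩ := Finset.dvd_prod_of_mem M hf
  rw [hk, pow_mul]
  exact (hcomm f hf).pow_left k

/-- A root in the group ring of a nontrivial element of a free group yields a root in the group. -/
theorem FreeGroup.exists_pow_eq_of_groupRing {Y : Type*} {D : MonoidAlgebra ℤ (FreeGroup Y)}
    {p : ℕ} (hp : p ≠ 0) {w : FreeGroup Y} (hw : w ≠ 1) (hD : D ^ p = MonoidAlgebra.of ℤ _ w) :
    ∃ v, v ^ p = w := by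
  obtain ⟨M, hM, hcomm⟩ := exists_pow_commute_of_commute
    (show Commute D (MonoidAlgebra.of ℤ _ w) from hD ▸ (Commute.refl D).pow_right p)
  let H := Subgroup.centralizer {w ^ M}
  have hmem : ∀ {f}, Commute (w ^ M) f → f ∈ H := fun h =>
    Subgroup.mem_centralizer_singleton_iff.mpr h.symm.eq
  let i := mapDomainAlgHom ℤ ℤ H.subtype
  have hi : Function.Injective i := mapDomain_injective H.subtype_injective
  have hrange : D ∈ i.range := by
    rw [← sum_coeff_single D]
    refine i.range.sum_mem fun f hf => ⟨single ⟨f, hmem (hcomm f hf)⟩ (D.coeff f), ?_⟩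
    simp [i, mapDomain_single]
  obtain ⟨E, hE⟩ := hrange
  have hwH : w ∈ H := hmem ((Commute.refl w).pow_left M)
  have hE' : E ^ p = MonoidAlgebra.of ℤ H ⟨w, hwH⟩ := by
    apply hi
    rw [map_pow]
    change i E = D at hE
    rw [hE, hD]
    simp [i, MonoidAlgebra.of_apply, mapDomain_single]
  have : TwoUniqueProds H := by
    refine IsFreeGroup.twoUniqueProds_of_mem_center (z := ⟨w ^ M, hmem (Commute.refl _)⟩) ?_ ?_
    · rw [Subgroup.mem_center_iff]
      intro g
      exact Subtype.ext (Subgroup.mem_centralizer_singleton_iff.mp g.2)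
    · intro h
      exact hw ((pow_eq_one_iff_left hM).mp (congrArg Subtype.val h))
  obtain ⟨v, hv⟩ := exists_pow_eq_of_twoUniqueProds hp hE'
  exact ⟨v, congrArg Subtype.val hv⟩

end Roots

section Torsion

theorem IsTrivialMod.conj {G : Type u} [Group G] (q : ℕ) (w : G) :
    IsTrivialMod q (MulAut.conj w) := by
  intro A _ χ _ g
  rw [MulAut.conj_apply, map_mul, map_mul, map_inv, mul_inv_cancel_comm]

theorem IsTrivialMod.mul {G : Type u} [Group G] {q : ℕ} {φ ψ : MulAut G} (hφ : IsTrivialMod q φ)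
    (hψ : IsTrivialMod q ψ) : IsTrivialMod q (φ * ψ) := by
  intro A _ χ hχ g
  rw [MulAut.mul_apply, hφ A χ hχ, hψ A χ hχ]

namespace FreeGroup

variable {Y : Type u}

theorem exists_mul_eq_one_add {p q : ℕ} (hpq : p.Coprime q) (hq : 2 ≤ q) (m : ℕ) :
    ∃ s l, p * s = 1 + q ^ (m + 1) * l := by
  obtain ⟨s, -, hs⟩ := Nat.exists_mul_mod_eq_one_of_coprime (hpq.pow_right (m + 1))
    (Nat.one_lt_pow (Nat.succ_ne_zero m) hq)
  refine ⟨s, p * s / q ^ (m + 1), ?_⟩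
  have h := Nat.mod_add_div (p * s) (q ^ (m + 1))
  rw [hs] at h
  exact h.symm

theorem eq_of_augCongr_add_two {q : ℕ} (hq : 2 ≤ q) {g h : FreeGroup Y}
    (hgh : ∀ m, AugCongr q (m + 2) g h) : g = h :=
  eq_of_augCongr hq fun k => (hgh k).of_succ.of_succ

section PowEqConj

variable {p q : ℕ} {φ : MulAut (FreeGroup Y)} {w : FreeGroup Y}

theorem exists_augCongr_conj (hpq : p.Coprime q) (hq : 2 ≤ q) (hφ : IsTrivialMod q φ)
    (hw : φ ^ p = MulAut.conj w) (m : ℕ) :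
    ∃ s l, p * s = 1 + q ^ (m + 1) * l ∧
      ∀ g, AugCongr q (m + 2) (φ g) (w ^ s * g * (w ^ s)⁻¹) := by
  obtain ⟨s, l, hs⟩ := exists_mul_eq_one_add hpq hq m
  refine ⟨s, l, hs, fun g => ?_⟩
  have h := ((hφ.augCongr_pow (m + 1) l g).map φ.toMonoidHom).symm
  have h1 : φ ((φ ^ (q ^ (m + 1) * l)) g) = w ^ s * g * (w ^ s)⁻¹ := by
    rw [← MulAut.mul_apply, ← pow_succ', add_comm, ← hs, pow_mul, hw, ← map_pow,
      MulAut.conj_apply]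
  change AugCongr q (m + 2) (φ g) (φ ((φ ^ (q ^ (m + 1) * l)) g)) at h
  rwa [h1] at h

theorem eq_one_of_isTrivialMod (hpq : p.Coprime q) (hq : 2 ≤ q) (hφ : IsTrivialMod q φ)
    (hw : φ ^ p = 1) : φ = 1 := by
  ext g
  refine eq_of_augCongr_add_two hq fun m => ?_
  obtain ⟨s, l, -, h⟩ := exists_augCongr_conj hpq hq hφ (w := 1) (by rw [hw, _root_.map_one]) m
  simpa using h g

/-- The affine action on the group ring encoding the Fox derivative with respect to `x`. -/
noncomputable def foxAction [DecidableEq Y] (x : Y) :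
    FreeGroup Y →* Equiv.Perm (MonoidAlgebra ℤ (FreeGroup Y)) :=
  lift fun y => if y = x then Equiv.addRight 1 else
    (Units.map (MonoidAlgebra.of ℤ (FreeGroup Y)) (toUnits (of y))).mulLeft

/-- The endomorphism erasing the generator `x`. -/
def eraseGenerator [DecidableEq Y] (x : Y) : FreeGroup Y →* FreeGroup Y :=
  lift fun y => if y = x then 1 else of y

/-- The endomorphism sending the generator `x` to `u` and fixing all other generators. -/
def replaceGenerator [DecidableEq Y] (x : Y) (u : FreeGroup Y) : FreeGroup Y →* FreeGroup Y :=
  lift fun y => if y = x then u else of y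

variable [DecidableEq Y] {x : Y} {u : FreeGroup Y}

theorem foxAction_of_self (a : MonoidAlgebra ℤ (FreeGroup Y)) :
    foxAction x (of x) a = a + 1 := by
  simp [foxAction]

theorem foxAction_of_ne {y : Y} (h : y ≠ x) (a : MonoidAlgebra ℤ (FreeGroup Y)) :
    foxAction x (of y) a = MonoidAlgebra.of ℤ _ (of y) * a := by
  simp [foxAction, h]

theorem foxAction_apply (f : FreeGroup Y) (a : MonoidAlgebra ℤ (FreeGroup Y)) :
    foxAction x f a = MonoidAlgebra.of ℤ _ (eraseGenerator x f) * a + foxAction x f 0 := by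
  have hmul : ∀ f g, (∀ a, foxAction x f a = MonoidAlgebra.of ℤ _ (eraseGenerator x f) * a +
      foxAction x f 0) → (∀ a, foxAction x g a = MonoidAlgebra.of ℤ _ (eraseGenerator x g) * a +
      foxAction x g 0) → ∀ a, foxAction x (f * g) a =
      MonoidAlgebra.of ℤ _ (eraseGenerator x (f * g)) * a + foxAction x (f * g) 0 := by
    intro f g hf hg a
    rw [_root_.map_mul, Equiv.Perm.mul_apply, Equiv.Perm.mul_apply, hg, hf, hf (foxAction x g 0),
      _root_.map_mul, _root_.map_mul, mul_add, mul_assoc, add_assoc]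
  have hinv : ∀ f, (∀ a, foxAction x f a = MonoidAlgebra.of ℤ _ (eraseGenerator x f) * a +
      foxAction x f 0) → ∀ a, foxAction x f⁻¹ a = MonoidAlgebra.of ℤ _ (eraseGenerator x f⁻¹) * a +
      foxAction x f⁻¹ 0 := by
    intro f hf a
    apply (foxAction x f).injective
    have h0 := hf (foxAction x f⁻¹ 0)
    rw [hf (_ + _), mul_add, add_assoc, ← h0, ← mul_assoc, ← _root_.map_mul, ← _root_.map_mul,
      mul_inv_cancel, _root_.map_one, _root_.map_one, one_mul]
    simp [_root_.map_inv]
  have hof : ∀ y a, foxAction x (of y) a = MonoidAlgebra.of ℤ _ (eraseGenerator x (of y)) * a +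
      foxAction x (of y) 0 := by
    intro y a
    by_cases h : y = x
    · subst h
      simp [foxAction_of_self, eraseGenerator, ← MonoidAlgebra.one_def]
    · simp [foxAction_of_ne h, eraseGenerator, h]
  induction f using FreeGroup.induction_on generalizing a with
  | C1 => simp [← MonoidAlgebra.one_def]
  | of y => exact hof y a
  | inv_of y => exact hinv _ (hof y) a
  | mul f g hf hg => exact hmul f g hf hg a

theorem foxAction_of_mem_closure {f : FreeGroup Y} (hf : f ∈ Subgroup.closure (of '' {x}ᶜ))
    (a : MonoidAlgebra ℤ (FreeGroup Y)) : foxAction x f a = MonoidAlgebra.of ℤ _ f * a := by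
  induction hf using Subgroup.closure_induction generalizing a with
  | mem f hf =>
    obtain ⟨y, hy, rfl⟩ := hf
    exact foxAction_of_ne hy a
  | one => simp [← MonoidAlgebra.one_def]
  | mul f g _ _ hf hg => rw [_root_.map_mul, Equiv.Perm.mul_apply, hg, hf, _root_.map_mul, mul_assoc]
  | inv f _ hf =>
    apply (foxAction x f).injective
    rw [hf (_ * a), ← mul_assoc, ← _root_.map_mul, mul_inv_cancel, _root_.map_one, one_mul]
    simp [_root_.map_inv]

theorem replaceGenerator_of_mem_closure {f : FreeGroup Y} (hf : f ∈ Subgroup.closure (of '' {x}ᶜ)) :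
    replaceGenerator x u f = f := by
  refine MonoidHom.eqOn_closure (f := replaceGenerator x u) (g := MonoidHom.id _) ?_ hf
  rintro - ⟨y, hy, rfl⟩
  have hy' : y ≠ x := hy
  simp [replaceGenerator, hy']

theorem eraseGenerator_eq : eraseGenerator x = replaceGenerator x 1 := rfl

theorem replaceGenerator_of_self : replaceGenerator x u (of x) = u := by simp [replaceGenerator]

theorem foxAction_replaceGenerator (hu : eraseGenerator x u = 1) (f : FreeGroup Y)
    (a : MonoidAlgebra ℤ (FreeGroup Y)) :
    foxAction x (replaceGenerator x u f) (a * foxAction x u 0) =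
      foxAction x f a * foxAction x u 0 := by
  have hof : ∀ y a, foxAction x (replaceGenerator x u (of y)) (a * foxAction x u 0) =
      foxAction x (of y) a * foxAction x u 0 := by
    intro y a
    by_cases h : y = x
    · subst h
      rw [replaceGenerator_of_self, foxAction_apply, hu, foxAction_of_self, _root_.map_one, one_mul,
        add_one_mul]
    · simp [replaceGenerator, h, foxAction_of_ne h, mul_assoc]
  induction f using FreeGroup.induction_on generalizing a with
  | C1 => simp
  | of y => exact hof y a
  | inv_of y =>
    apply (foxAction x (replaceGenerator x u (of y))).injective
    rw [hof]
    simp [_root_.map_inv]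
  | mul f g hf hg =>
    rw [_root_.map_mul (replaceGenerator x u), _root_.map_mul (foxAction x),
      _root_.map_mul (foxAction x),
      Equiv.Perm.mul_apply, Equiv.Perm.mul_apply, hg, hf]

theorem foxAction_iterate_replaceGenerator (hu : eraseGenerator x u = 1) (n : ℕ) :
    foxAction x ((replaceGenerator x u)^[n] (of x)) 0 = foxAction x u 0 ^ n := by
  induction n with
  | zero => simp [foxAction_of_self]
  | succ n ih =>
    have h := foxAction_replaceGenerator hu ((replaceGenerator x u)^[n] (of x)) 0
    rwa [zero_mul, ih, ← pow_succ, ← Function.iterate_succ_apply' (replaceGenerator x u)] at h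

omit [DecidableEq Y] in
theorem exists_mem_closure_compl_singleton [Infinite Y] (w : FreeGroup Y) :
    ∃ x, w ∈ Subgroup.closure (of '' {x}ᶜ) := by
  classical
  obtain ⟨x, hx⟩ := Infinite.exists_notMem_finset (w.toWord.map Prod.fst).toFinset
  refine ⟨x, mem_closure_of_image_iff.mpr fun a ha hax => hx ?_⟩
  rw [List.mem_toFinset, List.mem_map]
  exact ⟨a, ha, hax⟩

omit [DecidableEq Y] in
/-- If an automorphism acts trivially modulo `q` and its `p`-th power is conjugation by `w ≠ 1`,
for `p` coprime to `q`, then `w` is a `p`-th power. -/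
theorem exists_pow_eq_of_pow_eq_conj [Infinite Y] (hp : p ≠ 0) (hpq : p.Coprime q) (hq : 2 ≤ q)
    (hφ : IsTrivialMod q φ) (hw : φ ^ p = MulAut.conj w) (hw1 : w ≠ 1) : ∃ v, v ^ p = w := by
  classical
  obtain ⟨x, hx⟩ := exists_mem_closure_compl_singleton w
  have hfix : ∀ u, replaceGenerator x u w = w := fun u => replaceGenerator_of_mem_closure hx
  have herase : eraseGenerator x (φ (of x)) = 1 := by
    refine eq_of_augCongr_add_two hq fun m => ?_
    obtain ⟨s, l, -, h⟩ := exists_augCongr_conj hpq hq hφ hw m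
    have h1 := (h (of x)).map (eraseGenerator x)
    rwa [_root_.map_mul, _root_.map_mul, _root_.map_inv, eraseGenerator_eq, replaceGenerator_of_self,
      mul_one, mul_inv_cancel] at h1
  have hiter : (replaceGenerator x (φ (of x)))^[p] (of x) = w * of x * w⁻¹ := by
    refine eq_of_augCongr_add_two hq fun m => ?_
    obtain ⟨s, l, hs, h⟩ := exists_augCongr_conj hpq hq hφ hw m
    have hn : ∀ n, AugCongr q (m + 2) ((replaceGenerator x (φ (of x)))^[n] (of x))
        (w ^ (n * s) * of x * (w ^ (n * s))⁻¹) := by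
      intro n
      induction n with
      | zero => simpa using AugCongr.refl _
      | succ n ih =>
        have h1 := ih.map (replaceGenerator x (φ (of x)))
        rw [← Function.iterate_succ_apply' (replaceGenerator x (φ (of x))), _root_.map_mul,
          _root_.map_mul, _root_.map_inv,
          _root_.map_pow, hfix, replaceGenerator_of_self] at h1
        refine h1.trans ?_
        have h2 := ((h (of x)).mul_left (w ^ (n * s))).mul_right (w ^ (n * s))⁻¹
        rw [add_mul, one_mul, pow_add]
        simpa only [mul_inv_rev, mul_assoc] using h2
    refine (hn p).trans ?_
    have h3 := (((IsTrivialMod.conj q w).augCongr_pow (m + 1) l (of x)).mul_left w).mul_right w⁻¹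
    rw [← _root_.map_pow, MulAut.conj_apply] at h3
    rw [hs, pow_add, pow_one]
    simpa only [mul_inv_rev, mul_assoc] using h3
  refine exists_pow_eq_of_groupRing (D := foxAction x (φ (of x)) 0) hp hw1 ?_
  rw [← foxAction_iterate_replaceGenerator herase, hiter, _root_.map_mul, _root_.map_mul,
    Equiv.Perm.mul_apply, Equiv.Perm.mul_apply, foxAction_of_mem_closure (inv_mem hx), mul_zero,
    foxAction_of_self, foxAction_of_mem_closure hx, zero_add, mul_one]

omit [DecidableEq Y] in
/-- An automorphism of an infinitely generated free group acting trivially modulo `q` is inner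
as soon as its `p`-th power is inner, for some `p` coprime to `q`. -/
theorem exists_eq_conj_of_pow_eq_conj [Infinite Y] (hp : p ≠ 0) (hpq : p.Coprime q) (hq : 2 ≤ q)
    (hφ : IsTrivialMod q φ) (hw : φ ^ p = MulAut.conj w) : ∃ v, φ = MulAut.conj v := by
  by_cases hw1 : w = 1
  · exact ⟨1, by rw [_root_.map_one, eq_one_of_isTrivialMod hpq hq hφ
      (by rw [hw, hw1, _root_.map_one])]⟩
  obtain ⟨v, rfl⟩ := exists_pow_eq_of_pow_eq_conj hp hpq hq hφ hw hw1
  have hfix : φ v = v := by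
    apply pow_left_injective hp
    change φ v ^ p = v ^ p
    rw [← _root_.map_pow]
    apply conj_injective
    rw [← mulAut_mul_conj_mul_inv, ← hw, mul_inv_eq_iff_eq_mul, ← pow_succ, ← pow_succ']
  have hcomm : Commute φ (MulAut.conj v⁻¹) := by
    have h := mulAut_mul_conj_mul_inv φ v⁻¹
    rw [_root_.map_inv φ, hfix, mul_inv_eq_iff_eq_mul] at h
    exact h
  refine ⟨v, ?_⟩
  have h1 : φ * MulAut.conj v⁻¹ = 1 := by
    refine eq_one_of_isTrivialMod hpq hq (hφ.mul (IsTrivialMod.conj q _)) ?_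
    rw [hcomm.mul_pow, hw, ← _root_.map_pow, ← _root_.map_mul, inv_pow, mul_inv_cancel,
      _root_.map_one]
  rwa [_root_.map_inv, mul_inv_eq_one] at h1

end PowEqConj

end FreeGroup

end Torsion

section OuterClasses

theorem toOut_eq_one_iff {G : Type*} [Group G] {φ : MulAut G} :
    toOut φ = 1 ↔ ∃ w, φ = MulAut.conj w := by
  rw [toOut, QuotientGroup.mk'_apply, QuotientGroup.eq_one_iff]
  exact ⟨fun ⟨w, hw⟩ => ⟨w, hw.symm⟩, fun ⟨w, hw⟩ => ⟨w, hw.symm⟩⟩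

/-- An outer automorphism acts trivially modulo `q` if it has a representative which does. -/
def IsOutTrivialMod {G : Type u} [Group G] (q : ℕ) (f : OutAut G) : Prop :=
  ∃ φ, toOut φ = f ∧ IsTrivialMod q φ

namespace IsOutTrivialMod

variable {G : Type u} [Group G] {q : ℕ} {f g : OutAut G}

theorem mul (hf : IsOutTrivialMod q f) (hg : IsOutTrivialMod q g) : IsOutTrivialMod q (f * g) := by
  obtain ⟨φ, rfl, hφ⟩ := hf
  obtain ⟨ψ, rfl, hψ⟩ := hg
  exact ⟨φ * ψ, map_mul _ _ _, hφ.mul hψ⟩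

theorem isConj (hf : IsOutTrivialMod q f) (h : IsConj f g) : IsOutTrivialMod q g := by
  obtain ⟨φ, rfl, hφ⟩ := hf
  obtain ⟨c, rfl⟩ := isConj_iff.mp h
  obtain ⟨σ, rfl⟩ := QuotientGroup.mk'_surjective (Inn G) c
  refine ⟨σ * φ * σ⁻¹, ?_, fun A _ χ hχ g => ?_⟩
  · rw [map_mul, map_mul, map_inv]
    rfl
  · have h1 := hφ A (χ.comp σ.toMonoidHom) (fun g => hχ _) (σ⁻¹ g)
    change χ (σ (φ (σ⁻¹ g))) = χ (σ (σ⁻¹ g)) at h1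
    rwa [MulAut.apply_inv_self] at h1

/-- In the outer automorphism group of an infinitely generated free group, the elements acting
trivially modulo `q` have no torsion coprime to `q`. -/
theorem eq_one_of_pow_eq_one {X : Type u} [Infinite X] {f : OutAut (FreeGroup X)} {p : ℕ}
    (hf : IsOutTrivialMod q f) (hp : p ≠ 0) (hpq : p.Coprime q) (hq : 2 ≤ q) (h : f ^ p = 1) :
    f = 1 := by
  obtain ⟨φ, rfl, hφ⟩ := hf
  rw [← map_pow] at h
  obtain ⟨w, hw⟩ := toOut_eq_one_iff.mp h
  exact toOut_eq_one_iff.mpr (FreeGroup.exists_eq_conj_of_pow_eq_conj hp hpq hq hφ hw)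

end IsOutTrivialMod

theorem IsSoftOutInvolution.isOutTrivialMod_two {X : Type u} {f : OutAut (FreeGroup X)}
    (hf : IsSoftOutInvolution f) : IsOutTrivialMod 2 f := by
  obtain ⟨-, φ, ⟨-, U, S, Y, hB, hU, hS, hY⟩, rfl⟩ := hf
  refine ⟨φ, rfl, fun A _ χ hχ g => ?_⟩
  have h : χ.comp φ.toMonoidHom = χ := by
    refine hB.isBasis.ext fun s hs => ?_
    change χ (φ s) = χ s
    rcases hs with (hs | hs) | hs
    · rw [hU s hs]
    · rw [hS s hs, map_inv, inv_eq_iff_mul_eq_one, ← pow_two, hχ]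
    · simp only [Set.mem_iUnion] at hs
      obtain ⟨x, hx, hs⟩ := hs
      rw [hY x hx s hs, map_mul, map_mul, map_inv, mul_inv_cancel_comm]
  exact DFunLike.congr_fun h g

section AntiComm

variable {G : Type*} [Group G] {a : G}

theorem IsProductOfTwoInvolutionsFromAntiCommClass.conj
    (ha : IsProductOfTwoInvolutionsFromAntiCommClass a) (g : G) :
    IsProductOfTwoInvolutionsFromAntiCommClass (g * a * g⁻¹) := by
  obtain ⟨c, hc, hanti, j₁, j₂, h₁, h₂, rfl⟩ := ha
  refine ⟨c, hc, hanti, g * j₁ * g⁻¹, g * j₂ * g⁻¹, h₁.trans (isConj_iff.mpr ⟨g, rfl⟩),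
    h₂.trans (isConj_iff.mpr ⟨g, rfl⟩), ?_⟩
  rw [conj_mul]

theorem IsInvolution.inv_eq (ha : IsInvolution a) : a⁻¹ = a :=
  inv_eq_of_mul_eq_one_left (by rw [← pow_two, ha.2])

theorem IsInvolution.isConj {b : G} (ha : IsInvolution a) (h : IsConj a b) : IsInvolution b := by
  obtain ⟨c, rfl⟩ := isConj_iff.mp h
  refine ⟨fun h1 => ha.1 (conj_eq_one_iff.mp h1), ?_⟩
  rw [conj_pow, ha.2, mul_one, mul_inv_cancel]

theorem IsProductOfTwoInvolutionsFromAntiCommClass.inv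
    (ha : IsProductOfTwoInvolutionsFromAntiCommClass a) :
    IsProductOfTwoInvolutionsFromAntiCommClass a⁻¹ := by
  obtain ⟨c, hc, hanti, j₁, j₂, h₁, h₂, rfl⟩ := ha
  refine ⟨c, hc, hanti, j₂, j₁, h₂, h₁, ?_⟩
  rw [mul_inv_rev, (hc.isConj h₁).inv_eq, (hc.isConj h₂).inv_eq]

end AntiComm

end OuterClasses

namespace FreeGroup

section Inversion

variable {C : Type v}

/-- The automorphism of a free group inverting all generators. -/
def inversion (C : Type v) : MulAut (FreeGroup C) :=
  MonoidHom.toMulEquiv (lift fun c => (of c)⁻¹) (lift fun c => (of c)⁻¹)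
    (by ext; simp) (by ext; simp)

@[simp]
theorem inversion_of (c : C) : inversion C (of c) = (of c)⁻¹ := by
  simp [inversion]

theorem inversion_mul_self : inversion C * inversion C = 1 := by
  apply MulEquiv.toMonoidHom_injective
  ext c
  simp [MulAut.mul_apply]

theorem map_inversion {A : Type*} [CommGroup A] (χ : FreeGroup C →* A) (g : FreeGroup C) :
    χ (inversion C g) = (χ g)⁻¹ := by
  have h : χ.comp (inversion C).toMonoidHom = (MonoidHom.comp invMonoidHom χ) := by
    ext c
    simp
  exact DFunLike.congr_fun h g

/-- The outer automorphism inverting all elements of the basis given by `e`. -/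
noncomputable def outInversion {X : Type u} (e : FreeGroup C ≃* FreeGroup X) :
    OutAut (FreeGroup X) :=
  toOut (MulAut.congr e (inversion C))

variable {X : Type u} (e : FreeGroup C ≃* FreeGroup X)

theorem isInvolution_outInversion [Nonempty C] : IsInvolution (outInversion e) := by
  constructor
  · intro h
    obtain ⟨w, hw⟩ := toOut_eq_one_iff.mp h
    let c : C := Classical.arbitrary C
    let χ : FreeGroup C →* Multiplicative ℤ := lift fun _ => Multiplicative.ofAdd 1
    have h1 : inversion C (of c) = e.symm w * of c * (e.symm w)⁻¹ := by
      have := DFunLike.congr_fun hw (e (of c))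
      apply e.injective
      simpa [MulAut.congr] using this
    have h2 := congrArg χ h1
    rw [map_inversion, _root_.map_mul, _root_.map_mul, _root_.map_inv, mul_inv_cancel_comm] at h2
    simp only [χ, lift_apply_of] at h2
    have := congrArg Multiplicative.toAdd h2
    simp at this
  · rw [outInversion, ← _root_.map_pow, ← _root_.map_pow, pow_two, inversion_mul_self,
      _root_.map_one, _root_.map_one]

theorem exists_toOut_eq_of_isConj_outInversion {f : OutAut (FreeGroup X)}
    (hf : IsConj (outInversion e) f) : ∃ φ, toOut φ = f ∧
      ∀ (A : Type u) [CommGroup A] (χ : FreeGroup X →* A) (g), χ (φ g) = (χ g)⁻¹ := by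
  obtain ⟨c, rfl⟩ := isConj_iff.mp hf
  obtain ⟨σ, rfl⟩ := QuotientGroup.mk'_surjective (Inn _) c
  refine ⟨σ * MulAut.congr e (inversion C) * σ⁻¹, ?_, fun A _ χ g => ?_⟩
  · rw [_root_.map_mul, _root_.map_mul, _root_.map_inv]
    rfl
  · have h := map_inversion ((χ.comp σ.toMonoidHom).comp e.toMonoidHom) (e.symm (σ⁻¹ g))
    change χ (σ (e (inversion C (e.symm (σ⁻¹ g))))) = (χ (σ (e (e.symm (σ⁻¹ g)))))⁻¹ at h
    rw [e.apply_symm_apply, MulAut.apply_inv_self] at h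
    exact h

theorem antiCommSet_outInversion [Infinite X] [Nonempty C] :
    AntiCommSet {g | IsConj (outInversion e) g} := by
  intro a ha b hb hab hcomm
  have hia := (isInvolution_outInversion e).isConj ha
  have hib := (isInvolution_outInversion e).isConj hb
  obtain ⟨φ, rfl, hφ⟩ := exists_toOut_eq_of_isConj_outInversion e ha
  obtain ⟨ψ, rfl, hψ⟩ := exists_toOut_eq_of_isConj_outInversion e hb
  have h3 : IsOutTrivialMod 3 (toOut φ * toOut ψ) := by
    refine ⟨φ * ψ, _root_.map_mul _ _ _, fun A _ χ _ g => ?_⟩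
    rw [MulAut.mul_apply, hφ, hψ, inv_inv]
  have h1 := h3.eq_one_of_pow_eq_one (p := 2) (by decide) (by decide) (by decide)
    (by rw [Commute.mul_pow hcomm, hia.2, hib.2, one_mul])
  exact hab ((mul_eq_one_iff_eq_inv.mp h1).trans hib.inv_eq)

end Inversion

end FreeGroup

namespace FreeGroup

section PairAutomorphisms

variable {ι : Type u}

/-- The first element of the distinguished pair of generators. -/
def pairFst (ι : Type u) : FreeGroup (Bool ⊕ ι) := of (Sum.inl false)

/-- The second element of the distinguished pair of generators. -/
def pairSnd (ι : Type u) : FreeGroup (Bool ⊕ ι) := of (Sum.inl true)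

theorem pair_hom_ext {H : Type*} [Group H] {f g : FreeGroup (Bool ⊕ ι) →* H}
    (h1 : f (pairFst ι) = g (pairFst ι)) (h2 : f (pairSnd ι) = g (pairSnd ι))
    (h3 : ∀ w, f (map Sum.inr w) = g (map Sum.inr w)) : f = g := by
  refine ext_hom _ _ ?_
  rintro ((_ | _) | i)
  · exact h1
  · exact h2
  · simpa using h3 (of i)

theorem pair_aut_ext {f g : MulAut (FreeGroup (Bool ⊕ ι))}
    (h1 : f (pairFst ι) = g (pairFst ι)) (h2 : f (pairSnd ι) = g (pairSnd ι))
    (h3 : ∀ w, f (map Sum.inr w) = g (map Sum.inr w)) : f = g :=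
  MulEquiv.toMonoidHom_injective (pair_hom_ext h1 h2 h3)

/-- The endomorphism replacing the distinguished pair by `a, b` and fixing the other generators. -/
def pairHom (a b : FreeGroup (Bool ⊕ ι)) : FreeGroup (Bool ⊕ ι) →* FreeGroup (Bool ⊕ ι) :=
  lift (Sum.elim (fun c => cond c b a) fun i => of (Sum.inr i))

variable {a b c d : FreeGroup (Bool ⊕ ι)}

@[simp]
theorem pairHom_fst : pairHom a b (pairFst ι) = a := by simp [pairHom, pairFst]

@[simp]
theorem pairHom_snd : pairHom a b (pairSnd ι) = b := by simp [pairHom, pairSnd]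

@[simp]
theorem pairHom_map_inr (w : FreeGroup ι) : pairHom a b (map Sum.inr w) = map Sum.inr w := by
  have h : (pairHom a b).comp (map Sum.inr) = map Sum.inr := by
    ext i
    simp [pairHom]
  exact DFunLike.congr_fun h w

/-- The automorphism given by two mutually inverse endomorphisms supported on the pair. -/
def pairAut (a b c d : FreeGroup (Bool ⊕ ι))
    (h1 : pairHom c d a = pairFst ι) (h2 : pairHom c d b = pairSnd ι)
    (h3 : pairHom a b c = pairFst ι) (h4 : pairHom a b d = pairSnd ι) :
    MulAut (FreeGroup (Bool ⊕ ι)) :=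
  MonoidHom.toMulEquiv (pairHom a b) (pairHom c d)
    (pair_hom_ext (by simpa using h1) (by simpa using h2) (by simp))
    (pair_hom_ext (by simpa using h3) (by simpa using h4) (by simp))

section

variable {h1 : pairHom c d a = pairFst ι} {h2 : pairHom c d b = pairSnd ι}
  {h3 : pairHom a b c = pairFst ι} {h4 : pairHom a b d = pairSnd ι}

@[simp]
theorem pairAut_fst : pairAut a b c d h1 h2 h3 h4 (pairFst ι) = a := pairHom_fst

@[simp]
theorem pairAut_snd : pairAut a b c d h1 h2 h3 h4 (pairSnd ι) = b := pairHom_snd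

@[simp]
theorem pairAut_map_inr (w : FreeGroup ι) :
    pairAut a b c d h1 h2 h3 h4 (map Sum.inr w) = map Sum.inr w := pairHom_map_inr w

end

@[simp]
theorem inversion_pairFst : inversion (Bool ⊕ ι) (pairFst ι) = (pairFst ι)⁻¹ := inversion_of _

@[simp]
theorem inversion_pairSnd : inversion (Bool ⊕ ι) (pairSnd ι) = (pairSnd ι)⁻¹ := inversion_of _

theorem inversion_map_inr (w : FreeGroup ι) :
    inversion (Bool ⊕ ι) (map Sum.inr w) = map Sum.inr (inversion ι w) := by
  have h : (inversion (Bool ⊕ ι)).toMonoidHom.comp (map Sum.inr) =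
      (map Sum.inr).comp (inversion ι).toMonoidHom := by
    ext i
    simp
  exact DFunLike.congr_fun h w

/-- Conjugation of the first element of the pair by a generator is a product of two inversions. -/
theorem exists_inversion_mul_conj_inversion {t : FreeGroup ι} (ht : inversion ι t = t⁻¹) :
    ∃ a μ : MulAut (FreeGroup (Bool ⊕ ι)),
      a = inversion _ * (μ * inversion _ * μ⁻¹) ∧
      a (pairFst ι) = (map Sum.inr t)⁻¹ * pairFst ι * map Sum.inr t ∧
      a (pairSnd ι) = pairSnd ι ∧ ∀ w, a (map Sum.inr w) = map Sum.inr w := by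
  let μ := pairAut (map Sum.inr t * pairFst ι) (pairSnd ι) ((map Sum.inr t)⁻¹ * pairFst ι)
    (pairSnd ι) (by simp) (by simp) (by simp) (by simp)
  have hμ1 : μ⁻¹ (pairFst ι) = (map Sum.inr t)⁻¹ * pairFst ι := by
    apply μ.injective
    simp [μ]
  have hμ2 : μ⁻¹ (pairSnd ι) = pairSnd ι := by
    apply μ.injective
    simp [μ]
  have hμ3 : ∀ w, μ⁻¹ (map Sum.inr w) = map Sum.inr w := by
    intro w
    apply μ.injective
    simp [μ]
  refine ⟨_, μ, rfl, ?_, ?_, fun w => ?_⟩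
  · simp [MulAut.mul_apply, hμ1, inversion_map_inr, ht, μ, mul_assoc]
  · simp [MulAut.mul_apply, hμ2, μ]
  · have h := DFunLike.congr_fun (inversion_mul_self (C := ι)) w
    rw [MulAut.mul_apply, MulAut.one_apply] at h
    simp only [MulAut.mul_apply, hμ3, inversion_map_inr, μ, pairAut_map_inr, h]

/-- The character counting the first element of the pair. -/
def pairCharacter (ι : Type u) : FreeGroup (Bool ⊕ ι) →* Multiplicative ℤ :=
  lift (Sum.elim (fun c => cond c 1 (Multiplicative.ofAdd 1)) 1)

@[simp]
theorem pairCharacter_fst : pairCharacter ι (pairFst ι) = Multiplicative.ofAdd 1 := by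
  simp [pairCharacter, pairFst]

@[simp]
theorem pairCharacter_snd : pairCharacter ι (pairSnd ι) = 1 := by
  simp [pairCharacter, pairSnd]

end PairAutomorphisms

section PairForm

variable {X : Type u} {ι : Type v} (e : FreeGroup (Bool ⊕ ι) ≃* FreeGroup X)

/-- The outer automorphism of a free group given by an automorphism in a basis. -/
noncomputable def toOutCongr : MulAut (FreeGroup (Bool ⊕ ι)) →* OutAut (FreeGroup X) :=
  toOut.comp (MulAut.congr e).toMonoidHom

theorem toOutCongr_conj (w : FreeGroup (Bool ⊕ ι)) : toOutCongr e (MulAut.conj w) = 1 := by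
  refine toOut_eq_one_iff.mpr ⟨e w, ?_⟩
  ext g
  simp [MulAut.congr]

theorem toOutCongr_ne_one {φ : MulAut (FreeGroup (Bool ⊕ ι))} {A : Type*} [CommGroup A]
    {χ : FreeGroup (Bool ⊕ ι) →* A} {g : FreeGroup (Bool ⊕ ι)} (h : χ (φ g) ≠ χ g) :
    toOutCongr e φ ≠ 1 := by
  intro h1
  obtain ⟨w, hw⟩ := toOut_eq_one_iff.mp h1
  apply h
  have h2 : φ g = e.symm w * g * (e.symm w)⁻¹ := by
    apply e.injective
    simpa [MulAut.congr] using DFunLike.congr_fun hw (e g)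
  rw [h2, _root_.map_mul, _root_.map_mul, _root_.map_inv, mul_inv_cancel_comm]

end PairForm

section PairForm

variable {X : Type u} {ι : Type u} {e : FreeGroup (Bool ⊕ ι) ≃* FreeGroup X}
  {Ψ : MulAut (FreeGroup (Bool ⊕ ι))} {t : FreeGroup ι}

theorem apply_pairSnd (hz : Ψ (pairFst ι) = pairSnd ι)
    (hsq : ∀ g, Ψ (Ψ g) = map Sum.inr t * g * (map Sum.inr t)⁻¹) :
    Ψ (pairSnd ι) = map Sum.inr t * pairFst ι * (map Sum.inr t)⁻¹ := by
  rw [← hz, hsq]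

theorem not_antiCommSet_toOutCongr (hf : IsInvolution (toOutCongr e Ψ))
    (hz : Ψ (pairFst ι) = pairSnd ι) (hrest : ∀ w, ∃ w', Ψ (map Sum.inr w) = map Sum.inr w')
    (hsq : ∀ g, Ψ (Ψ g) = map Sum.inr t * g * (map Sum.inr t)⁻¹)
    (ht : Ψ (map Sum.inr t) = map Sum.inr t) :
    ¬ AntiCommSet {g | IsConj (toOutCongr e Ψ) g} := by
  intro hanti
  have hz' := apply_pairSnd hz hsq
  let η := pairAut (pairFst ι) (pairSnd ι)⁻¹ (pairFst ι) (pairSnd ι)⁻¹ (by simp) (by simp)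
    (by simp) (by simp)
  let ν := pairAut (pairFst ι)⁻¹ (pairSnd ι)⁻¹ (pairFst ι)⁻¹ (pairSnd ι)⁻¹ (by simp) (by simp)
    (by simp) (by simp)
  have hη : η * η = 1 := pair_aut_ext (by simp [η]) (by simp [η]) (by simp [η])
  have hν : ν * ν = 1 := pair_aut_ext (by simp [ν]) (by simp [ν]) (by simp [ν])
  have hmul : Ψ * (η * Ψ * η⁻¹) = MulAut.conj (map Sum.inr t) * ν := by
    rw [inv_eq_of_mul_eq_one_left hη]
    refine pair_aut_ext ?_ ?_ fun w => ?_
    · simp [η, ν, hz, hz', mul_assoc]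
    · simp [η, ν, hz, hz', mul_assoc, ht]
    · obtain ⟨w', hw'⟩ := hrest w
      have h := hsq (map Sum.inr w)
      rw [hw'] at h
      simp [η, ν, hw', h]
  have hmul' : toOutCongr e Ψ * (toOutCongr e η * toOutCongr e Ψ * (toOutCongr e η)⁻¹) =
      toOutCongr e ν := by
    rw [← _root_.map_inv, ← _root_.map_mul, ← _root_.map_mul, ← _root_.map_mul, hmul,
      _root_.map_mul, toOutCongr_conj, one_mul]
  have hconj : IsConj (toOutCongr e Ψ) (toOutCongr e η * toOutCongr e Ψ * (toOutCongr e η)⁻¹) :=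
    isConj_iff.mpr ⟨_, rfl⟩
  set f' := toOutCongr e η * toOutCongr e Ψ * (toOutCongr e η)⁻¹
  have hf' := hf.isConj hconj
  refine hanti _ (IsConj.refl _) f' hconj ?_ ?_
  · intro h
    rw [← h, ← pow_two, hf.2] at hmul'
    refine toOutCongr_ne_one e (χ := pairCharacter ι) (g := pairFst ι) ?_ hmul'.symm
    simp only [ν, pairAut_fst, _root_.map_inv, pairCharacter_fst]
    decide
  · have h : (toOutCongr e ν)⁻¹ = toOutCongr e ν := by
      rw [← _root_.map_inv, inv_eq_of_mul_eq_one_left hν]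
    rw [← hmul', mul_inv_rev, hf.inv_eq, hf'.inv_eq] at h
    exact h.symm

theorem exists_orderOf_eq_three [Infinite X] (hf : IsInvolution (toOutCongr e Ψ))
    (hz : Ψ (pairFst ι) = pairSnd ι) (hrest : ∀ w, ∃ w', Ψ (map Sum.inr w) = map Sum.inr w')
    (hsq : ∀ g, Ψ (Ψ g) = map Sum.inr t * g * (map Sum.inr t)⁻¹)
    (hinv : inversion ι t = t⁻¹) :
    ∃ a₁ a₂ f₁ f₂, IsProductOfTwoInvolutionsFromAntiCommClass a₁ ∧
      IsProductOfTwoInvolutionsFromAntiCommClass a₂ ∧ IsConj (toOutCongr e Ψ) f₁ ∧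
      IsConj (toOutCongr e Ψ) f₂ ∧ orderOf (a₁ * f₁ * a₂ * f₂) = 3 := by
  have hz' := apply_pairSnd hz hsq
  obtain ⟨a, μ, ha, ha1, ha2, ha3⟩ := exists_inversion_mul_conj_inversion hinv
  have hprod : IsProductOfTwoInvolutionsFromAntiCommClass (toOutCongr e a) := by
    refine ⟨outInversion e, isInvolution_outInversion e, antiCommSet_outInversion e,
      toOutCongr e (inversion _), toOutCongr e (μ * inversion _ * μ⁻¹), IsConj.refl _,
      isConj_iff.mpr ⟨toOutCongr e μ, ?_⟩, ?_⟩
    · rw [_root_.map_mul, _root_.map_mul, _root_.map_inv]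
      rfl
    · rw [ha, _root_.map_mul]
  let α := pairAut (pairSnd ι) ((pairFst ι)⁻¹ * pairSnd ι) (pairFst ι * (pairSnd ι)⁻¹) (pairFst ι)
    (by simp) (by simp) (by simp) (by simp)
  let ξ := a * Ψ * α * (a * Ψ)⁻¹ * α⁻¹
  have hcomm : ∀ g, ξ (α (a (Ψ g))) = a (Ψ (α g)) := by
    intro g
    have h : ξ * (α * (a * Ψ)) = a * Ψ * α := by simp only [ξ]; group
    exact DFunLike.congr_fun h g
  have h2 : ξ (pairSnd ι) = (pairSnd ι)⁻¹ * pairFst ι := by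
    have h := hcomm (pairSnd ι)
    simpa [hz', α, ha1, ha2, ha3, hz, mul_assoc] using h
  have h1 : ξ (pairFst ι) = (pairSnd ι)⁻¹ := by
    have h := hcomm (pairFst ι)
    simp only [hz, α, ha2, pairAut_snd, pairAut_fst, hz', _root_.map_mul, _root_.map_inv, h2,
      ha1, ha3] at h
    rw [inv_mul_eq_iff_eq_mul] at h
    have h' := congrArg (fun g => g * ((pairFst ι)⁻¹)) h
    simpa [mul_assoc] using h'.symm
  have h3 : ∀ w, ξ (map Sum.inr w) = map Sum.inr w := by
    intro w
    obtain ⟨w', hw'⟩ := hrest (t⁻¹ * w * t)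
    have hΨ : Ψ (map Sum.inr w') = map Sum.inr w := by
      rw [← hw', hsq]
      simp [mul_assoc]
    have h := hcomm (map Sum.inr w')
    simpa [hΨ, ha3, α] using h
  have hξ : ξ ^ 3 = 1 := by
    rw [pow_succ, pow_two]
    refine pair_aut_ext ?_ ?_ fun w => ?_
    · simp [h1, h2]
    · simp [h1, h2]
    · simp [h3]
  have hne : toOutCongr e ξ ≠ 1 := by
    refine toOutCongr_ne_one e (χ := pairCharacter ι) (g := pairFst ι) ?_
    rw [h1, _root_.map_inv, pairCharacter_fst, pairCharacter_snd]
    decide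
  set A := toOutCongr e a
  set B := toOutCongr e α
  set f := toOutCongr e Ψ
  refine ⟨A, (B * f) * A⁻¹ * (B * f)⁻¹, f, B * f * B⁻¹, hprod, hprod.inv.conj _, IsConj.refl _,
    isConj_iff.mpr ⟨B, rfl⟩, ?_⟩
  have heq : A * f * ((B * f) * A⁻¹ * (B * f)⁻¹) * (B * f * B⁻¹) = toOutCongr e ξ := by
    have h : toOutCongr e ξ = A * f * B * (A * f)⁻¹ * B⁻¹ := by
      simp only [ξ, _root_.map_mul, _root_.map_inv, A, B, f]
    rw [h, mul_inv_rev A f, hf.inv_eq]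
    group
  rw [heq]
  refine orderOf_eq_prime ?_ hne
  rw [← _root_.map_pow, hξ, _root_.map_one]

end PairForm

end FreeGroup

section Main

variable {X : Type u}

theorem HasPairForm.exists_pairAut {f : OutAut (FreeGroup X)} (h : HasPairForm f) :
    ∃ (ι : Type u) (e : FreeGroup (Bool ⊕ ι) ≃* FreeGroup X) (Ψ : MulAut (FreeGroup (Bool ⊕ ι)))
      (t : FreeGroup ι), FreeGroup.inversion ι t = t⁻¹ ∧ FreeGroup.toOutCongr e Ψ = f ∧
      Ψ (FreeGroup.pairFst ι) = FreeGroup.pairSnd ι ∧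
      (∀ w, ∃ w', Ψ (FreeGroup.map Sum.inr w) = FreeGroup.map Sum.inr w') ∧
      (∀ g, Ψ (Ψ g) = FreeGroup.map Sum.inr t * g * (FreeGroup.map Sum.inr t)⁻¹) ∧
      Ψ (FreeGroup.map Sum.inr t) = FreeGroup.map Sum.inr t := by
  obtain ⟨ι, e, ψ, t, ht, rfl, hz, hrest, hsq, hfix⟩ := h
  have happ : ∀ g, (MulAut.congr e).symm ψ g = e.symm (ψ (e g)) := fun g => rfl
  refine ⟨ι, e, (MulAut.congr e).symm ψ, t, ?_, ?_, ?_, fun w => ?_, fun g => ?_, ?_⟩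
  · rcases ht with rfl | ⟨i, rfl⟩ <;> simp
  · change toOut (MulAut.congr e ((MulAut.congr e).symm ψ)) = _
    rw [MulEquiv.apply_symm_apply]
  · exact (happ _).trans ((congrArg e.symm hz).trans (e.symm_apply_apply _))
  · choose r hr using hrest
    refine ⟨FreeGroup.lift r w, ?_⟩
    have h : (((MulAut.congr e).symm ψ).toMonoidHom).comp (FreeGroup.map Sum.inr) =
        (FreeGroup.map Sum.inr).comp (FreeGroup.lift r) := by
      ext i
      simp [hr]
    exact DFunLike.congr_fun h w
  · rw [happ, happ, e.apply_symm_apply, hsq]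
    simp
  · rw [happ, hfix, e.symm_apply_apply]

theorem HasPairForm.not_antiCommSet {f : OutAut (FreeGroup X)} (h : HasPairForm f)
    (hf : IsInvolution f) : ¬ AntiCommSet {g | IsConj f g} := by
  obtain ⟨ι, e, Ψ, t, -, rfl, hz, hrest, hsq, hfix⟩ := h.exists_pairAut
  exact FreeGroup.not_antiCommSet_toOutCongr hf hz hrest hsq hfix

theorem HasPairForm.exists_orderOf_eq_three [Infinite X] {f : OutAut (FreeGroup X)}
    (h : HasPairForm f) (hf : IsInvolution f) :
    ∃ a₁ a₂ f₁ f₂, IsProductOfTwoInvolutionsFromAntiCommClass a₁ ∧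
      IsProductOfTwoInvolutionsFromAntiCommClass a₂ ∧ IsConj f f₁ ∧ IsConj f f₂ ∧
      orderOf (a₁ * f₁ * a₂ * f₂) = 3 := by
  obtain ⟨ι, e, Ψ, t, hinv, rfl, hz, hrest, hsq, -⟩ := h.exists_pairAut
  exact FreeGroup.exists_orderOf_eq_three hf hz hrest hsq hinv

theorem IsProductOfTwoInvolutionsFromAntiCommClass.isOutTrivialMod_two [Infinite X]
    {a : OutAut (FreeGroup X)} (ha : IsProductOfTwoInvolutionsFromAntiCommClass a) :
    IsOutTrivialMod 2 a := by
  obtain ⟨c, hc, hanti, j₁, j₂, h₁, h₂, rfl⟩ := ha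
  rcases isSoftOutInvolution_or_hasPairForm hc with h | h
  · exact (h.isOutTrivialMod_two.isConj h₁).mul (h.isOutTrivialMod_two.isConj h₂)
  · exact (h.not_antiCommSet hc hanti).elim

end Main

/-- An involution `f ∈ Out F` is soft iff no element of the form `a₁ f₁ a₂ f₂` has order
three, where `f₁, f₂` are conjugates of `f` and each `aᵢ` is a product of two involutions
taken from a single anti-commutative conjugacy class of `Out F`. -/
theorem soft_involution_iff_no_order_three_products (X : Type*) [Infinite X]
    (f : OutAut (FreeGroup X)) (hf : IsInvolution f) :
    IsSoftOutInvolution f ↔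
      ∀ a₁ a₂ f₁ f₂ : OutAut (FreeGroup X),
        IsProductOfTwoInvolutionsFromAntiCommClass a₁ →
        IsProductOfTwoInvolutionsFromAntiCommClass a₂ →
        IsConj f f₁ → IsConj f f₂ →
        orderOf (a₁ * f₁ * a₂ * f₂) ≠ 3 := by
  constructor
  · intro hsoft a₁ a₂ f₁ f₂ ha₁ ha₂ hf₁ hf₂ h3
    have hmod := hsoft.isOutTrivialMod_two
    have h := ((ha₁.isOutTrivialMod_two.mul (hmod.isConj hf₁)).mul
      ha₂.isOutTrivialMod_two).mul (hmod.isConj hf₂)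
    have h1 := h.eq_one_of_pow_eq_one (p := 3) (by decide) (by decide) le_rfl
      (h3 ▸ pow_orderOf_eq_one _)
    rw [h1, orderOf_one] at h3
    exact absurd h3 (by decide)
  · intro h
    rcases isSoftOutInvolution_or_hasPairForm hf with hsoft | hpair
    · exact hsoft
    · obtain ⟨a₁, a₂, f₁, f₂, ha₁, ha₂, hf₁, hf₂, h3⟩ := hpair.exists_orderOf_eq_three hf
      exact (h a₁ a₂ f₁ f₂ ha₁ ha₂ hf₁ hf₂ h3).elim
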